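/- (Corollary 3.5.) The convex Blaschke–Santaló diagram satisfies the inclusion 𝓔ᶜ ⊆ { (x,y) ∈ ℝ² : x ≥ π·λ₁(𝔻) and π⁴/(4x) < y ≤ min( π·μ₁(𝔻), 9π²·λ₁(𝔻)/x ) }, where 𝔻 is the open unit disc. -/

import Mathlib

open MeasureTheory Filter Set Real RealInnerProductSpace

noncomputable section

abbrev E2 : Type := EuclideanSpace ℝ (Fin 2)

/-- First Dirichlet eigenvalue, variational characterization. -/
noncomputable def dEig1 (Ω : Set E2) : ℝ :=
  sInf { R : ℝ | ∃ u : E2 → ℝ, ContDiff ℝ (⊤ : ℕ∞) u ∧ HasCompactSupport u ∧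
    tsupport u ⊆ Ω ∧ (∫ x, (u x)^2) ≠ 0 ∧
    R = (∫ x, ‖fderiv ℝ u x‖^2) / (∫ x, (u x)^2) }

/-- First nontrivial Neumann eigenvalue, variational characterization. -/
noncomputable def nEig1 (Ω : Set E2) : ℝ :=
  sInf { R : ℝ | ∃ u : E2 → ℝ, ContDiff ℝ (⊤ : ℕ∞) u ∧ (∫ x in Ω, u x) = 0 ∧
    (∫ x in Ω, (u x)^2) ≠ 0 ∧
    R = (∫ x in Ω, ‖fderiv ℝ u x‖^2) / (∫ x in Ω, (u x)^2) }

/-- The open unit disc in the plane. -/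
def unitDisc : Set E2 := Metric.ball 0 1

/-- The Blaschke–Santaló diagram 𝓔ᶜ for bounded open convex sets. -/
def diagEC : Set (ℝ × ℝ) :=
  { p | ∃ Ω : Set E2, Ω.Nonempty ∧ IsOpen Ω ∧ Bornology.IsBounded Ω ∧ Convex ℝ Ω ∧
      p = ((volume Ω).toReal * dEig1 Ω, (volume Ω).toReal * nEig1 Ω) }

/-- Weighted Riccati (Jacobi) inequality. -/
lemma riccati {a b : ℝ} (hab : a ≤ b) {f f' w Q Q' : ℝ → ℝ}
    (hf : ∀ x ∈ Icc a b, HasDerivAt f (f' x) x) (hf' : ContinuousOn f' (Icc a b))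
    (hQ : ∀ x ∈ Icc a b, HasDerivAt Q (Q' x) x) (hQ' : ContinuousOn Q' (Icc a b))
    (hw : ContinuousOn w (Icc a b)) (hw0 : ∀ x ∈ Icc a b, 0 < w x) :
    f b ^ 2 * Q b - f a ^ 2 * Q a ≤
      (∫ x in a..b, w x * f' x ^ 2) + ∫ x in a..b, (Q' x + Q x ^ 2 / w x) * f x ^ 2 := by
  have hfc : ContinuousOn f (Icc a b) := fun x hx => (hf x hx).continuousAt.continuousWithinAt
  have hQc : ContinuousOn Q (Icc a b) := fun x hx => (hQ x hx).continuousAt.continuousWithinAt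
  have hw1 : ∀ x ∈ Icc a b, w x ≠ 0 := fun x hx => (hw0 x hx).ne'
  have i1 : IntervalIntegrable (fun x => w x * f' x ^ 2) volume a b :=
    ContinuousOn.intervalIntegrable_of_Icc hab (by fun_prop)
  have i2 : IntervalIntegrable (fun x => (Q' x + Q x ^ 2 / w x) * f x ^ 2) volume a b :=
    ContinuousOn.intervalIntegrable_of_Icc hab (by fun_prop (disch := assumption))
  have i3 : IntervalIntegrable (fun x => 2 * f x * f' x * Q x + f x ^ 2 * Q' x) volume a b :=
    ContinuousOn.intervalIntegrable_of_Icc hab (by fun_prop)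
  have h1 : ∫ x in a..b, (2 * f x * f' x * Q x + f x ^ 2 * Q' x) = f b ^ 2 * Q b - f a ^ 2 * Q a := by
    apply intervalIntegral.integral_eq_sub_of_hasDerivAt (f := fun x => f x ^ 2 * Q x)
    · intro x hx
      rw [uIcc_of_le hab] at hx
      have := ((hf x hx).pow 2).mul (hQ x hx)
      exact this.congr_deriv (by simp)
    · exact i3
  rw [← h1, ← intervalIntegral.integral_add i1 i2]
  apply intervalIntegral.integral_mono_on hab i3 (i1.add i2)
  intro x hx
  have hwx := hw0 x hx
  have : w x * f' x ^ 2 + (Q' x + Q x ^ 2 / w x) * f x ^ 2 -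
      (2 * f x * f' x * Q x + f x ^ 2 * Q' x) = w x * (f' x - Q x * f x / w x) ^ 2 := by
    field_simp
    ring
  have h2 : 0 ≤ w x * (f' x - Q x * f x / w x) ^ 2 := by positivity
  linarith

lemma hasDerivAt_ctan (k m x : ℝ) (h : |k * (x - m)| < π / 2) :
    HasDerivAt (fun s => - k * tan (k * (s - m))) (-k ^ 2 - (- k * tan (k * (x - m))) ^ 2) x := by
  rw [abs_lt] at h
  have hc : 0 < cos (k * (x - m)) := cos_pos_of_mem_Ioo ⟨by linarith [h.1], h.2⟩
  have h1 := (hasDerivAt_tan hc.ne').comp x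
    (((hasDerivAt_id x).sub_const m).const_mul k)
  have h2 := h1.const_mul (-k)
  refine h2.congr_deriv ?_
  rw [tan_eq_sin_div_cos]
  have := sin_sq_add_cos_sq (k * (x - m))
  field_simp
  linear_combination (k^2) * this

lemma continuousOn_ctan (k m : ℝ) (s : Set ℝ) (h : ∀ x ∈ s, |k * (x - m)| < π / 2) :
    ContinuousOn (fun s => - k * tan (k * (s - m))) s :=
  fun x hx => (hasDerivAt_ctan k m x (h x hx)).continuousAt.continuousWithinAt

lemma wirtinger_tan {a b k m : ℝ} (hab : a ≤ b) {f f' : ℝ → ℝ}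
    (hf : ∀ x ∈ Icc a b, HasDerivAt f (f' x) x) (hf' : ContinuousOn f' (Icc a b))
    (hk : ∀ x ∈ Icc a b, |k * (x - m)| < π / 2) (ha : f a = 0 ∨ a = m) (hb : f b = 0 ∨ b = m) :
    k ^ 2 * (∫ x in a..b, f x ^ 2) ≤ ∫ x in a..b, f' x ^ 2 := by
  have hc := continuousOn_ctan k m _ hk
  have := riccati hab hf hf' (w := fun _ => 1) (fun x hx => hasDerivAt_ctan k m x (hk x hx))
    (by fun_prop) (by fun_prop) (by simp)
  have e1 : f a ^ 2 * (-k * tan (k * (a - m))) = 0 := by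
    rcases ha with h | h <;> simp [h]
  have e2 : f b ^ 2 * (-k * tan (k * (b - m))) = 0 := by
    rcases hb with h | h <;> simp [h]
  rw [e1, e2] at this
  have e3 : (∫ x in a..b, (-k ^ 2 - (-k * tan (k * (x - m))) ^ 2 +
      (-k * tan (k * (x - m))) ^ 2 / 1) * f x ^ 2) = - (k ^ 2 * ∫ x in a..b, f x ^ 2) := by
    rw [← intervalIntegral.integral_const_mul, ← intervalIntegral.integral_neg]
    congr 1; ext x; ring
  rw [e3] at this
  simp only [one_mul] at this
  linarith

lemma sq_mul_le_of_forall_lt {k0 A B : ℝ} (hk0 : 0 < k0)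
    (h : ∀ k, 0 < k → k < k0 → k ^ 2 * A ≤ B) : k0 ^ 2 * A ≤ B := by
  have ht : Tendsto (fun k : ℝ => k ^ 2 * A) (nhdsWithin k0 (Iio k0)) (nhds (k0 ^ 2 * A)) := by
    apply Tendsto.mono_left _ nhdsWithin_le_nhds
    exact Continuous.tendsto (by fun_prop) k0
  apply le_of_tendsto ht
  filter_upwards [Ioo_mem_nhdsLT hk0] with k hk
  exact h k hk.1 hk.2

/-- Dirichlet at right end, free at left end. -/
lemma wirtinger_right {a b : ℝ} (hab : a < b) {f f' : ℝ → ℝ}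
    (hf : ∀ x ∈ Icc a b, HasDerivAt f (f' x) x) (hf' : ContinuousOn f' (Icc a b))
    (hb : f b = 0) :
    (π / (2 * (b - a))) ^ 2 * (∫ x in a..b, f x ^ 2) ≤ ∫ x in a..b, f' x ^ 2 := by
  have hba : 0 < b - a := by linarith
  apply sq_mul_le_of_forall_lt (by positivity)
  intro k hk0 hk
  refine wirtinger_tan (m := a) hab.le hf hf' ?_ (Or.inr rfl) (Or.inl hb)
  intro x hx
  rw [abs_of_nonneg (mul_nonneg hk0.le (by linarith [hx.1]))]
  rw [lt_div_iff₀ (by positivity)] at hk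
  nlinarith [hx.1, hx.2]

/-- Dirichlet at both ends. -/
lemma wirtinger_both {a b : ℝ} (hab : a < b) {f f' : ℝ → ℝ}
    (hf : ∀ x ∈ Icc a b, HasDerivAt f (f' x) x) (hf' : ContinuousOn f' (Icc a b))
    (ha : f a = 0) (hb : f b = 0) :
    (π / (b - a)) ^ 2 * (∫ x in a..b, f x ^ 2) ≤ ∫ x in a..b, f' x ^ 2 := by
  have hba : 0 < b - a := by linarith
  apply sq_mul_le_of_forall_lt (by positivity)
  intro k hk0 hk
  refine wirtinger_tan (m := (a + b) / 2) hab.le hf hf' ?_ (Or.inl ha) (Or.inl hb)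
  intro x hx
  rw [lt_div_iff₀ (by positivity)] at hk
  rw [abs_lt]
  constructor <;> nlinarith [hx.1, hx.2]

/-- Smooth case of the one dimensional weighted Payne-Weinberger inequality. -/
lemma pw_aux {L : ℝ} {a b : ℝ} (hab : a < b) (hL : b - a ≤ L) {p p' p'' F F' : ℝ → ℝ}
    (hp : ∀ x ∈ Icc a b, HasDerivAt p (p' x) x) (hp' : ∀ x ∈ Icc a b, HasDerivAt p' (p'' x) x)
    (hpc : ContinuousOn p'' (Icc a b)) (hpos : ∀ x ∈ Icc a b, 0 < p x)
    (hconc : ∀ x ∈ Icc a b, p'' x ≤ 0)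
    (hF : ∀ x ∈ Icc a b, HasDerivAt F (F' x) x) (hF' : ContinuousOn F' (Icc a b))
    (ha : F a = 0) (hb : F b = 0) :
    (π / L) ^ 2 * (∫ x in a..b, F x ^ 2 / p x) ≤ ∫ x in a..b, F' x ^ 2 / p x := by
  have hba : 0 < b - a := by linarith
  have hLpos : 0 < L := by linarith
  apply sq_mul_le_of_forall_lt (by positivity)
  intro k hk0 hk
  set m := (a + b) / 2
  have hkk : ∀ x ∈ Icc a b, |k * (x - m)| < π / 2 := by
    intro x hx
    rw [lt_div_iff₀ (by positivity)] at hk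
    rw [abs_lt]
    simp only [m]
    constructor <;> nlinarith [hx.1, hx.2]
  have hcc := continuousOn_ctan k m _ hkk
  have hpcont : ContinuousOn p (Icc a b) := fun x hx => (hp x hx).continuousAt.continuousWithinAt
  have hp'cont : ContinuousOn p' (Icc a b) := fun x hx => (hp' x hx).continuousAt.continuousWithinAt
  have hFcont : ContinuousOn F (Icc a b) := fun x hx => (hF x hx).continuousAt.continuousWithinAt
  have hne : ∀ x ∈ Icc a b, p x ≠ 0 := fun x hx => (hpos x hx).ne'
  have hne2 : ∀ x ∈ Icc a b, 2 * p x ≠ 0 := fun x hx => mul_ne_zero two_ne_zero (hne x hx)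
  have hne3 : ∀ x ∈ Icc a b, (2 * p x) ^ 2 ≠ 0 := fun x hx => pow_ne_zero _ (hne2 x hx)
  have hne4 : ∀ x ∈ Icc a b, (p x) ^ 2 ≠ 0 := fun x hx => pow_ne_zero _ (hne x hx)
  let c : ℝ → ℝ := fun s => - k * tan (k * (s - m))
  have key := riccati (f := F) (f' := F') (w := fun x => 1 / p x)
    (Q := fun x => (p' x / (2 * p x) + c x) / p x)
    (Q' := fun x => (((p'' x * (2 * p x) - p' x * (2 * p' x)) / (2 * p x) ^ 2
        + (-k ^ 2 - (c x) ^ 2)) * p x -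
        (p' x / (2 * p x) + c x) * p' x) / (p x) ^ 2) hab.le hF hF' ?_ ?_ ?_ ?_
  · simp only [ha, hb] at key
    have e1 : ∀ x ∈ Icc a b, ((((p'' x * (2 * p x) - p' x * (2 * p' x)) / (2 * p x) ^ 2
        + (-k ^ 2 - (c x) ^ 2)) * p x -
        (p' x / (2 * p x) + c x) * p' x) / (p x) ^ 2 +
        ((p' x / (2 * p x) + c x) / p x) ^ 2 / (1 / p x)) * F x ^ 2 ≤ - (k ^ 2 * (F x ^ 2 / p x)) := by
      intro x hx
      have hpx := hpos x hx
      have : ((((p'' x * (2 * p x) - p' x * (2 * p' x)) / (2 * p x) ^ 2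
        + (-k ^ 2 - (c x) ^ 2)) * p x -
        (p' x / (2 * p x) + c x) * p' x) / (p x) ^ 2 +
        ((p' x / (2 * p x) + c x) / p x) ^ 2 / (1 / p x)) = (p'' x / (2 * p x) -
          3 / 4 * (p' x / p x) ^ 2 - k ^ 2) / p x := by
        field_simp
        ring
      rw [this]
      have h3 : p'' x / (2 * p x) ≤ 0 := div_nonpos_of_nonpos_of_nonneg (hconc x hx) (by positivity)
      have h4 : (p'' x / (2 * p x) - 3 / 4 * (p' x / p x) ^ 2 - k ^ 2) ≤ - k ^ 2 := by
        nlinarith [sq_nonneg (p' x / p x)]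
      calc _ ≤ (- k^2) / p x * F x ^ 2 := by gcongr
        _ = _ := by ring
    have e2 : (∫ x in a..b, ((((p'' x * (2 * p x) - p' x * (2 * p' x)) / (2 * p x) ^ 2
        + (-k ^ 2 - (c x) ^ 2)) * p x -
        (p' x / (2 * p x) + c x) * p' x) / (p x) ^ 2 +
        ((p' x / (2 * p x) + c x) / p x) ^ 2 / (1 / p x)) * F x ^ 2) ≤
        ∫ x in a..b, - (k ^ 2 * (F x ^ 2 / p x)) := by
      apply intervalIntegral.integral_mono_on hab.le _ _ e1
      · apply ContinuousOn.intervalIntegrable_of_Icc hab.le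
        have : ∀ x ∈ Icc a b, 1 / p x ≠ 0 := fun x hx => one_div_ne_zero (hne x hx)
        fun_prop (disch := assumption)
      · apply ContinuousOn.intervalIntegrable_of_Icc hab.le
        fun_prop (disch := assumption)
    rw [intervalIntegral.integral_neg, intervalIntegral.integral_const_mul] at e2
    have e3 : (∫ x in a..b, 1 / p x * F' x ^ 2) = ∫ x in a..b, F' x ^ 2 / p x := by
      congr 1; ext x; ring
    rw [e3] at key
    linarith
  · intro x hx
    have := (((hp' x hx).div ((hp x hx).const_mul 2) (hne2 x hx)).add
      (hasDerivAt_ctan k m x (hkk x hx))).div (hp x hx) (hne x hx)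
    exact this
  · have hcc' : ContinuousOn c (Icc a b) := hcc
    fun_prop (disch := assumption)
  · fun_prop (disch := assumption)
  · intro x hx
    have := hpos x hx
    positivity

/-- The duality trick, smooth positive weight. -/
lemma pw_smooth {L : ℝ} {a b : ℝ} (hab : a < b) (hL : b - a ≤ L) {p p' p'' u u' : ℝ → ℝ}
    (hp : ∀ x, HasDerivAt p (p' x) x) (hp' : ∀ x, HasDerivAt p' (p'' x) x)
    (hpc : Continuous p'') (hpos : ∀ x ∈ Icc a b, 0 < p x)
    (hconc : ∀ x ∈ Icc a b, p'' x ≤ 0)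
    (hu : ∀ x, HasDerivAt u (u' x) x) (hu' : Continuous u')
    (hz : ∫ x in a..b, u x * p x = 0) :
    (π / L) ^ 2 * (∫ x in a..b, u x ^ 2 * p x) ≤ ∫ x in a..b, u' x ^ 2 * p x := by
  have hba : 0 < b - a := by linarith
  have hLpos : 0 < L := by linarith
  have hpcont : Continuous p := continuous_iff_continuousAt.2 fun x => (hp x).continuousAt
  have hucont : Continuous u := continuous_iff_continuousAt.2 fun x => (hu x).continuousAt
  have hne : ∀ x ∈ Icc a b, p x ≠ 0 := fun x hx => (hpos x hx).ne'
  let F : ℝ → ℝ := fun x => ∫ t in a..x, u t * p t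
  have hF : ∀ x, HasDerivAt F (u x * p x) x := fun x =>
    (hucont.mul hpcont).integral_hasStrictDerivAt a x |>.hasDerivAt
  have hFcont : Continuous F := continuous_iff_continuousAt.2 fun x => (hF x).continuousAt
  have h1 := pw_aux hab hL (fun x _ => hp x) (fun x _ => hp' x) hpc.continuousOn hpos hconc
    (fun x _ => hF x) (hucont.mul hpcont).continuousOn (by simp [F]) (by simp [F, hz])
  have h2 : (∫ x in a..b, (u x * p x) ^ 2 / p x) = ∫ x in a..b, u x ^ 2 * p x := by
    apply intervalIntegral.integral_congr
    intro x hx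
    rw [uIcc_of_le hab.le] at hx
    have := hne x hx
    simp only
    field_simp
  rw [h2] at h1
  -- integration by parts
  have h3 : (∫ x in a..b, u x ^ 2 * p x) = - ∫ x in a..b, F x * u' x := by
    have := intervalIntegral.integral_mul_deriv_eq_deriv_mul (a := a) (b := b) (u := u) (v := F)
      (u' := u') (v' := fun x => u x * p x) (fun x _ => hu x) (fun x _ => hF x)
      (hu'.intervalIntegrable _ _) ((hucont.mul hpcont).intervalIntegrable _ _)
    have e : F b = 0 := hz
    have e' : F a = 0 := by simp [F]
    rw [e, e'] at this
    have e4 : (∫ x in a..b, u x ^ 2 * p x) = ∫ x in a..b, u x * (u x * p x) := by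
      congr 1; ext x; ring
    rw [e4, this]
    simp
    congr 1; ext x; ring
  set κ := π / L with hκ
  have hκ0 : 0 < κ := by positivity
  have h4 : - (∫ x in a..b, F x * u' x) ≤ ∫ x in a..b, (1 / (2 * κ ^ 2) * (u' x ^ 2 * p x) +
      κ ^ 2 / 2 * (F x ^ 2 / p x)) := by
    rw [← intervalIntegral.integral_neg]
    apply intervalIntegral.integral_mono_on hab.le
    · exact (Continuous.intervalIntegrable (by fun_prop) _ _)
    · apply ContinuousOn.intervalIntegrable_of_Icc hab.le
      fun_prop (disch := assumption)
    · intro x hx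
      have hpx := hpos x hx
      have : 1 / (2 * κ ^ 2) * (u' x ^ 2 * p x) + κ ^ 2 / 2 * (F x ^ 2 / p x) - (-(F x * u' x)) =
        p x / (2 * κ ^ 2) * (u' x + κ ^ 2 * F x / p x) ^ 2 := by
        field_simp
        ring
      have h5 : 0 ≤ p x / (2 * κ ^ 2) * (u' x + κ ^ 2 * F x / p x) ^ 2 := by positivity
      linarith
  rw [intervalIntegral.integral_add, intervalIntegral.integral_const_mul,
    intervalIntegral.integral_const_mul, ← h3] at h4
  · have h5 : (∫ x in a..b, u x ^ 2 * p x) ≤ 1 / κ ^ 2 * ∫ x in a..b, u' x ^ 2 * p x := by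
      have : 1 / (2 * κ ^ 2) = 1 / 2 * (1 / κ ^ 2) := by field_simp
      rw [this] at h4
      linarith
    calc _ ≤ κ ^ 2 * (1 / κ ^ 2 * ∫ x in a..b, u' x ^ 2 * p x) := by gcongr
      _ = _ := by field_simp
  · exact Continuous.intervalIntegrable (by fun_prop) _ _
  · apply ContinuousOn.intervalIntegrable_of_Icc hab.le
    fun_prop (disch := assumption)

lemma pw_smooth' {L : ℝ} {a b : ℝ} (hab : a < b) (hL : b - a ≤ L) {p p' p'' u u' : ℝ → ℝ}
    (hp : ∀ x, HasDerivAt p (p' x) x) (hp' : ∀ x, HasDerivAt p' (p'' x) x)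
    (hpc : Continuous p'') (hpos : ∀ x ∈ Icc a b, 0 < p x)
    (hconc : ∀ x ∈ Icc a b, p'' x ≤ 0)
    (hu : ∀ x, HasDerivAt u (u' x) x) (hu' : Continuous u') :
    (π / L) ^ 2 * ((∫ x in a..b, u x ^ 2 * p x) * (∫ x in a..b, p x) - (∫ x in a..b, u x * p x) ^ 2)
      ≤ (∫ x in a..b, u' x ^ 2 * p x) * (∫ x in a..b, p x) := by
  have hpcont : Continuous p := continuous_iff_continuousAt.2 fun x => (hp x).continuousAt
  have hucont : Continuous u := continuous_iff_continuousAt.2 fun x => (hu x).continuousAt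
  have hI : 0 < ∫ x in a..b, p x :=
    intervalIntegral.intervalIntegral_pos_of_pos_on (hpcont.intervalIntegrable _ _)
      (fun x hx => hpos x (Ioo_subset_Icc_self hx)) hab
  set I := ∫ x in a..b, p x with hIdef
  set J := ∫ x in a..b, u x * p x with hJdef
  have e0 : (∫ x in a..b, (u x - J / I) * p x) = 0 := by
    have : (∫ x in a..b, (u x - J / I) * p x) = ∫ x in a..b, (u x * p x - J / I * p x) := by
      congr 1; ext x; ring
    rw [this, intervalIntegral.integral_sub (Continuous.intervalIntegrable (by fun_prop) _ _)
      (Continuous.intervalIntegrable (by fun_prop) _ _), intervalIntegral.integral_const_mul,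
      ← hIdef, ← hJdef]
    field_simp
    simp
  have h1 := pw_smooth hab hL hp hp' hpc hpos hconc (u := fun x => u x - J / I) (u' := u')
    (fun x => (hu x).sub_const _) hu' e0
  have e1 : (∫ x in a..b, (u x - J / I) ^ 2 * p x) = (∫ x in a..b, u x ^ 2 * p x) - J ^ 2 / I := by
    have : (∫ x in a..b, (u x - J / I) ^ 2 * p x) =
        ∫ x in a..b, ((u x ^ 2 * p x - 2 * (J / I) * (u x * p x)) + (J / I) ^ 2 * p x) := by
      congr 1; ext x; ring
    rw [this, intervalIntegral.integral_add (Continuous.intervalIntegrable (by fun_prop) _ _)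
      (Continuous.intervalIntegrable (by fun_prop) _ _),
      intervalIntegral.integral_sub (Continuous.intervalIntegrable (by fun_prop) _ _)
      (Continuous.intervalIntegrable (by fun_prop) _ _), intervalIntegral.integral_const_mul,
      intervalIntegral.integral_const_mul, ← hIdef, ← hJdef]
    field_simp
    ring
  rw [e1] at h1
  have h2 := mul_le_mul_of_nonneg_right h1 hI.le
  refine le_trans (le_of_eq ?_) h2
  field_simp

/-- Steklov average. -/
def stek (q : ℝ → ℝ) (h x : ℝ) : ℝ := ∫ s in (0:ℝ)..1, q (x + h * s)

lemma stek_hasDerivAt {q : ℝ → ℝ} (hq : Continuous q) {h : ℝ} (hh : 0 < h) (x : ℝ) :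
    HasDerivAt (stek q h) ((q (x + h) - q x) / h) x := by
  have e : stek q h = fun x => ((∫ t in (0:ℝ)..(x + h), q t) - ∫ t in (0:ℝ)..x, q t) / h := by
    ext y
    have h1 := intervalIntegral.integral_comp_add_mul (a := 0) (b := 1) q hh.ne' y
    simp only [stek]
    rw [h1, intervalIntegral.integral_interval_sub_left (hq.intervalIntegrable _ _)
      (hq.intervalIntegrable _ _)]
    simp
    field_simp
  rw [e]
  have h1 : ∀ y, HasDerivAt (fun x => ∫ t in (0:ℝ)..x, q t) (q y) y := fun y =>
    (hq.integral_hasStrictDerivAt 0 y).hasDerivAt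
  exact (((h1 (x + h)).comp_add_const x h).sub (h1 x)).div_const h

lemma stek_cont2 {q : ℝ → ℝ → ℝ} (hq : Continuous fun z : ℝ × ℝ => q z.1 z.2) :
    Continuous fun z : ℝ × ℝ => stek (q z.1) z.1 z.2 := by
  unfold stek
  apply intervalIntegral.continuous_parametric_intervalIntegral_of_continuous'
  have : (Function.uncurry fun (z : ℝ × ℝ) (s : ℝ) => q z.1 (z.2 + z.1 * s)) =
    (fun z : ℝ × ℝ => q z.1 z.2) ∘ (fun w : (ℝ × ℝ) × ℝ => (w.1.1, w.1.2 + w.1.1 * w.2)) := by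
    ext w; simp [Function.uncurry]
  rw [this]
  exact hq.comp (by fun_prop)

lemma pw_cont {L : ℝ} {a b b' : ℝ} (hab : a < b) (hb' : b < b') (hL : b - a ≤ L) {p u u' : ℝ → ℝ}
    (hp : Continuous p) (hpos : ∀ x ∈ Icc a b', 0 < p x)
    (hconc : ConcaveOn ℝ (Icc a b') p)
    (hu : ∀ x, HasDerivAt u (u' x) x) (hu' : Continuous u') :
    (π / L) ^ 2 * ((∫ x in a..b, u x ^ 2 * p x) * (∫ x in a..b, p x) - (∫ x in a..b, u x * p x) ^ 2)
      ≤ (∫ x in a..b, u' x ^ 2 * p x) * (∫ x in a..b, p x) := by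
  have hucont : Continuous u := continuous_iff_continuousAt.2 fun x => (hu x).continuousAt
  let P : ℝ → ℝ → ℝ := fun h => stek (stek p h) h
  have hPc : Continuous fun z : ℝ × ℝ => P z.1 z.2 := by
    apply stek_cont2 (q := fun h => stek p h)
    exact stek_cont2 (q := fun _ => p) (by fun_prop)
  have hIntg : ∀ φ : ℝ → ℝ, Continuous φ → Continuous fun h => ∫ x in a..b, φ x * P h x := by
    intro φ hφ
    apply intervalIntegral.continuous_parametric_intervalIntegral_of_continuous'
    exact (hφ.comp continuous_snd).mul hPc
  have hP0 : P 0 = p := by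
    ext x; simp [P, stek]
  have hint1 : Continuous fun h => ∫ x in a..b, P h x := by
    simpa using hIntg (fun _ => 1) continuous_const
  have key : ∀ᶠ h in nhdsWithin (0:ℝ) (Ioi 0),
    (π / L) ^ 2 * ((∫ x in a..b, u x ^ 2 * P h x) * (∫ x in a..b, P h x) -
      (∫ x in a..b, u x * P h x) ^ 2)
      ≤ (∫ x in a..b, u' x ^ 2 * P h x) * (∫ x in a..b, P h x) := by
    filter_upwards [Ioo_mem_nhdsGT (show (0:ℝ) < (b' - b) / 2 by linarith)] with h hh
    have hh0 := hh.1
    have hh1 : 2 * h < b' - b := by linarith [hh.2]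
    have hsc : Continuous (stek p h) := continuous_iff_continuousAt.2 fun x =>
      (stek_hasDerivAt hp hh0 x).continuousAt
    apply pw_smooth' hab hL (p := P h) (p' := fun x => (stek p h (x + h) - stek p h x) / h)
      (p'' := fun x => ((p (x + h + h) - p (x + h)) / h - (p (x + h) - p x) / h) / h)
    · exact fun x => stek_hasDerivAt hsc hh0 x
    · intro x
      exact (((stek_hasDerivAt hp hh0 (x + h)).comp_add_const x h).sub
        (stek_hasDerivAt hp hh0 x)).div_const h
    · fun_prop
    · intro x hx
      have h1 : ∀ y ∈ Icc a (b + h), 0 < stek p h y := by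
        intro y hy
        apply intervalIntegral.intervalIntegral_pos_of_pos_on
          (Continuous.intervalIntegrable (by fun_prop) _ _) _ one_pos
        intro s hs
        apply hpos
        constructor
        · nlinarith [hs.1, hs.2, hy.1]
        · nlinarith [hs.1, hs.2, hy.2]
      apply intervalIntegral.intervalIntegral_pos_of_pos_on
          (Continuous.intervalIntegrable (by fun_prop) _ _) _ one_pos
      intro s hs
      apply h1
      constructor
      · nlinarith [hs.1, hs.2, hx.1]
      · nlinarith [hs.1, hs.2, hx.2]
    · intro x hx
      have h1 := hconc.2 (show x ∈ Icc a b' from ⟨hx.1, by linarith [hx.2]⟩)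
        (show x + h + h ∈ Icc a b' from ⟨by linarith [hx.1], by linarith [hx.2]⟩)
        (show (0:ℝ) ≤ 1 / 2 by norm_num) (show (0:ℝ) ≤ 1 / 2 by norm_num) (by norm_num)
      have e : (1 / 2 : ℝ) • x + (1 / 2 : ℝ) • (x + h + h) = x + h := by
        simp only [smul_eq_mul]; ring
      rw [e] at h1
      simp only [smul_eq_mul] at h1
      have : ((p (x + h + h) - p (x + h)) / h - (p (x + h) - p x) / h) / h =
        (p (x + h + h) + p x - 2 * p (x + h)) / (h * h) := by
        field_simp; ring
      rw [this]
      apply div_nonpos_of_nonpos_of_nonneg _ (by positivity)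
      linarith
    · exact hu
    · exact hu'
  have c1 := hIntg (fun x => u x ^ 2) (by fun_prop)
  have c2 := hIntg (fun x => u x) (by fun_prop)
  have c3 := hIntg (fun x => u' x ^ 2) (by fun_prop)
  have t1 : Continuous fun h => (π / L) ^ 2 * ((∫ x in a..b, u x ^ 2 * P h x) * (∫ x in a..b, P h x) -
      (∫ x in a..b, u x * P h x) ^ 2) := by fun_prop
  have t2 : Continuous fun h => (∫ x in a..b, u' x ^ 2 * P h x) * (∫ x in a..b, P h x) := by fun_prop
  have := le_of_tendsto_of_tendsto ((t1.tendsto 0).mono_left nhdsWithin_le_nhds)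
    ((t2.tendsto 0).mono_left (nhdsWithin_le_nhds (s := Ioi 0))) key
  rw [hP0] at this
  exact this

/-- One dimensional Payne-Weinberger inequality with concave weight on an open interval. -/
lemma pw_concave {a b : ℝ} (hab : a < b) {p u u' : ℝ → ℝ} {M : ℝ}
    (hpos : ∀ x ∈ Ioo a b, 0 < p x) (hM : ∀ x ∈ Ioo a b, p x ≤ M)
    (hconc : ConcaveOn ℝ (Ioo a b) p)
    (hu : ∀ x, HasDerivAt u (u' x) x) (hu' : Continuous u') :
    (π / (b - a)) ^ 2 * ((∫ x in Ioo a b, u x ^ 2 * p x) * (∫ x in Ioo a b, p x) -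
      (∫ x in Ioo a b, u x * p x) ^ 2)
      ≤ (∫ x in Ioo a b, u' x ^ 2 * p x) * (∫ x in Ioo a b, p x) := by
  have hucont : Continuous u := continuous_iff_continuousAt.2 fun x => (hu x).continuousAt
  have hpc : ContinuousOn p (Ioo a b) := hconc.continuousOn isOpen_Ioo
  have hpi : IntegrableOn p (Ioo a b) := by
    refine IntegrableOn.of_bound (C := M) (by simp) (hpc.aestronglyMeasurable measurableSet_Ioo) ?_
    filter_upwards [self_mem_ae_restrict measurableSet_Ioo] with x hx
    rw [Real.norm_eq_abs, abs_of_pos (hpos x hx)]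
    exact hM x hx
  have hφi : ∀ φ : ℝ → ℝ, Continuous φ → IntegrableOn (fun x => φ x * p x) (Ioo a b) := by
    intro φ hφ
    obtain ⟨B, hB⟩ := (isCompact_Icc (a := a) (b := b)).exists_bound_of_continuousOn hφ.continuousOn
    apply Integrable.bdd_mul (c := B) hpi hφ.aestronglyMeasurable
    filter_upwards [self_mem_ae_restrict measurableSet_Ioo] with x hx
    exact hB x (Ioo_subset_Icc_self hx)
  let A : ℕ → ℝ := fun n => a + (b - a) / (n + 3)
  let B : ℕ → ℝ := fun n => b - (b - a) / (n + 3)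
  have hba : 0 < b - a := by linarith
  have hlim : Tendsto (fun n : ℕ => (b - a) / ((n : ℝ) + 3)) atTop (nhds 0) := by
    apply Tendsto.const_div_atTop
    exact tendsto_atTop_add_const_right _ _ tendsto_natCast_atTop_atTop
  have hA : Tendsto A atTop (nhds a) := by simpa using hlim.const_add a
  have hB : Tendsto B atTop (nhds b) := by simpa using hlim.const_sub b
  have hsmall : ∀ n : ℕ, 0 < (b - a) / ((n : ℝ) + 3) ∧ (b - a) / ((n : ℝ) + 3) ≤ (b - a) / 3 := by
    intro n
    constructor
    · positivity
    · gcongr; linarith [(Nat.cast_nonneg n : (0:ℝ) ≤ n)]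
  have hAB : ∀ n, A n < B n := by
    intro n; have := hsmall n; simp only [A, B]; linarith
  have hcover := aecover_Ioo_of_Ioc (μ := volume) hA hB
  have hlimφ : ∀ f : ℝ → ℝ, IntegrableOn f (Ioo a b) →
      Tendsto (fun n => ∫ x in (A n)..(B n), f x) atTop (nhds (∫ x in Ioo a b, f x)) := by
    intro f hf
    have := hcover.integral_tendsto_of_countably_generated hf
    refine this.congr fun n => ?_
    rw [intervalIntegral.integral_of_le (hAB n).le, Measure.restrict_restrict measurableSet_Ioc]
    congr 2
    apply inter_eq_left.2
    intro x hx
    have := hsmall n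
    simp only [A, B] at hx
    exact ⟨by linarith [hx.1], by linarith [hx.2]⟩
  have key : ∀ n, (π / (b - a)) ^ 2 * ((∫ x in (A n)..(B n), u x ^ 2 * p x) *
      (∫ x in (A n)..(B n), p x) - (∫ x in (A n)..(B n), u x * p x) ^ 2)
      ≤ (∫ x in (A n)..(B n), u' x ^ 2 * p x) * (∫ x in (A n)..(B n), p x) := by
    intro n
    have hn := hsmall n
    obtain ⟨b', hb1, hb2⟩ := exists_between (show B n < b by simp only [B]; linarith)
    have hAb' : A n ≤ b' := (hAB n).le.trans hb1.le
    have hsub : Icc (A n) b' ⊆ Ioo a b := by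
      intro x hx; simp only [A] at hx
      exact ⟨by linarith [hx.1], by linarith [hx.2]⟩
    let q := IccExtend hAb' (domRestrict (Icc (A n) b') p)
    have hq : ∀ x ∈ Icc (A n) b', q x = p x := fun x hx => by
      simp [q, IccExtend_of_mem _ _ hx]
    have hqc : Continuous q := by
      apply Continuous.Icc_extend'
      exact (hpc.mono hsub).domRestrict
    have := pw_cont (L := b - a) (hAB n) hb1 (by simp only [A, B]; linarith) hqc (u := u) (u' := u')
      (fun x hx => by rw [hq x hx]; exact hpos x (hsub hx)) ?_ hu hu'
    · have hcg : ∀ φ : ℝ → ℝ, (∫ x in (A n)..(B n), φ x * q x) = ∫ x in (A n)..(B n), φ x * p x := by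
        intro φ
        apply intervalIntegral.integral_congr
        intro x hx
        rw [uIcc_of_le (hAB n).le] at hx
        simp only [hq x ⟨hx.1, hx.2.trans hb1.le⟩]
      have h1 := hcg (fun _ => 1)
      simp only [one_mul] at h1
      rw [h1, hcg u, hcg (fun x => u x ^ 2), hcg (fun x => u' x ^ 2)] at this
      exact this
    · refine ConcaveOn.congr (hconc.subset hsub (convex_Icc _ _)) ?_
      intro x hx
      exact (hq x hx).symm
  refine le_of_tendsto_of_tendsto' (b := atTop) ?_ ?_ key
  · exact (((hlimφ _ (hφi (fun x => u x ^ 2) (by fun_prop))).mul (hlimφ p hpi)).sub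
      ((hlimφ _ (hφi u hucont)).pow 2)).const_mul _
  · exact (hlimφ _ (hφi (fun x => u' x ^ 2) (by fun_prop))).mul (hlimφ p hpi)

lemma bm1_compact {K L C : Set ℝ} (hK : IsCompact K) (hL : IsCompact L) (hKn : K.Nonempty)
    (hLn : L.Nonempty) (hC : ∀ x ∈ K, ∀ y ∈ L, x + y ∈ C) :
    volume K + volume L ≤ volume C := by
  obtain ⟨M, hM, hMmax⟩ := hK.exists_isMaxOn hKn continuousOn_id
  obtain ⟨m, hm, hmmin⟩ := hL.exists_isMinOn hLn continuousOn_id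
  have h1 : volume ((fun x => x - m) ⁻¹' K) = volume K := by
    simpa [sub_eq_add_neg] using measure_preimage_add_right volume (-m) K
  have h2 : volume ((fun x => x - M) ⁻¹' L) = volume L := by
    simpa [sub_eq_add_neg] using measure_preimage_add_right volume (-M) L
  rw [← h1, ← h2, ← measure_union₀]
  · apply measure_mono
    rintro x (hx | hx)
    · have := hC _ hx _ hm; simpa using this
    · have := hC _ hM _ hx; simpa using this
  · exact ((measurable_id.sub_const M) hL.measurableSet).nullMeasurableSet
  · refine measure_mono_null (t := {M + m}) ?_ (by simp)
    rintro x ⟨hx1, hx2⟩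
    have a1 := hMmax hx1
    have a2 := hmmin hx2
    simp only [id] at a1 a2
    simp only [mem_singleton_iff]
    apply le_antisymm
    · have : x - m ≤ M := a1
      linarith
    · have : m ≤ x - M := a2
      linarith

/-- One-dimensional Brunn-Minkowski inequality. -/
lemma bm1 {A B C : Set ℝ} (hA : MeasurableSet A) (hB : MeasurableSet B) (hAn : A.Nonempty)
    (hBn : B.Nonempty) (hC : ∀ x ∈ A, ∀ y ∈ B, x + y ∈ C) :
    volume A + volume B ≤ volume C := by
  rcases eq_or_ne (volume A) 0 with h0 | h0
  · obtain ⟨x, hx⟩ := hAn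
    have h1 : volume ((fun y => y - x) ⁻¹' B) = volume B := by
      simpa [sub_eq_add_neg] using measure_preimage_add_right volume (-x) B
    rw [h0, zero_add, ← h1]
    apply measure_mono
    intro y hy
    have := hC _ hx _ hy; simpa using this
  rcases eq_or_ne (volume B) 0 with h0' | h0'
  · obtain ⟨x, hx⟩ := hBn
    have h1 : volume ((fun y => y - x) ⁻¹' A) = volume A := by
      simpa [sub_eq_add_neg] using measure_preimage_add_right volume (-x) A
    rw [h0', add_zero, ← h1]
    apply measure_mono
    intro y hy
    have := hC _ hy _ hx; simpa using this
  apply le_of_forall_lt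
  intro c hc
  obtain ⟨y', hy', z', hz', hlt⟩ := ENNReal.exists_lt_add_of_lt_add hc h0 h0'
  obtain ⟨K, hKA, hK, hyK⟩ := hA.exists_lt_isCompact hy'
  obtain ⟨L, hLB, hL, hzL⟩ := hB.exists_lt_isCompact hz'
  have hKn : K.Nonempty := by
    rw [nonempty_iff_ne_empty]; rintro rfl; simp at hyK
  have hLn : L.Nonempty := by
    rw [nonempty_iff_ne_empty]; rintro rfl; simp at hzL
  have := bm1_compact hK hL hKn hLn (C := C) fun x hx y hy => hC x (hKA hx) y (hLB hy)
  calc c < y' + z' := hlt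
    _ ≤ volume K + volume L := add_le_add hyK.le hzL.le
    _ ≤ _ := this

/-- Length of the section. -/
def secLen (K : Set (ℝ × ℝ)) (s : ℝ) : ℝ := (volume (Prod.mk s ⁻¹' K)).toReal

lemma secLen_nonneg (K : Set (ℝ × ℝ)) (s : ℝ) : 0 ≤ secLen K s := ENNReal.toReal_nonneg

lemma measurable_secLen {K : Set (ℝ × ℝ)} (hK : MeasurableSet K) : Measurable (secLen K) :=
  (measurable_measure_prodMk_left hK).ennreal_toReal

lemma bdd_box {K : Set (ℝ × ℝ)} (hK : Bornology.IsBounded K) :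
    ∃ R : ℝ, 0 < R ∧ K ⊆ Icc (-R) R ×ˢ Icc (-R) R := by
  obtain ⟨R, hR0, hR⟩ := hK.subset_closedBall_lt 0 0
  refine ⟨R, hR0, fun x hx => ?_⟩
  have := hR hx
  rw [mem_closedBall_zero_iff, Prod.norm_def, max_le_iff, Real.norm_eq_abs, Real.norm_eq_abs,
    abs_le, abs_le] at this
  exact ⟨this.1, this.2⟩

lemma sec_vol_le {K : Set (ℝ × ℝ)} {R : ℝ} (hK : K ⊆ Icc (-R) R ×ˢ Icc (-R) R) (s : ℝ) :
    volume (Prod.mk s ⁻¹' K) ≤ ENNReal.ofReal (2 * R) := by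
  calc volume (Prod.mk s ⁻¹' K) ≤ volume (Icc (-R) R) := measure_mono fun t ht => (hK ht).2
    _ = _ := by rw [Real.volume_Icc]; congr 1; ring

lemma secLen_le {K : Set (ℝ × ℝ)} {R : ℝ} (hR : 0 < R) (hK : K ⊆ Icc (-R) R ×ˢ Icc (-R) R) (s : ℝ) :
    secLen K s ≤ 2 * R := by
  unfold secLen
  exact ENNReal.toReal_le_of_le_ofReal (by positivity) (sec_vol_le hK s)

lemma ofReal_secLen {K : Set (ℝ × ℝ)} (hK : Bornology.IsBounded K) (s : ℝ) :
    ENNReal.ofReal (secLen K s) = volume (Prod.mk s ⁻¹' K) := by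
  obtain ⟨R, hR, h⟩ := bdd_box hK
  exact ENNReal.ofReal_toReal (ne_top_of_le_ne_top ENNReal.ofReal_ne_top (sec_vol_le h s))

lemma lintegral_secLen {K : Set (ℝ × ℝ)} (hK : Bornology.IsBounded K) (hm : MeasurableSet K) :
    ∫⁻ s, ENNReal.ofReal (secLen K s) = volume K := by
  simp_rw [ofReal_secLen hK]
  rw [Measure.volume_eq_prod, Measure.prod_apply hm]

lemma layer_unit {f : ℝ → ℝ} (hf : Measurable f) (h0 : ∀ x, 0 ≤ f x) (h1 : ∀ x, f x ≤ 1) :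
    ∫⁻ x, ENNReal.ofReal (f x) = ∫⁻ t in Ioo (0:ℝ) 1, volume {x | t < f x} := by
  rw [lintegral_eq_lintegral_meas_lt _ (Eventually.of_forall h0) hf.aemeasurable]
  have : Ioi (0:ℝ) = Ioo 0 1 ∪ Ici 1 := by
    ext t; simp only [mem_Ioi, mem_union, mem_Ioo, mem_Ici]
    constructor
    · intro h; rcases lt_or_ge t 1 with h' | h'
      · exact Or.inl ⟨h, h'⟩
      · exact Or.inr h'
    · rintro (h | h)
      · exact h.1
      · linarith
  rw [this, lintegral_union measurableSet_Ici]
  · have : ∫⁻ t in Ici (1:ℝ), volume {x | t < f x} = 0 := by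
      rw [setLIntegral_eq_zero_iff' measurableSet_Ici]
      · apply Eventually.of_forall
        intro t ht
        have : {x | t < f x} = ∅ := by
          ext x; simp only [mem_setOf_eq, mem_empty_iff_false, iff_false, not_lt]
          exact (h1 x).trans ht
        simp [this]
      · apply Measurable.aemeasurable
        have : Antitone fun t => volume {x | t < f x} := fun s t hst =>
          measure_mono fun x hx => lt_of_le_of_lt hst hx
        exact this.measurable
    rw [this, add_zero]
  · rw [Set.disjoint_left]; rintro t ⟨_, h⟩ h'; exact absurd h' (not_le.2 h)

/-- Two-dimensional Brunn-Minkowski inequality, in real form. -/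
lemma bm2 {A B C : Set (ℝ × ℝ)} (hA : IsOpen A) (hB : IsOpen B) (hAn : A.Nonempty)
    (hBn : B.Nonempty) (hAb : Bornology.IsBounded A) (hBb : Bornology.IsBounded B)
    (hCb : Bornology.IsBounded C) (hCm : MeasurableSet C)
    (hC : ∀ x ∈ A, ∀ y ∈ B, x + y ∈ C) :
    (√(volume A).toReal + √(volume B).toReal) ^ 2 ≤ (volume C).toReal := by
  obtain ⟨RA, hRA, hRA'⟩ := bdd_box hAb
  obtain ⟨RB, hRB, hRB'⟩ := bdd_box hBb
  have hpos : ∀ {K : Set (ℝ × ℝ)}, IsOpen K → Bornology.IsBounded K → ∀ {z : ℝ × ℝ}, z ∈ K →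
      0 < secLen K z.1 := by
    intro K hK hKb z hz
    have : 0 < volume (Prod.mk z.1 ⁻¹' K) :=
      (hK.preimage (by fun_prop)).measure_pos _ ⟨z.2, hz⟩
    rw [← ofReal_secLen hKb] at this
    exact ENNReal.ofReal_pos.1 this
  have bA : BddAbove (range (secLen A)) := ⟨2 * RA, by rintro _ ⟨s, rfl⟩; exact secLen_le hRA hRA' s⟩
  have bB : BddAbove (range (secLen B)) := ⟨2 * RB, by rintro _ ⟨s, rfl⟩; exact secLen_le hRB hRB' s⟩
  set a := ⨆ s, secLen A s with ha
  set b := ⨆ s, secLen B s with hb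
  have ha0 : 0 < a := by
    obtain ⟨z, hz⟩ := hAn
    exact (hpos hA hAb hz).trans_le (le_ciSup bA z.1)
  have hb0 : 0 < b := by
    obtain ⟨z, hz⟩ := hBn
    exact (hpos hB hBb hz).trans_le (le_ciSup bB z.1)
  have key : ∀ t ∈ Ioo (0:ℝ) 1, volume {x | t < secLen A x / a} + volume {x | t < secLen B x / b} ≤
      volume {x | t < secLen C x / (a + b)} := by
    intro t ht
    have hneA : {x | t < secLen A x / a}.Nonempty := by
      have : t * a < a := by nlinarith [ht.2]
      obtain ⟨s, hs⟩ := exists_lt_of_lt_ciSup this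
      exact ⟨s, by simp only [mem_setOf_eq]; rwa [lt_div_iff₀ ha0]⟩
    have hneB : {x | t < secLen B x / b}.Nonempty := by
      have : t * b < b := by nlinarith [ht.2]
      obtain ⟨s, hs⟩ := exists_lt_of_lt_ciSup this
      exact ⟨s, by simp only [mem_setOf_eq]; rwa [lt_div_iff₀ hb0]⟩
    apply bm1 _ _ hneA hneB
    · intro x hx y hy
      simp only [mem_setOf_eq] at hx hy ⊢
      rw [lt_div_iff₀ ha0] at hx
      rw [lt_div_iff₀ hb0] at hy
      rw [lt_div_iff₀ (by positivity)]
      have hxA : (Prod.mk x ⁻¹' A).Nonempty := by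
        rw [nonempty_iff_ne_empty]; intro h
        have : secLen A x = 0 := by simp [secLen, h]
        rw [this] at hx; nlinarith [ht.1]
      have hyB : (Prod.mk y ⁻¹' B).Nonempty := by
        rw [nonempty_iff_ne_empty]; intro h
        have : secLen B y = 0 := by simp [secLen, h]
        rw [this] at hy; nlinarith [ht.1]
      have := bm1 (C := Prod.mk (x + y) ⁻¹' C) (hA.preimage (by fun_prop : Continuous (Prod.mk x))).measurableSet
        (hB.preimage (by fun_prop : Continuous (Prod.mk y))).measurableSet hxA hyB
        (fun s hs r hr => by simpa using hC _ hs _ hr)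
      rw [← ofReal_secLen hAb, ← ofReal_secLen hBb, ← ofReal_secLen hCb,
        ← ENNReal.ofReal_add (secLen_nonneg _ _) (secLen_nonneg _ _),
        ENNReal.ofReal_le_ofReal_iff (secLen_nonneg _ _)] at this
      linarith
    · exact measurableSet_lt measurable_const ((measurable_secLen hA.measurableSet).div_const _)
    · exact measurableSet_lt measurable_const ((measurable_secLen hB.measurableSet).div_const _)
  have hI : (∫⁻ x, ENNReal.ofReal (secLen A x / a)) + ∫⁻ x, ENNReal.ofReal (secLen B x / b) ≤
      ∫⁻ x, ENNReal.ofReal (secLen C x / (a + b)) := by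
    rw [layer_unit ((measurable_secLen hA.measurableSet).div_const _)
        (fun x => div_nonneg (secLen_nonneg _ _) ha0.le)
        (fun x => (div_le_one ha0).2 (le_ciSup bA x)),
      layer_unit ((measurable_secLen hB.measurableSet).div_const _)
        (fun x => div_nonneg (secLen_nonneg _ _) hb0.le)
        (fun x => (div_le_one hb0).2 (le_ciSup bB x)),
      lintegral_eq_lintegral_meas_lt _ (Eventually.of_forall
        (fun x => div_nonneg (secLen_nonneg _ _) (by positivity)))
        ((measurable_secLen hCm).div_const _).aemeasurable, ← lintegral_add_left]
    · calc _ ≤ ∫⁻ t in Ioo (0:ℝ) 1, volume {x | t < secLen C x / (a + b)} := by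
            apply setLIntegral_mono' measurableSet_Ioo key
        _ ≤ _ := lintegral_mono_set Ioo_subset_Ioi_self
    · have : Antitone fun t => volume {x | t < secLen A x / a} := fun s t hst =>
          measure_mono fun x hx => lt_of_le_of_lt hst hx
      exact this.measurable
  have hdiv : ∀ (K : Set (ℝ × ℝ)) (hK : Bornology.IsBounded K) (hm : MeasurableSet K) (c : ℝ),
      0 < c → ∫⁻ x, ENNReal.ofReal (secLen K x / c) = ENNReal.ofReal ((volume K).toReal / c) := by
    intro K hK hm c hc
    have h1 : ∀ x, ENNReal.ofReal (secLen K x / c) = ENNReal.ofReal (secLen K x) * ENNReal.ofReal c⁻¹ := by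
      intro x; rw [div_eq_mul_inv, ENNReal.ofReal_mul (secLen_nonneg _ _)]
    simp_rw [h1]
    rw [lintegral_mul_const _ (measurable_secLen hm).ennreal_ofReal, lintegral_secLen hK hm,
      div_eq_mul_inv, ENNReal.ofReal_mul ENNReal.toReal_nonneg,
      ENNReal.ofReal_toReal hK.measure_lt_top.ne]
  rw [hdiv A hAb hA.measurableSet a ha0, hdiv B hBb hB.measurableSet b hb0,
    hdiv C hCb hCm _ (by positivity), ← ENNReal.ofReal_add (by positivity) (by positivity),
    ENNReal.ofReal_le_ofReal_iff (by positivity)] at hI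
  set x := (volume A).toReal
  set y := (volume B).toReal
  have hx : 0 ≤ x := ENNReal.toReal_nonneg
  have hy : 0 ≤ y := ENNReal.toReal_nonneg
  rw [le_div_iff₀ (by positivity)] at hI
  refine le_trans ?_ hI
  have sx := Real.sq_sqrt hx
  have sy := Real.sq_sqrt hy
  set X := √x
  set Y := √y
  rw [← sx, ← sy]
  have : (X ^ 2 / a + Y ^ 2 / b) * (a + b) - (X + Y) ^ 2 = (X * b - Y * a) ^ 2 / (a * b) := by
    field_simp; ring
  have h5 : 0 ≤ (X * b - Y * a) ^ 2 / (a * b) := by positivity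
  linarith

section PointwiseHelpers

open scoped Pointwise

def perp (e : E2) : E2 := !₂[-e 1, e 0]

def fr (c e : E2) (z : ℝ × ℝ) : E2 := c + z.1 • e + z.2 • perp e

lemma inner_E2 (x y : E2) : ⟪x, y⟫ = x 0 * y 0 + x 1 * y 1 := by
  simp [PiLp.inner_apply, Fin.sum_univ_two]; ring

lemma norm_sq_E2 (x : E2) : ‖x‖ ^ 2 = x 0 ^ 2 + x 1 ^ 2 := by
  rw [← real_inner_self_eq_norm_sq, inner_E2]; ring

@[simp] lemma perp_zero' (e : E2) : perp e 0 = -e 1 := by simp [perp]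
@[simp] lemma perp_one' (e : E2) : perp e 1 = e 0 := by simp [perp]
@[simp] lemma fr_zero' (c e : E2) (z : ℝ × ℝ) : fr c e z 0 = c 0 + z.1 * e 0 - z.2 * e 1 := by
  simp [fr]; ring
@[simp] lemma fr_one' (c e : E2) (z : ℝ × ℝ) : fr c e z 1 = c 1 + z.1 * e 1 + z.2 * e 0 := by
  simp [fr]

lemma E2_ext {x y : E2} (h0 : x 0 = y 0) (h1 : x 1 = y 1) : x = y := by
  ext i; fin_cases i <;> assumption

lemma norm_perp (e : E2) : ‖perp e‖ = ‖e‖ := by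
  rw [← abs_of_nonneg (norm_nonneg (perp e)), ← abs_of_nonneg (norm_nonneg e), ← sq_eq_sq_iff_abs_eq_abs,
    norm_sq_E2, norm_sq_E2]
  simp; ring

lemma unit_sq {e : E2} (he : ‖e‖ = 1) : e 0 ^ 2 + e 1 ^ 2 = 1 := by
  rw [← norm_sq_E2, he]; norm_num

lemma inner_fr (c : E2) {e : E2} (he : ‖e‖ = 1) (z : ℝ × ℝ) : ⟪fr c e z - c, e⟫ = z.1 := by
  rw [inner_E2]; simp; linear_combination z.1 * unit_sq he

lemma inner_fr' (c : E2) {e : E2} (he : ‖e‖ = 1) (z : ℝ × ℝ) : ⟪fr c e z - c, perp e⟫ = z.2 := by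
  rw [inner_E2]; simp; linear_combination z.2 * unit_sq he

lemma fr_inner (c : E2) {e : E2} (he : ‖e‖ = 1) (x : E2) :
    fr c e (⟪x - c, e⟫, ⟪x - c, perp e⟫) = x := by
  apply E2_ext
  · simp [inner_E2]; linear_combination (x 0 - c 0) * unit_sq he
  · simp [inner_E2]; linear_combination (x 1 - c 1) * unit_sq he

lemma norm_fr_sub {c e : E2} (he : ‖e‖ = 1) (z w : ℝ × ℝ) :
    ‖fr c e z - fr c e w‖ ^ 2 = (z.1 - w.1) ^ 2 + (z.2 - w.2) ^ 2 := by
  rw [norm_sq_E2]; simp; linear_combination ((z.1 - w.1) ^ 2 + (z.2 - w.2) ^ 2) * unit_sq he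

lemma norm_fr_sub_le {c e : E2} (he : ‖e‖ = 1) (s t t' : ℝ) :
    ‖fr c e (s, t) - fr c e (s, t')‖ = |t - t'| := by
  have := norm_fr_sub (c := c) he (s, t) (s, t')
  simp only [sub_self, ne_eq, OfNat.ofNat_ne_zero, not_false_eq_true, zero_pow, zero_add] at this
  rw [← abs_of_nonneg (norm_nonneg _)]
  exact (sq_eq_sq_iff_abs_eq_abs _ _).1 this

lemma continuous_fr (c e : E2) : Continuous (fr c e) := by unfold fr; fun_prop

def frH (c : E2) {e : E2} (he : ‖e‖ = 1) : (ℝ × ℝ) ≃ₜ E2 where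
  toFun := fr c e
  invFun x := (⟪x - c, e⟫, ⟪x - c, perp e⟫)
  left_inv z := by simp [inner_fr c he, inner_fr' c he]
  right_inv x := fr_inner c he x
  continuous_toFun := continuous_fr c e
  continuous_invFun := by fun_prop

lemma mp_fr (c : E2) {e : E2} (he : ‖e‖ = 1) : MeasurePreserving (fr c e) volume volume := by
  have hon : Orthonormal ℝ ![e, perp e] := by
    rw [orthonormal_iff_ite]
    intro i j
    fin_cases i <;> fin_cases j <;> simp [inner_E2]
    · exact Or.inl he
    · ring
    · ring
    · exact Or.inl ((norm_perp e).trans he)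
  have hc : Fintype.card (Fin 2) = Module.finrank ℝ E2 := by simp
  let b0 := basisOfOrthonormalOfCardEqFinrank hon hc
  have hb0 : ⇑b0 = ![e, perp e] := coe_basisOfOrthonormalOfCardEqFinrank hon hc
  let b := b0.toOrthonormalBasis (by rw [hb0]; exact hon)
  have hb : ⇑b = ![e, perp e] := by simp [b, hb0]
  have h1 := b.measurePreserving_repr_symm
  have h2 := EuclideanSpace.volume_preserving_symm_measurableEquiv_toLp (Fin 2)
  have h3 := (volume_preserving_finTwoArrow ℝ).symm
  have h4 := (measurePreserving_add_left (volume : Measure E2) c).comp (h1.comp (h2.symm.comp h3))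
  convert h4 using 1
  ext1 z
  have : ∀ w : E2, b.repr.symm w = w 0 • e + w 1 • perp e := by
    intro w
    have := b.sum_repr_symm w
    rw [← this, Fin.sum_univ_two, hb]; simp
  simp only [Function.comp]
  rw [this, fr, add_assoc]
  rfl

lemma emb_fr (c : E2) {e : E2} (he : ‖e‖ = 1) : MeasurableEmbedding (fr c e) :=
  (frH c he).measurableEmbedding

lemma setIntegral_fr (c : E2) {e : E2} (he : ‖e‖ = 1) (K : Set E2) (f : E2 → ℝ) :
    ∫ z in fr c e ⁻¹' K, f (fr c e z) = ∫ x in K, f x :=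
  (mp_fr c he).setIntegral_preimage_emb (emb_fr c he) f K

lemma volume_fr (c : E2) {e : E2} (he : ‖e‖ = 1) (K : Set E2) :
    volume (fr c e ⁻¹' K) = volume K :=
  (mp_fr c he).measure_preimage_emb (emb_fr c he) K

lemma isOpen_fr (c e : E2) {K : Set E2} (hK : IsOpen K) : IsOpen (fr c e ⁻¹' K) :=
  hK.preimage (continuous_fr c e)

lemma bdd_fr (c : E2) {e : E2} (he : ‖e‖ = 1) {K : Set E2} (hK : Bornology.IsBounded K) :
    Bornology.IsBounded (fr c e ⁻¹' K) := by
  obtain ⟨R, hR⟩ := hK.subset_closedBall c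
  apply (Metric.isBounded_closedBall (x := (0 : ℝ × ℝ)) (r := R)).subset
  intro z hz
  have h := hR hz
  rw [mem_closedBall_iff_norm] at h
  rw [mem_closedBall_zero_iff, Prod.norm_def]
  apply max_le
  · rw [← inner_fr c he z]
    calc _ ≤ _ := norm_inner_le_norm _ _
      _ ≤ R := by rw [he, mul_one]; exact h
  · rw [← inner_fr' c he z]
    calc _ ≤ _ := norm_inner_le_norm _ _
      _ ≤ R := by rw [norm_perp, he, mul_one]; exact h

lemma fr_comb (c e : E2) (z w : ℝ × ℝ) {a b : ℝ} (hab : a + b = 1) :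
    fr c e (a • z + b • w) = a • fr c e z + b • fr c e w := by
  have : b = 1 - a := by linarith
  subst this
  apply E2_ext <;> simp <;> ring

lemma convex_fr (c e : E2) {K : Set E2} (hK : Convex ℝ K) : Convex ℝ (fr c e ⁻¹' K) := by
  intro z hz w hw a b ha hb hab
  simp only [mem_preimage] at *
  rw [fr_comb c e z w hab]
  exact hK hz hw ha hb hab

/-! Sections of convex sets in the plane. -/

lemma int_sec {K : Set (ℝ × ℝ)} (hK : MeasurableSet K) {F : ℝ × ℝ → ℝ} (hF : IntegrableOn F K) :
    ∫ z in K, F z = ∫ s, ∫ t in Prod.mk s ⁻¹' K, F (s, t) := by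
  rw [← integral_indicator hK, Measure.volume_eq_prod,
    integral_prod _ ((integrable_indicator_iff hK).2 hF)]
  congr 1; ext s
  rw [← integral_indicator (hK.preimage measurable_prodMk_left)]
  rfl

lemma int_sec1 {K : Set (ℝ × ℝ)} (hK : MeasurableSet K) {φ : ℝ → ℝ}
    (hF : IntegrableOn (fun z : ℝ × ℝ => φ z.1) K) :
    ∫ z in K, φ z.1 = ∫ s, φ s * secLen K s := by
  rw [int_sec hK hF]
  congr 1; ext s
  simp [secLen, Measure.real, mul_comm]

structure Body (K : Set (ℝ × ℝ)) : Prop where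
  isOpen : IsOpen K
  bdd : Bornology.IsBounded K
  conv : Convex ℝ K
  ne : K.Nonempty

lemma secLen_concave_aux {K : Set (ℝ × ℝ)} (h : Body K) {x y : ℝ}
    (hx : (Prod.mk x ⁻¹' K).Nonempty) (hy : (Prod.mk y ⁻¹' K).Nonempty) {a b : ℝ}
    (ha : 0 ≤ a) (hb : 0 ≤ b) (hab : a + b = 1) :
    a * secLen K x + b * secLen K y ≤ secLen K (a * x + b * y) := by
  have mx := (h.isOpen.preimage (by fun_prop : Continuous (Prod.mk x : ℝ → ℝ × ℝ))).measurableSet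
  have my := (h.isOpen.preimage (by fun_prop : Continuous (Prod.mk y : ℝ → ℝ × ℝ))).measurableSet
  rcases ha.eq_or_lt with rfl | ha
  · have : b = 1 := by linarith
    subst this; simp
  rcases hb.eq_or_lt with rfl | hb
  · have : a = 1 := by linarith
    subst this; simp
  have := bm1 (A := a • (Prod.mk x ⁻¹' K)) (B := b • (Prod.mk y ⁻¹' K))
    (C := Prod.mk (a * x + b * y) ⁻¹' K) (mx.const_smul₀ a) (my.const_smul₀ b)
    hx.smul_set hy.smul_set ?_
  · rw [Measure.addHaar_smul, Measure.addHaar_smul, ← ofReal_secLen h.bdd, ← ofReal_secLen h.bdd,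
      ← ofReal_secLen h.bdd, ← ENNReal.ofReal_mul (abs_nonneg _), ← ENNReal.ofReal_mul (abs_nonneg _),
      ← ENNReal.ofReal_add (mul_nonneg (abs_nonneg _) (secLen_nonneg _ _))
        (mul_nonneg (abs_nonneg _) (secLen_nonneg _ _)),
      ENNReal.ofReal_le_ofReal_iff (secLen_nonneg _ _)] at this
    simpa [abs_of_pos ha, abs_of_pos hb] using this
  · rintro _ ⟨s, hs, rfl⟩ _ ⟨t, ht, rfl⟩
    have := h.conv hs ht ha.le hb.le hab
    simpa using this

lemma secLen_pos {K : Set (ℝ × ℝ)} (h : Body K) {x : ℝ}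
    (hx : (Prod.mk x ⁻¹' K).Nonempty) : 0 < secLen K x := by
  have ho := h.isOpen.preimage (by fun_prop : Continuous (Prod.mk x : ℝ → ℝ × ℝ))
  have := ho.measure_pos volume hx
  rw [← ofReal_secLen h.bdd] at this
  exact ENNReal.ofReal_pos.1 this

lemma secLen_zero {K : Set (ℝ × ℝ)} {x : ℝ} (hx : ¬ (Prod.mk x ⁻¹' K).Nonempty) :
    secLen K x = 0 := by
  rw [not_nonempty_iff_eq_empty] at hx
  simp [secLen, hx]

/-- an open bounded convex nonempty set of reals is an interval -/
lemma conv_Ioo {P : Set ℝ} (ho : IsOpen P) (hb : Bornology.IsBounded P) (hc : Convex ℝ P)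
    (hn : P.Nonempty) : sInf P < sSup P ∧ P = Ioo (sInf P) (sSup P) := by
  have hba := hb.bddAbove
  have hbb := hb.bddBelow
  have hsub : P ⊆ Ioo (sInf P) (sSup P) := by
    intro x hx
    obtain ⟨ε, hε, hball⟩ := Metric.isOpen_iff.1 ho x hx
    have h1 : x + ε / 2 ∈ P := hball (by simp [abs_of_pos hε]; exact hε)
    have h2 : x - ε / 2 ∈ P := hball (by simp [abs_of_pos hε]; exact hε)
    constructor
    · linarith [csInf_le hbb h2]
    · linarith [le_csSup hba h1]
  obtain ⟨x, hx⟩ := hn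
  refine ⟨(hsub hx).1.trans (hsub hx).2, hsub.antisymm ?_⟩
  intro y hy
  obtain ⟨p, hp, hpy⟩ := exists_lt_of_csInf_lt ⟨x, hx⟩ hy.1
  obtain ⟨q, hq, hqy⟩ := exists_lt_of_lt_csSup ⟨x, hx⟩ hy.2
  exact hc.ordConnected.out hp hq ⟨hpy.le, hqy.le⟩

def pL (K : Set (ℝ × ℝ)) : ℝ := sInf (Prod.fst '' K)
def pR (K : Set (ℝ × ℝ)) : ℝ := sSup (Prod.fst '' K)

lemma proj_eq {K : Set (ℝ × ℝ)} (h : Body K) : pL K < pR K ∧ Prod.fst '' K = Ioo (pL K) (pR K) := by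
  apply conv_Ioo
  · exact isOpenMap_fst _ h.isOpen
  · exact h.bdd.image_fst
  · exact h.conv.linear_image (LinearMap.fst ℝ ℝ ℝ)
  · exact h.ne.image _

lemma sec_ne_iff {K : Set (ℝ × ℝ)} (h : Body K) {s : ℝ} :
    (Prod.mk s ⁻¹' K).Nonempty ↔ s ∈ Ioo (pL K) (pR K) := by
  rw [← (proj_eq h).2]
  constructor
  · rintro ⟨t, ht⟩; exact ⟨(s, t), ht, rfl⟩
  · rintro ⟨⟨s', t⟩, ht, rfl⟩; exact ⟨t, ht⟩

lemma secLen_concave {K : Set (ℝ × ℝ)} (h : Body K) :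
    ConcaveOn ℝ (Ioo (pL K) (pR K)) (secLen K) := by
  refine ⟨convex_Ioo _ _, fun x hx y hy a b ha hb hab => ?_⟩
  exact secLen_concave_aux h ((sec_ne_iff h).2 hx) ((sec_ne_iff h).2 hy) ha hb hab

lemma secLen_pos' {K : Set (ℝ × ℝ)} (h : Body K) : ∀ s ∈ Ioo (pL K) (pR K), 0 < secLen K s :=
  fun _ hs => secLen_pos h ((sec_ne_iff h).2 hs)

lemma secLen_zero' {K : Set (ℝ × ℝ)} (h : Body K) {s : ℝ} (hs : s ∉ Ioo (pL K) (pR K)) :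
    secLen K s = 0 := secLen_zero fun h' => hs ((sec_ne_iff h).1 h')

lemma int_sec1_Ioo {K : Set (ℝ × ℝ)} (h : Body K) {φ : ℝ → ℝ}
    (hF : IntegrableOn (fun z : ℝ × ℝ => φ z.1) K) :
    ∫ z in K, φ z.1 = ∫ s in Ioo (pL K) (pR K), φ s * secLen K s := by
  rw [int_sec1 h.isOpen.measurableSet hF, setIntegral_eq_integral_of_forall_compl_eq_zero]
  intro s hs; rw [secLen_zero' h hs, mul_zero]

lemma integrableOn_fst {K : Set (ℝ × ℝ)} (h : Body K) {φ : ℝ → ℝ} (hφ : Continuous φ) :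
    IntegrableOn (fun z : ℝ × ℝ => φ z.1) K := by
  have : Continuous fun z : ℝ × ℝ => φ z.1 := by fun_prop
  exact ((this.continuousOn).integrableOn_compact h.bdd.isCompact_closure).mono_set subset_closure

lemma vol_sec {K : Set (ℝ × ℝ)} (h : Body K) :
    (volume K).toReal = ∫ s in Ioo (pL K) (pR K), secLen K s := by
  have := int_sec1_Ioo h (φ := fun _ => 1) (integrableOn_fst h continuous_const)
  simpa [Measure.real] using this

lemma body_fr (c : E2) {e : E2} (he : ‖e‖ = 1) {K : Set E2} (ho : IsOpen K)
    (hb : Bornology.IsBounded K) (hc : Convex ℝ K) (hn : K.Nonempty) : Body (fr c e ⁻¹' K) :=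
  ⟨isOpen_fr c e ho, bdd_fr c he hb, convex_fr c e hc, by
    obtain ⟨x, hx⟩ := hn
    exact ⟨(⟪x - c, e⟫, ⟪x - c, perp e⟫), by rw [mem_preimage, fr_inner c he]; exact hx⟩⟩

end PointwiseHelpers

/-! Hersch inequality. -/

lemma HasCompactSupport.sq' {X : Type*} [TopologicalSpace X] {f : X → ℝ} (hs : HasCompactSupport f) :
    HasCompactSupport fun x => f x ^ 2 := by
  have : (fun x => f x ^ 2) = fun x => f x * f x := by ext x; ring
  rw [this]; exact hs.mul_right

lemma int_sq {X : Type*} [TopologicalSpace X] [MeasurableSpace X] [OpensMeasurableSpace X]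
    {μ : Measure X} [IsFiniteMeasureOnCompacts μ] {f : X → ℝ} (hf : Continuous f)
    (hs : HasCompactSupport f) : Integrable (fun x => f x ^ 2) μ :=
  (show Continuous fun x => f x ^ 2 by fun_prop).integrable_of_hasCompactSupport hs.sq'


lemma hersch1 {T : Set ℝ} (hT : IsUpperSet T) {f f' : ℝ → ℝ} (hf : ∀ t, HasDerivAt f (f' t) t)
    (hf' : Continuous f') (hs : HasCompactSupport f) (hs' : HasCompactSupport f') {h r : ℝ} (hr : 0 < r)
    (h1 : ∀ t, h ≤ t → f t = 0) (h2 : ∀ t ∈ T, t ≤ h - r → f t = 0) :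
    (π / (2 * r)) ^ 2 * (∫ t in T, f t ^ 2) ≤ ∫ t in T, f' t ^ 2 := by
  have hfc : Continuous f := continuous_iff_continuousAt.2 fun x => (hf x).continuousAt
  have hTm : MeasurableSet T := hT.ordConnected.measurableSet
  have i1 : Integrable fun t => f t ^ 2 :=
    int_sq hfc hs
  have i2 : Integrable fun t => f' t ^ 2 :=
    int_sq hf' hs'
  by_cases hne : (T ∩ Ioo (h - r) h).Nonempty
  · set a := sInf (T ∩ Ioo (h - r) h) with ha
    have hbb : BddBelow (T ∩ Ioo (h - r) h) := ⟨h - r, fun x hx => hx.2.1.le⟩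
    have ha1 : h - r ≤ a := le_csInf hne fun x hx => hx.2.1.le
    have ha2 : a < h := by
      obtain ⟨x, hx⟩ := hne
      exact (csInf_le hbb hx).trans_lt hx.2.2
    have hsub : Ioo a h ⊆ T := by
      intro x hx
      obtain ⟨y, hy, hyx⟩ := exists_lt_of_csInf_lt hne hx.1
      exact hT hyx.le hy.1
    have e1 : ∫ t in T, f t ^ 2 ≤ ∫ t in a..h, f t ^ 2 := by
      rw [intervalIntegral.integral_of_le ha2.le, ← integral_Icc_eq_integral_Ioc,
        ← integral_indicator hTm, ← integral_indicator measurableSet_Icc]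
      apply integral_mono (i1.indicator hTm) (i1.indicator measurableSet_Icc)
      intro t
      by_cases htT : t ∈ T
      · by_cases ht : t ∈ Icc a h
        · simp [htT, ht]
        · have : f t = 0 := by
            rcases le_or_gt h t with h' | h'
            · exact h1 t h'
            rcases le_or_gt t (h - r) with h'' | h''
            · exact h2 t htT h''
            exact absurd ⟨csInf_le hbb ⟨htT, h'', h'⟩, h'.le⟩ ht
          simp [ht, htT, this]
      · simp only [htT, not_false_eq_true, indicator_of_notMem]
        exact indicator_nonneg (fun _ _ => sq_nonneg _) _
    have e2 : ∫ t in a..h, f' t ^ 2 ≤ ∫ t in T, f' t ^ 2 := by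
      rw [intervalIntegral.integral_of_le ha2.le, integral_Ioc_eq_integral_Ioo]
      exact setIntegral_mono_set i2.integrableOn (Eventually.of_forall fun t => sq_nonneg _)
        hsub.eventuallyLE
    have e3 := wirtinger_right ha2 (fun x _ => hf x) hf'.continuousOn (h1 h le_rfl)
    have e4 : (π / (2 * r)) ^ 2 ≤ (π / (2 * (h - a))) ^ 2 := by
      have : 0 < h - a := by linarith
      gcongr; linarith
    have e5 : 0 ≤ ∫ t in a..h, f t ^ 2 :=
      intervalIntegral.integral_nonneg ha2.le fun t _ => sq_nonneg _
    calc _ ≤ (π / (2 * r)) ^ 2 * ∫ t in a..h, f t ^ 2 := by gcongr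
      _ ≤ (π / (2 * (h - a))) ^ 2 * ∫ t in a..h, f t ^ 2 := by gcongr
      _ ≤ _ := e3
      _ ≤ _ := e2
  · have : ∫ t in T, f t ^ 2 = 0 := by
      apply setIntegral_eq_zero_of_forall_eq_zero
      intro t ht
      have : f t = 0 := by
        rcases le_or_gt h t with h' | h'
        · exact h1 t h'
        rcases le_or_gt t (h - r) with h'' | h''
        · exact h2 t ht h''
        exact absurd ⟨t, ht, h'', h'⟩ hne
      simp [this]
    rw [this, mul_zero]
    exact integral_nonneg fun t => sq_nonneg _

lemma fiber_le (c : E2) {e : E2} (he : ‖e‖ = 1) {S : Set E2} (hS : MeasurableSet S) {G H : E2 → ℝ}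
    (hG : IntegrableOn G S) (hH : IntegrableOn H S)
    (h : ∀ s, ∫ t in {t | fr c e (s, t) ∈ S}, G (fr c e (s, t)) ≤
      ∫ t in {t | fr c e (s, t) ∈ S}, H (fr c e (s, t))) :
    ∫ x in S, G x ≤ ∫ x in S, H x := by
  have hm : MeasurableSet (fr c e ⁻¹' S) := (continuous_fr c e).measurable hS
  have key : ∀ {G : E2 → ℝ}, IntegrableOn G S → IntegrableOn (fun z => G (fr c e z)) (fr c e ⁻¹' S) := by
    intro G hG
    exact ((mp_fr c he).integrableOn_comp_preimage (emb_fr c he)).2 hG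
  rw [← setIntegral_fr c he, ← setIntegral_fr c he S H, int_sec hm (key hG), int_sec hm (key hH)]
  have key2 : ∀ {G : E2 → ℝ}, IntegrableOn G S →
      Integrable (fun s => ∫ t in Prod.mk s ⁻¹' (fr c e ⁻¹' S), G (fr c e (s, t))) := by
    intro G hG
    have := ((integrable_indicator_iff hm).2 (key hG)).integral_prod_left
    refine this.congr (Eventually.of_forall fun s => ?_)
    simp only
    rw [← integral_indicator (hm.preimage measurable_prodMk_left)]
    rfl
  exact integral_mono (key2 hG) (key2 hH) h

lemma hasDerivAt_fr {u : E2 → ℝ} (hu : ContDiff ℝ 1 u) (c e : E2) (s t : ℝ) :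
    HasDerivAt (fun t => u (fr c e (s, t))) (fderiv ℝ u (fr c e (s, t)) (perp e)) t := by
  have h1 : HasDerivAt (fun t => fr c e (s, t)) (perp e) t := by
    have : HasDerivAt (fun t : ℝ => c + s • e + t • perp e) ((1:ℝ) • perp e) t :=
      ((hasDerivAt_id t).smul_const (perp e)).const_add _
    simpa [fr] using this
  exact ((hu.differentiable (by norm_num) _).hasFDerivAt).comp_hasDerivAt t h1

lemma fr_line_ce (c : E2) {e : E2} (he : ‖e‖ = 1) (s : ℝ) :
    Topology.IsClosedEmbedding (fun t => fr c e (s, t)) := by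
  have h1 : Topology.IsClosedEmbedding (Prod.mk s : ℝ → ℝ × ℝ) := by
    refine ⟨Topology.IsEmbedding.of_comp (by fun_prop) continuous_snd (by
      have : Prod.snd ∘ (Prod.mk s : ℝ → ℝ × ℝ) = id := rfl
      rw [this]; exact Topology.IsEmbedding.id), ?_⟩
    have : range (Prod.mk s : ℝ → ℝ × ℝ) = {z | z.1 = s} := by
      ext ⟨a, b⟩; simp [eq_comm]
    rw [this]
    exact isClosed_eq continuous_fst continuous_const
  exact (frH c he).isClosedEmbedding.comp h1

lemma exists_unit_sep {Ω : Set E2} (ho : IsOpen Ω) (hc : Convex ℝ Ω) (hn : Ω.Nonempty) {y : E2}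
    (hy : y ∉ Ω) : ∃ n : E2, ‖n‖ = 1 ∧ ∀ z ∈ Ω, ⟪z, n⟫ < ⟪y, n⟫ := by
  obtain ⟨f, hf⟩ := geometric_hahn_banach_open_point hc ho hy
  set v := (InnerProductSpace.toDual ℝ E2).symm f with hv
  have hfv : ∀ z, f z = ⟪z, v⟫ := by
    intro z; rw [real_inner_comm, hv, InnerProductSpace.toDual_symm_apply]
  have hv0 : v ≠ 0 := by
    intro h0
    obtain ⟨z, hz⟩ := hn
    have := hf z hz
    rw [hfv, hfv, h0] at this; simp at this
  refine ⟨‖v‖⁻¹ • v, by rw [norm_smul, norm_inv, norm_norm, inv_mul_cancel₀ (norm_ne_zero_iff.2 hv0)], ?_⟩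
  intro z hz
  rw [inner_smul_right, inner_smul_right, ← hfv, ← hfv]
  exact mul_lt_mul_of_pos_left (hf z hz) (inv_pos.2 (norm_pos_iff.2 hv0))

lemma hersch_fin {m : ℕ} (n : Fin m → E2) (h : Fin m → ℝ) (hn : ∀ i, ‖n i‖ = 1) {r : ℝ} (hr : 0 < r)
    {u : E2 → ℝ} (hu : ContDiff ℝ 1 u) (hs : HasCompactSupport u)
    (h1 : ∀ i, ∀ x, u x ≠ 0 → ⟪x, n i⟫ < h i)
    (h2 : ∀ x, u x ≠ 0 → ∃ i, h i - ⟪x, n i⟫ < r) :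
    (π / (2 * r)) ^ 2 * (∫ x, u x ^ 2) ≤ ∫ x, ‖fderiv ℝ u x‖ ^ 2 := by
  have hfc : Continuous (fderiv ℝ u) := hu.continuous_fderiv (by norm_num)
  have i1 : Integrable fun x => u x ^ 2 :=
    int_sq hu.continuous hs
  have i2 : Integrable fun x => ‖fderiv ℝ u x‖ ^ 2 :=
    int_sq hfc.norm (hs.fderiv ℝ).norm
  rcases Nat.eq_zero_or_pos m with rfl | hm
  · have : u = 0 := by
      ext x; by_contra hx; obtain ⟨i, _⟩ := h2 x hx; exact i.elim0
    subst this
    simp only [Pi.zero_apply, ne_eq, OfNat.ofNat_ne_zero, not_false_eq_true, zero_pow, integral_zero, mul_zero]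
    exact integral_nonneg fun x => sq_nonneg _
  have : Nonempty (Fin m) := ⟨⟨0, hm⟩⟩
  let d : Fin m → E2 → ℝ := fun i x => h i - ⟪x, n i⟫
  have hdc : ∀ i, Continuous (d i) := fun i => by simp only [d]; fun_prop
  let R : Fin m → Set E2 := fun i => ⋂ j, {x | d i x ≤ d j x ∧ (j < i → d i x < d j x)}
  have hRm : ∀ i, MeasurableSet (R i) := by
    intro i
    refine MeasurableSet.iInter fun j => ?_
    have : {x | d i x ≤ d j x ∧ (j < i → d i x < d j x)} =
        {x | d i x ≤ d j x} ∩ (if j < i then {x | d i x < d j x} else univ) := by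
      ext x; by_cases hji : j < i <;> simp [hji]
    rw [this]
    refine (isClosed_le (hdc i) (hdc j)).measurableSet.inter ?_
    split_ifs
    · exact (isOpen_lt (hdc i) (hdc j)).measurableSet
    · exact MeasurableSet.univ
  have hRd : Pairwise (Function.onFun Disjoint R) := by
    intro i j hij
    rw [Function.onFun, Set.disjoint_left]
    intro x hx hx'
    simp only [R, mem_iInter, mem_setOf_eq] at hx hx'
    rcases lt_or_gt_of_ne hij with h' | h'
    · exact absurd ((hx' i).2 h') (not_lt.2 (hx j).1)
    · exact absurd ((hx j).2 h') (not_lt.2 (hx' i).1)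
  have hRu : ⋃ i, R i = univ := by
    rw [eq_univ_iff_forall]
    intro x
    obtain ⟨i0, hi0⟩ := Finite.exists_min (fun i => d i x)
    let S : Finset (Fin m) := Finset.univ.filter fun i => ∀ j, d i x ≤ d j x
    have hS : S.Nonempty := ⟨i0, by simp [S, hi0]⟩
    have hmin := S.min'_mem hS
    refine mem_iUnion.2 ⟨S.min' hS, ?_⟩
    simp only [R, mem_iInter, mem_setOf_eq]
    have hm' : ∀ j, d (S.min' hS) x ≤ d j x := by simpa [S] using hmin
    intro j
    refine ⟨hm' j, fun hj => lt_of_le_of_ne (hm' j) fun heq => ?_⟩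
    have : j ∈ S := by simp only [S, Finset.mem_filter, Finset.mem_univ, true_and]; rw [← heq]; exact hm'
    exact absurd (S.min'_le j this) (not_le.2 hj)
  have hIntg : ∀ {F : E2 → ℝ}, Integrable F → ∫ x, F x = ∑ i, ∫ x in R i, F x := by
    intro F hF
    rw [← integral_iUnion_fintype hRm hRd (fun i => hF.integrableOn), hRu, Measure.restrict_univ]
  rw [hIntg i1, hIntg i2, Finset.mul_sum]
  apply Finset.sum_le_sum
  intro i _
  rw [← integral_const_mul]
  -- frame with `perp e = n i`
  set e : E2 := -perp (n i) with he_def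
  have he : ‖e‖ = 1 := by rw [he_def, norm_neg, norm_perp, hn]
  have hpe : perp e = n i := by apply E2_ext <;> simp [he_def]
  apply fiber_le 0 he (hRm i) (i1.const_mul _).integrableOn i2.integrableOn
  intro s
  rw [integral_const_mul]
  have hdline : ∀ j t, d j (fr 0 e (s, t)) = h j - s * ⟪e, n j⟫ - t * ⟪n i, n j⟫ := by
    intro j t
    simp only [d, fr, zero_add, hpe, inner_add_left, inner_smul_left]
    simp; ring
  have hnn : ∀ j, ⟪n i, n j⟫ ≤ 1 := by
    intro j
    calc _ ≤ ‖n i‖ * ‖n j‖ := real_inner_le_norm _ _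
      _ = 1 := by rw [hn, hn, one_mul]
  have hii : ⟪n i, n i⟫ = 1 := by rw [real_inner_self_eq_norm_sq, hn]; norm_num
  have hei : ⟪e, n i⟫ = 0 := by rw [inner_E2, he_def]; simp; ring
  have hdi : ∀ t, d i (fr 0 e (s, t)) = h i - t := by
    intro t; rw [hdline, hii, hei]; ring
  have hcont : Continuous fun t => fr 0 e (s, t) := (continuous_fr 0 e).comp (by fun_prop)
  have hcs : HasCompactSupport fun t => fderiv ℝ u (fr 0 e (s, t)) :=
    (hs.fderiv ℝ).comp_isClosedEmbedding (fr_line_ce 0 he s)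
  have hder : Continuous fun t => fderiv ℝ u (fr 0 e (s, t)) (perp e) :=
    (hfc.comp hcont).clm_apply continuous_const
  have hder2 : HasCompactSupport fun t => fderiv ℝ u (fr 0 e (s, t)) (perp e) :=
    hcs.comp_left (g := fun L : E2 →L[ℝ] ℝ => L (perp e)) (by simp)
  calc _ ≤ ∫ t in {t | fr 0 e (s, t) ∈ R i}, (fderiv ℝ u (fr 0 e (s, t)) (perp e)) ^ 2 := by
        apply hersch1 (h := h i) (r := r) _ (fun t => hasDerivAt_fr hu 0 e s t) _ _ _ hr
        · intro t ht
          by_contra hne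
          have := h1 i _ hne
          have h3 := hdi t
          simp only [d] at h3
          linarith
        · intro t ht htr
          by_contra hne
          obtain ⟨j, hj⟩ := h2 _ hne
          simp only [R, mem_iInter, mem_setOf_eq] at ht
          have h3 := (ht j).1
          rw [hdi t] at h3
          simp only [d] at h3
          linarith
        · intro t t' htt ht
          simp only [R, mem_iInter, mem_setOf_eq] at ht ⊢
          intro j
          have h3 := ht j
          rw [hdi t, hdline j t] at h3
          rw [hdi t', hdline j t']
          have h4 : (t' - t) * ⟪n i, n j⟫ ≤ (t' - t) * 1 :=
            mul_le_mul_of_nonneg_left (hnn j) (by linarith)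
          exact ⟨by linarith [h3.1], fun hji => by linarith [h3.2 hji]⟩
        · exact hder
        · exact hs.comp_isClosedEmbedding (fr_line_ce 0 he s)
        · exact hder2
    _ ≤ _ := by
        apply integral_mono
        · apply Integrable.integrableOn
          exact int_sq hder hder2
        · apply Integrable.integrableOn
          exact int_sq (hfc.comp hcont).norm hcs.norm
        · intro t
          simp only
          rw [← sq_abs]
          gcongr
          calc _ ≤ ‖fderiv ℝ u (fr 0 e (s, t))‖ * ‖perp e‖ := ContinuousLinearMap.le_opNorm _ _
            _ = _ := by rw [norm_perp, he, mul_one]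

lemma hersch {Ω : Set E2} (ho : IsOpen Ω) (hb : Bornology.IsBounded Ω) (hc : Convex ℝ Ω)
    (hn : Ω.Nonempty) : ∃ c : E2, ∃ r : ℝ, 0 < r ∧ c ∈ Ω ∧ Metric.ball c r ⊆ Ω ∧ ∀ u : E2 → ℝ, ContDiff ℝ 1 u →
      HasCompactSupport u → tsupport u ⊆ Ω →
      (π / (2 * r)) ^ 2 * (∫ x, u x ^ 2) ≤ ∫ x, ‖fderiv ℝ u x‖ ^ 2 := by
  have hcpt := hb.isCompact_closure
  obtain ⟨c, hcc, hmax⟩ := hcpt.exists_isMaxOn hn.closure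
    (Metric.continuous_infDist_pt (Ωᶜ)).continuousOn
  have hΩc : (Ωᶜ).Nonempty := by
    rw [nonempty_compl]; rintro rfl
    exact NormedSpace.unbounded_univ ℝ E2 hb
  set r := Metric.infDist c Ωᶜ with hr
  have hr0 : 0 < r := by
    obtain ⟨x, hx⟩ := hn
    have : Metric.infDist x Ωᶜ ≤ r := hmax (subset_closure hx)
    refine lt_of_lt_of_le ?_ this
    rw [← ho.isClosed_compl.notMem_iff_infDist_pos hΩc]
    simpa using hx
  have hball : Metric.ball c r ⊆ Ω := by
    intro x hx
    by_contra hxΩ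
    have : r ≤ dist c x := Metric.infDist_le_dist_of_mem (by simpa using hxΩ)
    rw [Metric.mem_ball, dist_comm] at hx
    linarith
  refine ⟨c, r, hr0, hball (Metric.mem_ball_self hr0), hball, fun u hu hs hsu => ?_⟩
  have key : ∀ r', r < r' → (π / (2 * r')) ^ 2 * (∫ x, u x ^ 2) ≤ ∫ x, ‖fderiv ℝ u x‖ ^ 2 := by
    intro r' hr'
    have hx : ∀ x ∈ tsupport u, ∃ n : E2, ∃ h : ℝ, ‖n‖ = 1 ∧ (∀ z ∈ Ω, ⟪z, n⟫ < h) ∧ h - ⟪x, n⟫ < r' := by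
      intro x hx
      have h1 : Metric.infDist x Ωᶜ < r' :=
        lt_of_le_of_lt (hmax (subset_closure (hsu hx))) hr'
      obtain ⟨y, hy, hxy⟩ := (Metric.infDist_lt_iff hΩc).1 h1
      obtain ⟨n, hn1, hn2⟩ := exists_unit_sep ho hc hn hy
      refine ⟨n, ⟪y, n⟫, hn1, hn2, ?_⟩
      rw [← inner_sub_left]
      calc _ ≤ ‖y - x‖ * ‖n‖ := real_inner_le_norm _ _
        _ < r' := by rw [hn1, mul_one, ← dist_eq_norm, dist_comm]; exact hxy
    choose! n h hn1 hn2 hn3 using hx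
    obtain ⟨T, hT, hcov⟩ := hs.isCompact.elim_nhds_subcover (fun x => {z | h x - ⟪z, n x⟫ < r'})
      (fun x hx => (isOpen_lt (by fun_prop) continuous_const).mem_nhds (hn3 x hx))
    let g : Fin T.card → E2 := fun i => (T.equivFin.symm i).1
    have hg : ∀ i, g i ∈ tsupport u := fun i => hT _ (T.equivFin.symm i).2
    apply hersch_fin (fun i => n (g i)) (fun i => h (g i)) (fun i => hn1 _ (hg i)) (hr0.trans hr') hu hs
    · intro i x hux
      exact hn2 _ (hg i) x (hsu (subset_tsupport u hux))
    · intro x hux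
      have := hcov (subset_tsupport u hux)
      simp only [mem_iUnion] at this
      obtain ⟨y, hy, hy2⟩ := this
      exact ⟨T.equivFin ⟨y, hy⟩, by simpa [g] using hy2⟩
  apply sq_mul_le_of_forall_lt (by positivity)
  intro k hk0 hk
  have := key (π / (2 * k)) (by
    rw [lt_div_iff₀ (by positivity)] at hk ⊢; linarith)
  have e : π / (2 * (π / (2 * k))) = k := by field_simp
  rwa [e] at this

/-! Payne-Weinberger inequality. -/

lemma line_null (n : E2) {e : E2} (he : ‖e‖ = 1) : volume {x : E2 | ⟪x - n, e⟫ = 0} = 0 := by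
  rw [← volume_fr n he]
  have : fr n e ⁻¹' {x : E2 | ⟪x - n, e⟫ = 0} = {0} ×ˢ univ := by
    ext z; simp only [mem_preimage, mem_setOf_eq, inner_fr n he]; simp
  rw [this, Measure.volume_eq_prod, Measure.prod_prod]; simp

lemma integrableOn_cont {K : Set E2} (hb : Bornology.IsBounded K) {f : E2 → ℝ} (hf : Continuous f) :
    IntegrableOn f K :=
  (hf.continuousOn.integrableOn_compact hb.isCompact_closure).mono_set subset_closure

lemma split_half {K : Set E2} (hm : MeasurableSet K) (n : E2) {e : E2} (he : ‖e‖ = 1) {f : E2 → ℝ}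
    (hf : IntegrableOn f K) :
    ∫ x in K, f x = (∫ x in K ∩ {x | 0 < ⟪x - n, e⟫}, f x) + ∫ x in K ∩ {x | 0 < ⟪x - n, -e⟫}, f x := by
  have m1 : MeasurableSet {x : E2 | 0 < ⟪x - n, e⟫} := (isOpen_lt (by fun_prop) (by fun_prop)).measurableSet
  have m2 : MeasurableSet {x : E2 | 0 < ⟪x - n, -e⟫} := (isOpen_lt (by fun_prop) (by fun_prop)).measurableSet
  rw [← setIntegral_union _ (hm.inter m2) (hf.mono_set inter_subset_left) (hf.mono_set inter_subset_left)]
  · apply setIntegral_congr_set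
    have h0 : ∀ᵐ x : E2, ⟪x - n, e⟫ ≠ 0 := by
      rw [ae_iff]; simpa using line_null n he
    filter_upwards [h0] with x hx
    apply propext
    show x ∈ K ↔ x ∈ (K ∩ {x | 0 < ⟪x - n, e⟫}) ∪ (K ∩ {x | 0 < ⟪x - n, -e⟫})
    simp only [mem_union, mem_inter_iff, mem_setOf_eq, inner_neg_right]
    constructor
    · intro hK
      rcases lt_or_gt_of_ne hx with h | h
      · exact Or.inr ⟨hK, by linarith⟩
      · exact Or.inl ⟨hK, h⟩
    · rintro (h | h) <;> exact h.1
  · rw [Set.disjoint_left]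
    rintro x ⟨_, h1⟩ ⟨_, h2⟩
    simp only [mem_setOf_eq, inner_neg_right] at h1 h2
    linarith

def dirv (θ : ℝ) : E2 := !₂[cos θ, sin θ]

lemma norm_dirv (θ : ℝ) : ‖dirv θ‖ = 1 := by
  have : ‖dirv θ‖ ^ 2 = 1 := by rw [norm_sq_E2]; simp [dirv]
  nlinarith [norm_nonneg (dirv θ)]

lemma continuous_dirv : Continuous dirv := by
  unfold dirv
  apply (PiLp.continuous_toLp 2 _).comp
  apply continuous_pi
  intro i; fin_cases i <;> simp <;> fun_prop

lemma bisect {K : Set E2} (ho : IsOpen K) (hb : Bornology.IsBounded K) {u : E2 → ℝ} (hu : Continuous u)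
    (h0 : ∫ x in K, u x = 0) (n : E2) :
    ∃ e : E2, ‖e‖ = 1 ∧ ∫ x in K ∩ {x | 0 < ⟪x - n, e⟫}, u x = 0 := by
  have hi := integrableOn_cont hb hu
  have mH : ∀ e : E2, MeasurableSet {x : E2 | 0 < ⟪x - n, e⟫} := fun e =>
    (isOpen_lt (by fun_prop) (by fun_prop)).measurableSet
  let F : ℝ → ℝ := fun θ => ∫ x in K ∩ {x | 0 < ⟪x - n, dirv θ⟫}, u x
  have hF : ∀ θ, F θ = ∫ x in K, {x | 0 < ⟪x - n, dirv θ⟫}.indicator u x := by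
    intro θ
    rw [setIntegral_indicator (mH _)]
  have hFc : Continuous F := by
    rw [continuous_iff_continuousAt]
    intro θ0
    have : F = fun θ => ∫ x in K, {x | 0 < ⟪x - n, dirv θ⟫}.indicator u x := funext hF
    rw [this]
    apply continuousAt_of_dominated (bound := fun x => |u x|)
    · exact Eventually.of_forall fun θ => (hi.aestronglyMeasurable).indicator (mH _)
    · refine Eventually.of_forall fun θ => Eventually.of_forall fun x => ?_
      exact norm_indicator_le_norm_self _ _
    · exact hi.abs
    · have h0 : ∀ᵐ x ∂(volume.restrict K), ⟪x - n, dirv θ0⟫ ≠ 0 := by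
        apply ae_restrict_of_ae
        rw [ae_iff]; simpa using line_null n (norm_dirv θ0)
      filter_upwards [h0] with x hx
      have hc : Continuous fun θ => ⟪x - n, dirv θ⟫ := continuous_const.inner continuous_dirv
      rcases lt_or_gt_of_ne hx with h | h
      · have : ∀ᶠ θ in nhds θ0, {x | 0 < ⟪x - n, dirv θ⟫}.indicator u x = 0 := by
          filter_upwards [hc.continuousAt.eventually_lt_const h] with θ hθ
          apply indicator_of_notMem
          simp only [mem_setOf_eq, not_lt]; exact le_of_lt hθ
        exact (continuousAt_const (y := (0:ℝ))).congr (this.mono fun _ h => h.symm)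
      · have : ∀ᶠ θ in nhds θ0, {x | 0 < ⟪x - n, dirv θ⟫}.indicator u x = u x := by
          filter_upwards [hc.continuousAt.eventually_const_lt h] with θ hθ
          exact indicator_of_mem (by simpa using hθ) _
        exact (continuousAt_const (y := u x)).congr (this.mono fun _ h => h.symm)
  have hpi : F π = - F 0 := by
    have h1 : dirv π = -dirv 0 := by apply E2_ext <;> simp [dirv]
    have := split_half ho.measurableSet n (norm_dirv 0) hi
    rw [h0, ← h1] at this
    simp only [F]; linarith
  have : ∃ θ ∈ Icc 0 π, F θ = 0 := by
    rcases le_total (F 0) 0 with h | h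
    · exact intermediate_value_Icc pi_pos.le hFc.continuousOn ⟨h, by linarith⟩
    · exact intermediate_value_Icc' pi_pos.le hFc.continuousOn ⟨by linarith, h⟩
  obtain ⟨θ, _, hθ⟩ := this
  exact ⟨dirv θ, norm_dirv θ, hθ⟩

lemma pw_induct {Ω : Set E2} (hb : Bornology.IsBounded Ω) {u : E2 → ℝ}
    (hu : Continuous u) (Φ : E2 → ℝ) (hΦ : Continuous Φ) (N : Finset E2)
    (hthin : ∀ K : Set E2, IsOpen K → Convex ℝ K → K.Nonempty → K ⊆ Ω → (∫ x in K, u x = 0) →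
      (∀ n ∈ N, n ∉ K) → 0 ≤ ∫ x in K, Φ x) :
    ∀ k : ℕ, ∀ K : Set E2, IsOpen K → Convex ℝ K → K.Nonempty → K ⊆ Ω → (∫ x in K, u x = 0) →
      (∀ M : Finset E2, M ⊆ N → (∀ n ∈ M, n ∈ K) → M.card ≤ k) → 0 ≤ ∫ x in K, Φ x := by
  intro k
  induction k with
  | zero =>
    intro K ho hc hn hK h0 hM
    apply hthin K ho hc hn hK h0
    intro n hn hnK
    have := hM {n} (by simpa using hn) (by simpa using hnK)
    simp at this
  | succ k ih =>
    intro K ho hc hn hK h0 hM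
    by_cases hex : ∃ n ∈ N, n ∈ K
    · obtain ⟨n, hnN, hnK⟩ := hex
      have hbK := hb.subset hK
      obtain ⟨e, he, he0⟩ := bisect ho hbK hu h0 n
      have hoH : ∀ e : E2, IsOpen {x : E2 | 0 < ⟪x - n, e⟫} := fun e => isOpen_lt (by fun_prop) (by fun_prop)
      have hcH : ∀ e : E2, Convex ℝ {x : E2 | 0 < ⟪x - n, e⟫} := by
        intro e x hx y hy a b ha hb hab
        simp only [mem_setOf_eq] at *
        have : a • x + b • y - n = a • (x - n) + b • (y - n) := by
          have : n = a • n + b • n := by rw [← add_smul, hab, one_smul]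
          nth_rw 1 [this]; module
        rw [this, inner_add_left, inner_smul_left, inner_smul_left]
        simp only [conj_trivial]
        rcases ha.eq_or_lt with rfl | ha
        · have : b = 1 := by linarith
          subst this; simpa using hy
        · have : 0 ≤ b * ⟪y - n, e⟫ := mul_nonneg hb hy.le
          have : 0 < a * ⟪x - n, e⟫ := mul_pos ha hx
          linarith
      have hne : ∀ e : E2, ‖e‖ = 1 → (K ∩ {x : E2 | 0 < ⟪x - n, e⟫}).Nonempty := by
        intro e he
        obtain ⟨r, hr, hrK⟩ := Metric.isOpen_iff.1 ho n hnK
        refine ⟨n + (r / 2) • e, hrK ?_, ?_⟩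
        · rw [mem_ball_iff_norm]; simp [norm_smul, he, abs_of_pos hr]; exact hr
        · simp only [mem_setOf_eq, add_sub_cancel_left, inner_smul_left, conj_trivial,
            real_inner_self_eq_norm_sq, he]
          positivity
      have hstep : ∀ e : E2, ‖e‖ = 1 → (∫ x in K ∩ {x | 0 < ⟪x - n, e⟫}, u x = 0) →
          0 ≤ ∫ x in K ∩ {x | 0 < ⟪x - n, e⟫}, Φ x := by
        intro e he he0
        apply ih _ (ho.inter (hoH e)) (hc.inter (hcH e)) (hne e he) (inter_subset_left.trans hK) he0
        intro M hMN hMK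
        have h1 : n ∉ M := by
          intro h; have := (hMK n h).2; simp at this
        have := hM (insert n M) (Finset.insert_subset hnN hMN) (by
          intro m hm
          rcases Finset.mem_insert.1 hm with rfl | h
          · exact hnK
          · exact (hMK m h).1)
        rw [Finset.card_insert_of_notMem h1] at this
        omega
      have s1 := split_half ho.measurableSet n he (integrableOn_cont hbK hu)
      have s2 := split_half ho.measurableSet n he (integrableOn_cont hbK hΦ)
      rw [s2]
      refine add_nonneg (hstep e he he0) (hstep (-e) (by rw [norm_neg, he]) ?_)
      linarith
    · push Not at hex
      exact hthin K ho hc hn hK h0 hex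

lemma exists_diam {K : Set E2} (ho : IsOpen K) (hb : Bornology.IsBounded K) (hn : K.Nonempty) :
    ∃ p ∈ closure K, ∃ q ∈ closure K, 0 < dist p q ∧ dist p q = Metric.diam K ∧
      ∀ x ∈ closure K, ∀ y ∈ closure K, dist x y ≤ dist p q := by
  have hc : IsCompact (closure K ×ˢ closure K) := hb.isCompact_closure.prod hb.isCompact_closure
  obtain ⟨⟨p, q⟩, ⟨hp, hq⟩, hmax⟩ := hc.exists_isMaxOn (hn.closure.prod hn.closure)
    (f := fun z : E2 × E2 => dist z.1 z.2) (by fun_prop)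
  have hm : ∀ x ∈ closure K, ∀ y ∈ closure K, dist x y ≤ dist p q := fun x hx y hy =>
    isMaxOn_iff.1 hmax (x, y) ⟨hx, hy⟩
  refine ⟨p, hp, q, hq, ?_, ?_, hm⟩
  · obtain ⟨x, hx⟩ := hn
    obtain ⟨r, hr, hrK⟩ := Metric.isOpen_iff.1 ho x hx
    have h1 : x + (r / 2) • dirv 0 ∈ K := hrK (by
      rw [mem_ball_iff_norm]; simp [norm_smul, norm_dirv, abs_of_pos hr]; exact hr)
    have := hm _ (subset_closure h1) _ (subset_closure hx)
    rw [dist_eq_norm] at this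
    simp only [add_sub_cancel_left, norm_smul, norm_dirv, mul_one, Real.norm_eq_abs] at this
    exact lt_of_lt_of_le (by positivity) this
  · apply le_antisymm
    · rw [← Metric.diam_closure]
      exact Metric.dist_le_diam_of_mem hb.closure hp hq
    · exact Metric.diam_le_of_forall_dist_le dist_nonneg fun x hx y hy =>
        hm _ (subset_closure hx) _ (subset_closure hy)

lemma fr_zero (c e : E2) : fr c e (0, 0) = c := by apply E2_ext <;> simp

/-- geometry of a convex set along its diameter -/
lemma diam_frame {K : Set E2} {p q : E2} (hpq : 0 < dist p q) (hp : p ∈ closure K) (hq : q ∈ closure K)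
    (hm : ∀ x ∈ closure K, ∀ y ∈ closure K, dist x y ≤ dist p q) :
    ∃ e : E2, ‖e‖ = 1 ∧ fr p e (dist p q, 0) = q ∧
      ∀ z, fr p e z ∈ closure K → z.1 ∈ Icc 0 (dist p q) ∧ |z.2| ≤ dist p q := by
  set L := dist p q with hL
  have hqp : ‖q - p‖ = L := by rw [← dist_eq_norm, dist_comm]
  refine ⟨L⁻¹ • (q - p), by rw [norm_smul, norm_inv, Real.norm_eq_abs, abs_of_pos hpq, hqp, inv_mul_cancel₀ hpq.ne'], ?_, ?_⟩
  · simp [fr, smul_smul, mul_inv_cancel₀ hpq.ne']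
  · have he : ‖L⁻¹ • (q - p)‖ = 1 := by rw [norm_smul, norm_inv, Real.norm_eq_abs, abs_of_pos hpq, hqp, inv_mul_cancel₀ hpq.ne']
    set e := L⁻¹ • (q - p) with he'
    have hq' : fr p e (L, 0) = q := by simp [fr, he', smul_smul, mul_inv_cancel₀ hpq.ne']
    intro z hz
    have h1 := hm _ hz _ hp
    have h2 := hm _ hz _ hq
    rw [dist_eq_norm] at h1 h2
    have h3 := norm_fr_sub (c := p) he z (0, 0)
    have h4 := norm_fr_sub (c := p) he z (L, 0)
    rw [fr_zero] at h3
    rw [hq'] at h4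
    have h5 : ‖fr p e z - p‖ ^ 2 ≤ L ^ 2 := by gcongr
    have h6 : ‖fr p e z - q‖ ^ 2 ≤ L ^ 2 := by gcongr
    rw [h3] at h5; rw [h4] at h6
    simp only [sub_zero] at h5 h6
    refine ⟨⟨?_, ?_⟩, ?_⟩
    · by_contra h; push Not at h; nlinarith [sq_nonneg z.2]
    · by_contra h; push Not at h; nlinarith [sq_nonneg z.2]
    · apply abs_le_of_sq_le_sq _ hpq.le
      nlinarith [sq_nonneg z.1]

lemma thin_height {K : Set E2} (ho : IsOpen K) (hc : Convex ℝ K) (hn : K.Nonempty) {p e : E2}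
    (he : ‖e‖ = 1) {L δ : ℝ} (hL : 0 < L) (hp : p ∈ closure K) (hq : fr p e (L, 0) ∈ closure K)
    (hδ : 0 < δ) (hball : ∀ x, ¬ Metric.ball x δ ⊆ K) {z : ℝ × ℝ} (hz : fr p e z ∈ closure K)
    (hz1 : z.1 ∈ Icc 0 L) (hz2 : |z.2| ≤ L) : |z.2| ≤ 9 * δ := by
  by_contra hlt
  push Not at hlt
  obtain ⟨s, η⟩ := z
  simp only at hlt hz1 hz2
  have hη : η ≠ 0 := by rintro rfl; simp at hlt; linarith
  have hcc := hc.closure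
  have hIntg : interior (closure K) = K := by
    rw [hc.interior_closure_eq_interior_of_nonempty_interior (by rwa [ho.interior_eq]), ho.interior_eq]
  apply hball (fr p e ((L + s) / 3, η / 3))
  rw [← hIntg]
  apply interior_maximal _ Metric.isOpen_ball
  intro w hw
  set m := fr p e ((L + s) / 3, η / 3) with hm
  rw [mem_ball_iff_norm] at hw
  set x := ⟪w - m, e⟫ with hx
  set y := ⟪w - m, perp e⟫ with hy
  have hxw : |x| < δ := lt_of_le_of_lt (by
    calc |x| ≤ ‖w - m‖ * ‖e‖ := abs_real_inner_le_norm _ _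
      _ = _ := by rw [he, mul_one]) hw
  have hyw : |y| < δ := lt_of_le_of_lt (by
    calc |y| ≤ ‖w - m‖ * ‖perp e‖ := abs_real_inner_le_norm _ _
      _ = _ := by rw [norm_perp, he, mul_one]) hw
  have hwm : w = fr m e (x, y) := (fr_inner m he w).symm
  set γ := 1 / 3 + y / η with hγ
  set β := 1 / 3 + x / L - (s / L) * (y / η) with hβ
  have b1 : |y / η| < 1 / 9 := by
    rw [abs_div, div_lt_iff₀ (abs_pos.2 hη)]; linarith
  have b2 : |x / L| < 1 / 9 := by
    rw [abs_div, abs_of_pos hL, div_lt_iff₀ hL]; linarith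
  have b3 : |(s / L) * (y / η)| ≤ 1 / 9 := by
    rw [abs_mul]
    have : |s / L| ≤ 1 := by
      rw [abs_div, abs_of_pos hL, div_le_one hL, abs_of_nonneg hz1.1]; exact hz1.2
    calc |s / L| * |y / η| ≤ 1 * (1 / 9) := by gcongr
      _ = _ := by norm_num
  rw [abs_lt] at b1 b2
  rw [abs_le] at b3
  have hγ0 : 0 ≤ γ := by rw [hγ]; linarith
  have hβ0 : 0 ≤ β := by rw [hβ]; linarith
  have hα0 : 0 ≤ 1 - β - γ := by rw [hγ, hβ]; linarith
  have hwe : w = (1 - β - γ) • p + β • fr p e (L, 0) + γ • fr p e (s, η) := by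
    rw [hwm, hm, hγ, hβ]
    apply E2_ext <;> simp <;> field_simp <;> ring
  rw [hwe]
  rcases (show γ < 1 by rw [hγ]; linarith) with hγ1
  have h1γ : (0:ℝ) < 1 - γ := by linarith
  have hmid := hcc hp hq (a := (1 - β - γ) / (1 - γ)) (b := β / (1 - γ)) (by positivity) (by positivity)
    (by rw [← add_div]; rw [div_eq_one_iff_eq h1γ.ne']; ring)
  have := hcc hmid hz (a := 1 - γ) (b := γ) h1γ.le hγ0 (by ring)
  rw [smul_add, smul_smul, smul_smul, mul_div_cancel₀ _ h1γ.ne', mul_div_cancel₀ _ h1γ.ne'] at this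
  exact this

lemma hasDerivAt_fr1 {u : E2 → ℝ} (hu : ContDiff ℝ 1 u) (c e : E2) (s : ℝ) :
    HasDerivAt (fun s => u (fr c e (s, 0))) (fderiv ℝ u (fr c e (s, 0)) e) s := by
  have h1 : HasDerivAt (fun s => fr c e (s, 0)) e s := by
    have : HasDerivAt (fun s : ℝ => c + s • e) ((1:ℝ) • e) s :=
      ((hasDerivAt_id s).smul_const e).const_add _
    simpa [fr] using this
  exact ((hu.differentiable (by norm_num) _).hasFDerivAt).comp_hasDerivAt s h1

lemma thin_final {k A U V1 V2 W G M ε : ℝ} (hA : 0 < A) (hk : 0 ≤ k) (hε : 0 ≤ ε) (hε1 : ε ≤ 1)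
    (h1 : |V1| ≤ ε * A) (h2 : U ≤ V2 + 2 * M * ε * A) (h3 : W ≤ G + 2 * M * ε * A)
    (hpw : k * (V2 * A - V1 ^ 2) ≤ W * A) : k * U ≤ G + (2 * M + 2 * M * k + k) * ε * A := by
  have h4 : V1 ^ 2 ≤ (ε * A) ^ 2 := by rw [← sq_abs]; gcongr
  have h5 : k * V2 * A ≤ (W + k * ε ^ 2 * A) * A := by nlinarith [mul_le_mul_of_nonneg_left h4 hk]
  have h6 := le_of_mul_le_mul_right h5 hA
  have h7 : k * ε ^ 2 * A ≤ k * ε * A := by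
    have : ε ^ 2 ≤ ε := by nlinarith
    gcongr
  have h8 := mul_le_mul_of_nonneg_left h2 hk
  nlinarith

lemma thin_pw {K : Set E2} (ho : IsOpen K) (hb : Bornology.IsBounded K) (hc : Convex ℝ K) (hn : K.Nonempty)
    {u : E2 → ℝ} (hu : ContDiff ℝ 1 u) (h0 : ∫ x in K, u x = 0) {D M ε δ : ℝ}
    (hD : Metric.diam K ≤ D) (hε : 0 ≤ ε) (hε1 : ε ≤ 1) (hδ : 0 < δ) (hball : ∀ x, ¬ Metric.ball x δ ⊆ K)
    (hM : ∀ x ∈ closure K, |u x| ≤ M) (hM' : ∀ x ∈ closure K, ‖fderiv ℝ u x‖ ≤ M)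
    (hu1 : ∀ x ∈ closure K, ∀ y ∈ closure K, dist x y ≤ 9 * δ → |u x - u y| ≤ ε)
    (hu2 : ∀ x ∈ closure K, ∀ y ∈ closure K, dist x y ≤ 9 * δ → ‖fderiv ℝ u x - fderiv ℝ u y‖ ≤ ε) :
    (π / D) ^ 2 * (∫ x in K, u x ^ 2) ≤ (∫ x in K, ‖fderiv ℝ u x‖ ^ 2) +
      (2 * M + 2 * M * (π / D) ^ 2 + (π / D) ^ 2) * ε * (volume K).toReal := by
  obtain ⟨p, hp, q, hq, hpq, hdiam, hm⟩ := exists_diam ho hb hn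
  obtain ⟨e, he, heq, hfr⟩ := diam_frame hpq hp hq hm
  set L := dist p q with hL
  have hB : Body (fr p e ⁻¹' K) := body_fr p he ho hb hc hn
  set K' := fr p e ⁻¹' K with hK'
  have hproj := proj_eq hB
  have hcc := hc.closure
  have hseg : ∀ s ∈ Icc 0 L, fr p e (s, 0) ∈ closure K := by
    intro s hs
    have := hcc hp (heq ▸ hq) (a := 1 - s / L) (b := s / L)
      (by rw [sub_nonneg, div_le_one hpq]; exact hs.2) (div_nonneg hs.1 hpq.le) (by ring)
    convert this using 1
    apply E2_ext <;> simp <;> field_simp <;> ring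
  have hin : ∀ z ∈ K', fr p e z ∈ closure K := fun z hz => subset_closure hz
  have hz1 : ∀ z ∈ K', z.1 ∈ Icc 0 L := fun z hz => (hfr z (hin z hz)).1
  have hz2 : ∀ z ∈ K', dist (fr p e z) (fr p e (z.1, 0)) ≤ 9 * δ := by
    intro z hz
    have h1 := norm_fr_sub_le (c := p) he z.1 z.2 0
    rw [dist_eq_norm, show fr p e z = fr p e (z.1, z.2) from rfl, h1, sub_zero]
    exact thin_height ho hc hn he hpq hp (heq ▸ hq) hδ hball (hin z hz) (hz1 z hz) (hfr z (hin z hz)).2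
  have hLR : pR K' - pL K' ≤ L := by
    have hne : (Prod.fst '' K').Nonempty := hB.ne.image _
    have h1 : pR K' ≤ L := csSup_le hne (by rintro _ ⟨z, hz, rfl⟩; exact (hz1 z hz).2)
    have h2 : 0 ≤ pL K' := le_csInf hne (by rintro _ ⟨z, hz, rfl⟩; exact (hz1 z hz).1)
    linarith
  set v : ℝ → ℝ := fun s => u (fr p e (s, 0)) with hv
  set v' : ℝ → ℝ := fun s => fderiv ℝ u (fr p e (s, 0)) e with hv'
  have hdv : ∀ s, HasDerivAt v (v' s) s := fun s => hasDerivAt_fr1 hu p e s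
  have hfc : Continuous (fderiv ℝ u) := hu.continuous_fderiv (by norm_num)
  have hcl : Continuous fun s : ℝ => fr p e (s, 0) := (continuous_fr p e).comp (by fun_prop)
  have hvc : Continuous v := hu.continuous.comp hcl
  have hvc' : Continuous v' := (hfc.comp hcl).clm_apply continuous_const
  obtain ⟨R, hR, hbox⟩ := bdd_box hB.bdd
  have hpw := pw_concave hproj.1 (secLen_pos' hB) (fun s _ => secLen_le hR hbox s)
    (secLen_concave hB) hdv hvc'
  rw [← vol_sec hB, ← int_sec1_Ioo hB (φ := v) (integrableOn_fst hB hvc),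
    ← int_sec1_Ioo hB (φ := fun s => v s ^ 2) (integrableOn_fst hB (hvc.pow 2)),
    ← int_sec1_Ioo hB (φ := fun s => v' s ^ 2) (integrableOn_fst hB (hvc'.pow 2)), volume_fr p he] at hpw
  set A := (volume K).toReal with hA
  have hA0 : 0 < A := ENNReal.toReal_pos (ho.measure_pos volume hn).ne' hb.measure_lt_top.ne
  have hAK' : (volume K').toReal = A := by rw [volume_fr p he]
  have hmK' : MeasurableSet K' := hB.isOpen.measurableSet
  have int2 : ∀ {f : E2 → ℝ}, Continuous f → IntegrableOn (fun z => f (fr p e z)) K' := by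
    intro f hf
    have : Continuous fun z => f (fr p e z) := hf.comp (continuous_fr p e)
    exact (this.continuousOn.integrableOn_compact hB.bdd.isCompact_closure).mono_set subset_closure
  have hconst : ∀ c : ℝ, ∫ _ in K', c = c * A := by
    intro c; simp [Measure.real, hAK', mul_comm]
  have hfin : volume K' < ⊤ := hB.bdd.measure_lt_top
  have hcint : ∀ c : ℝ, IntegrableOn (fun _ : ℝ × ℝ => c) K' := fun c => integrableOn_const hfin.ne
  have iv : IntegrableOn (fun z : ℝ × ℝ => v z.1 ^ 2) K' := integrableOn_fst hB (hvc.pow 2)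
  have iv' : IntegrableOn (fun z : ℝ × ℝ => v' z.1 ^ 2) K' := integrableOn_fst hB (hvc'.pow 2)
  have iu : IntegrableOn (fun z => u (fr p e z) ^ 2) K' :=
    int2 (f := fun x => u x ^ 2) (hu.continuous.pow 2)
  have ig : IntegrableOn (fun z => ‖fderiv ℝ u (fr p e z)‖ ^ 2) K' :=
    int2 (f := fun x => ‖fderiv ℝ u x‖ ^ 2) (hfc.norm.pow 2)
  have e1 : |∫ z in K', v z.1| ≤ ε * A := by
    have h3 : ∫ z in K', v z.1 = ∫ z in K', (v z.1 - u (fr p e z)) := by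
      rw [integral_sub (integrableOn_fst hB hvc) (int2 hu.continuous), setIntegral_fr p he, h0, sub_zero]
    rw [h3, ← Real.norm_eq_abs]
    have := norm_setIntegral_le_of_norm_le_const hfin (f := fun z => v z.1 - u (fr p e z)) (C := ε) (by
      intro z hz
      rw [Real.norm_eq_abs, abs_sub_comm]
      exact hu1 _ (hin z hz) _ (hseg _ (hz1 z hz)) (hz2 z hz))
    rwa [Measure.real, hAK'] at this
  have e2 : ∫ x in K, u x ^ 2 ≤ (∫ z in K', v z.1 ^ 2) + 2 * M * ε * A := by
    rw [← setIntegral_fr p he, ← hconst, ← integral_add iv (hcint _)]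
    apply setIntegral_mono_on iu (iv.add (hcint _)) hmK'
    intro z hz
    have h3 := hu1 _ (hin z hz) _ (hseg _ (hz1 z hz)) (hz2 z hz)
    have h4 := hM _ (hin z hz)
    have h5 := hM _ (hseg _ (hz1 z hz))
    show u (fr p e z) ^ 2 ≤ u (fr p e (z.1, 0)) ^ 2 + 2 * M * ε
    set a := u (fr p e z)
    set b := u (fr p e (z.1, 0))
    have : a ^ 2 - b ^ 2 ≤ ε * (2 * M) := by
      calc a ^ 2 - b ^ 2 = (a - b) * (a + b) := by ring
        _ ≤ |(a - b) * (a + b)| := le_abs_self _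
        _ = |a - b| * |a + b| := abs_mul _ _
        _ ≤ ε * (2 * M) := by
          gcongr; exact (abs_add_le a b).trans (by linarith)
    linarith
  have e3 : ∫ z in K', v' z.1 ^ 2 ≤ (∫ x in K, ‖fderiv ℝ u x‖ ^ 2) + 2 * M * ε * A := by
    rw [← setIntegral_fr p he, ← hconst, ← integral_add ig (hcint _)]
    apply setIntegral_mono_on iv' (ig.add (hcint _)) hmK'
    intro z hz
    have h3 := hu2 _ (hin z hz) _ (hseg _ (hz1 z hz)) (hz2 z hz)
    have h4 := hM' _ (hin z hz)
    have h5 := hM' _ (hseg _ (hz1 z hz))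
    have h6 : |v' z.1| ≤ ‖fderiv ℝ u (fr p e (z.1, 0))‖ := by
      calc |v' z.1| ≤ ‖fderiv ℝ u (fr p e (z.1, 0))‖ * ‖e‖ :=
            (fderiv ℝ u (fr p e (z.1, 0))).le_opNorm e
        _ = _ := by rw [he, mul_one]
    have h7 := norm_sub_norm_le (fderiv ℝ u (fr p e (z.1, 0))) (fderiv ℝ u (fr p e z))
    rw [norm_sub_rev] at h7
    show v' z.1 ^ 2 ≤ ‖fderiv ℝ u (fr p e z)‖ ^ 2 + 2 * M * ε
    set a := ‖fderiv ℝ u (fr p e z)‖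
    set b := ‖fderiv ℝ u (fr p e (z.1, 0))‖
    have ha : 0 ≤ a := norm_nonneg _
    have hb : 0 ≤ b := norm_nonneg _
    have h8 : v' z.1 ^ 2 ≤ b ^ 2 := by rw [← sq_abs]; gcongr
    have h9 : (b - a) * (b + a) ≤ ε * (2 * M) := by
      apply mul_le_mul (by linarith) (by linarith) (by positivity) hε
    nlinarith
  have hD0 : 0 < D := lt_of_lt_of_le (hdiam ▸ hpq) hD
  refine thin_final hA0 (by positivity) hε hε1 e1 e2 e3 ?_
  rcases le_total (((∫ z in K', v z.1 ^ 2) * A - (∫ z in K', v z.1) ^ 2)) 0 with hneg | hpos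
  · refine (mul_nonpos_of_nonneg_of_nonpos (by positivity) hneg).trans ?_
    exact mul_nonneg (integral_nonneg fun z => sq_nonneg _) hA0.le
  · refine le_trans ?_ hpw
    have : 0 < pR K' - pL K' := by linarith [hproj.1]
    have hLD : pR K' - pL K' ≤ D := hLR.trans (hdiam ▸ hD)
    gcongr

theorem payne_weinberger {Ω : Set E2} (ho : IsOpen Ω) (hb : Bornology.IsBounded Ω) (hc : Convex ℝ Ω)
    (hn : Ω.Nonempty) {u : E2 → ℝ} (hu : ContDiff ℝ 1 u) (h0 : ∫ x in Ω, u x = 0) :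
    (π / Metric.diam Ω) ^ 2 * (∫ x in Ω, u x ^ 2) ≤ ∫ x in Ω, ‖fderiv ℝ u x‖ ^ 2 := by
  set D := Metric.diam Ω with hD
  have hfc : Continuous (fderiv ℝ u) := hu.continuous_fderiv (by norm_num)
  have hcpt := hb.isCompact_closure
  obtain ⟨M1, hM1⟩ := hcpt.exists_bound_of_continuousOn hu.continuous.continuousOn
  obtain ⟨M2, hM2⟩ := hcpt.exists_bound_of_continuousOn hfc.continuousOn
  set M := max M1 M2
  set C := (2 * M + 2 * M * (π / D) ^ 2 + (π / D) ^ 2) with hC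
  have hM0 : 0 ≤ M := by
    obtain ⟨x, hx⟩ := hn
    exact ((norm_nonneg _).trans (hM1 x (subset_closure hx))).trans (le_max_left _ _)
  have hC0 : 0 ≤ C := by positivity
  set A := (volume Ω).toReal
  have hA0 : 0 ≤ A := ENNReal.toReal_nonneg
  have huc1 := hcpt.uniformContinuousOn_of_continuous hu.continuous.continuousOn
  have huc2 := hcpt.uniformContinuousOn_of_continuous hfc.continuousOn
  rw [Metric.uniformContinuousOn_iff_le] at huc1 huc2
  have key : ∀ ε, 0 < ε → ε ≤ 1 → 0 ≤ ∫ x in Ω, (‖fderiv ℝ u x‖ ^ 2 + C * ε - (π / D) ^ 2 * u x ^ 2) := by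
    intro ε hε hε1
    obtain ⟨δ1, hδ1, h1⟩ := huc1 ε hε
    obtain ⟨δ2, hδ2, h2⟩ := huc2 ε hε
    set δ := min δ1 δ2 / 9 with hδ
    have hδ0 : 0 < δ := by positivity
    have hΦ : Continuous fun x => (‖fderiv ℝ u x‖ ^ 2 + C * ε - (π / D) ^ 2 * u x ^ 2) := by
      have := hu.continuous
      fun_prop
    obtain ⟨N, hN, hcov⟩ := hcpt.elim_nhds_subcover (fun x => Metric.ball x δ)
      (fun x _ => Metric.ball_mem_nhds x hδ0)
    refine pw_induct hb hu.continuous _ hΦ N ?_ N.card Ω ho hc hn le_rfl h0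
      (fun M hM _ => Finset.card_le_card hM)
    intro K hoK hcK hnK hKΩ hK0 hKN
    have hbK := hb.subset hKΩ
    have hcl := closure_mono hKΩ
    have hfin := hbK.measure_lt_top (μ := (volume : Measure E2))
    have := thin_pw hoK hbK hcK hnK hu hK0 (D := D) (M := M) (δ := δ) (Metric.diam_mono hKΩ hb) hε.le hε1 hδ0
      (by
        intro x hx
        have hxK : x ∈ Ω := hKΩ (hx (Metric.mem_ball_self hδ0))
        have := hcov (subset_closure hxK)
        simp only [mem_iUnion] at this
        obtain ⟨n, hn, hxn⟩ := this
        exact hKN n hn (hx (Metric.mem_ball_comm.1 hxn)))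
      (fun x hx => (hM1 x (hcl hx)).trans (le_max_left _ _))
      (fun x hx => (hM2 x (hcl hx)).trans (le_max_right _ _))
      (fun x hx y hy hxy => h1 x (hcl hx) y (hcl hy) (by
        have := min_le_left δ1 δ2; rw [hδ] at hxy; linarith))
      (fun x hx y hy hxy => by
        rw [← dist_eq_norm]
        exact h2 x (hcl hx) y (hcl hy) (by
          have := min_le_right δ1 δ2; rw [hδ] at hxy; linarith))
    have i1 := integrableOn_cont hbK (f := fun x => ‖fderiv ℝ u x‖ ^ 2) (hfc.norm.pow 2)
    have i2 := integrableOn_cont hbK (f := fun x => (π / D) ^ 2 * u x ^ 2) ((hu.continuous.pow 2).const_mul _)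
    have i3 : IntegrableOn (fun _ : E2 => C * ε) K := integrableOn_const hfin.ne
    have i4 : IntegrableOn (fun x : E2 => ‖fderiv ℝ u x‖ ^ 2 + C * ε) K := i1.add i3
    have hcst : ∫ x in K, C * ε = C * ε * (volume K).toReal := by simp [Measure.real, mul_comm]
    rw [integral_sub i4 i2, integral_add i1 i3, hcst, integral_const_mul]
    linarith
  have i1 := integrableOn_cont hb (f := fun x => ‖fderiv ℝ u x‖ ^ 2) (hfc.norm.pow 2)
  have i2 := integrableOn_cont hb (f := fun x => (π / D) ^ 2 * u x ^ 2) ((hu.continuous.pow 2).const_mul _)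
  have hfin := hb.measure_lt_top (μ := (volume : Measure E2))
  have key2 : ∀ ε, 0 < ε → ε ≤ 1 → (π / D) ^ 2 * (∫ x in Ω, u x ^ 2) ≤
      (∫ x in Ω, ‖fderiv ℝ u x‖ ^ 2) + ε * (C * A) := by
    intro ε hε hε1
    have := key ε hε hε1
    have i3 : IntegrableOn (fun _ : E2 => C * ε) Ω := integrableOn_const hfin.ne
    have i4 : IntegrableOn (fun x : E2 => ‖fderiv ℝ u x‖ ^ 2 + C * ε) Ω := i1.add i3
    have hcst : ∫ x in Ω, C * ε = C * ε * A := by simp [Measure.real, A, mul_comm]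
    rw [integral_sub i4 i2, integral_add i1 i3, hcst, integral_const_mul] at this
    linarith
  apply le_of_forall_pos_le_add
  intro η hη
  have hCA : 0 ≤ C * A := mul_nonneg hC0 hA0
  have := key2 (min 1 (η / (C * A + 1))) (by positivity) (min_le_left _ _)
  have h3 : min 1 (η / (C * A + 1)) * (C * A) ≤ η := by
    calc min 1 (η / (C * A + 1)) * (C * A) ≤ (η / (C * A + 1)) * (C * A + 1) := by
          gcongr
          · exact min_le_right _ _
          · linarith
      _ = η := by field_simp
  linarith

lemma conc_ray {L s1 h s : ℝ} {p : ℝ → ℝ} (hconc : ConcaveOn ℝ (Ioo 0 L) p) (hp0 : ∀ s, 0 ≤ p s)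
    (h1 : 0 < s1) (h1L : s1 < L) (hs1 : h ≤ p s1) (hh : 0 ≤ h) (hs : 0 ≤ s) (hss : s ≤ s1) :
    h * (s / s1) ≤ p s := by
  rcases hs.eq_or_lt with rfl | hs
  · simpa using hp0 0
  rcases hss.eq_or_lt with rfl | hss
  · rw [div_self h1.ne', mul_one]; exact hs1
  have key : ∀ t, 0 < t → t < s → h * ((s - t) / (s1 - t)) ≤ p s := by
    intro t ht hts
    have hst : 0 < s1 - t := by linarith
    have := hconc.2 (show t ∈ Ioo 0 L from ⟨ht, by linarith⟩) (show s1 ∈ Ioo 0 L from ⟨h1, h1L⟩)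
      (show 0 ≤ (s1 - s) / (s1 - t) from div_nonneg (by linarith) hst.le)
      (show 0 ≤ (s - t) / (s1 - t) from div_nonneg (by linarith) hst.le)
      (by field_simp; ring)
    have e : (s1 - s) / (s1 - t) * t + (s - t) / (s1 - t) * s1 = s := by field_simp; ring
    simp only [smul_eq_mul] at this
    rw [e] at this
    have h3 : 0 ≤ (s1 - s) / (s1 - t) * p t := mul_nonneg (div_nonneg (by linarith) hst.le) (hp0 t)
    have h4 : (s - t) / (s1 - t) * h ≤ (s - t) / (s1 - t) * p s1 :=
      mul_le_mul_of_nonneg_left hs1 (div_nonneg (by linarith) hst.le)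
    linarith
  have hc : ContinuousAt (fun t : ℝ => h * ((s - t) / (s1 - t))) 0 := by
    apply ContinuousAt.mul continuousAt_const
    apply ContinuousAt.div (by fun_prop) (by fun_prop)
    simpa using h1.ne'
  have ht := hc.tendsto
  simp only [sub_zero] at ht
  have : Tendsto (fun t : ℝ => h * ((s - t) / (s1 - t))) (nhdsWithin 0 (Ioi 0)) (nhds (h * (s / s1))) :=
    ht.mono_left nhdsWithin_le_nhds
  refine le_of_tendsto this ?_
  filter_upwards [Ioo_mem_nhdsGT hs] with t ht
  exact key t ht.1 ht.2

lemma conc_area {L s1 s2 h : ℝ} {p : ℝ → ℝ} (hconc : ConcaveOn ℝ (Ioo 0 L) p) (hp0 : ∀ s, 0 ≤ p s)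
    (h1 : 0 < s1) (h12 : s1 < s2) (h2L : s2 < L) (hs1 : h ≤ p s1) (hs2 : h ≤ p s2) (hh : 0 ≤ h)
    (hIntg : Integrable p) : h * (L + (s2 - s1)) / 2 ≤ ∫ s in Ioo 0 L, p s := by
  rw [← integral_Ioc_eq_integral_Ioo, ← intervalIntegral.integral_of_le (by linarith)]
  have ii : ∀ a b, IntervalIntegrable p volume a b := fun a b => hIntg.intervalIntegrable
  rw [← intervalIntegral.integral_add_adjacent_intervals (ii 0 s1) (ii s1 L),
    ← intervalIntegral.integral_add_adjacent_intervals (ii s1 s2) (ii s2 L)]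
  have e1 : h * s1 / 2 ≤ ∫ s in (0:ℝ)..s1, p s := by
    have : ∫ s in (0:ℝ)..s1, h * (s / s1) = h * s1 / 2 := by
      rw [intervalIntegral.integral_const_mul, intervalIntegral.integral_div, integral_id]
      field_simp; ring
    rw [← this]
    apply intervalIntegral.integral_mono_on h1.le (Continuous.intervalIntegrable (by fun_prop) _ _) (ii _ _)
    intro s hs
    exact conc_ray hconc hp0 h1 (by linarith) hs1 hh hs.1 hs.2
  have e2 : h * (s2 - s1) ≤ ∫ s in s1..s2, p s := by
    have : ∫ s in s1..s2, h = h * (s2 - s1) := by simp [mul_comm]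
    rw [← this]
    apply intervalIntegral.integral_mono_on h12.le (by simp) (ii _ _)
    intro s hs
    have hpos : 0 < s2 - s1 := by linarith
    have := hconc.2 (show s1 ∈ Ioo 0 L from ⟨h1, by linarith⟩) (show s2 ∈ Ioo 0 L from ⟨by linarith, h2L⟩)
      (show 0 ≤ (s2 - s) / (s2 - s1) from div_nonneg (by linarith [hs.2]) hpos.le)
      (show 0 ≤ (s - s1) / (s2 - s1) from div_nonneg (by linarith [hs.1]) hpos.le) (by field_simp; ring)
    have e : (s2 - s) / (s2 - s1) * s1 + (s - s1) / (s2 - s1) * s2 = s := by field_simp; ring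
    simp only [smul_eq_mul] at this
    rw [e] at this
    have h3 : (s2 - s) / (s2 - s1) * h ≤ (s2 - s) / (s2 - s1) * p s1 :=
      mul_le_mul_of_nonneg_left hs1 (div_nonneg (by linarith [hs.2]) hpos.le)
    have h4 : (s - s1) / (s2 - s1) * h ≤ (s - s1) / (s2 - s1) * p s2 :=
      mul_le_mul_of_nonneg_left hs2 (div_nonneg (by linarith [hs.1]) hpos.le)
    have h5 : (s2 - s) / (s2 - s1) * h + (s - s1) / (s2 - s1) * h = h := by field_simp; ring
    linarith
  have e3 : h * (L - s2) / 2 ≤ ∫ s in s2..L, p s := by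
    have hL2 : L - s2 ≠ 0 := by linarith
    have : ∫ s in s2..L, h * ((L - s) / (L - s2)) = h * (L - s2) / 2 := by
      rw [intervalIntegral.integral_const_mul, intervalIntegral.integral_div,
        intervalIntegral.integral_comp_sub_left (fun x => x), integral_id]
      field_simp; ring
    rw [← this]
    apply intervalIntegral.integral_mono_on h2L.le (Continuous.intervalIntegrable (by fun_prop) _ _) (ii _ _)
    intro s hs
    have hc2 : ConcaveOn ℝ (Ioo 0 L) (fun s => p (L - s)) := by
      refine ⟨convex_Ioo _ _, fun x hx y hy a b ha hb hab => ?_⟩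
      have := hconc.2 (show L - x ∈ Ioo 0 L from ⟨by linarith [hx.2], by linarith [hx.1]⟩)
        (show L - y ∈ Ioo 0 L from ⟨by linarith [hy.2], by linarith [hy.1]⟩) ha hb hab
      have e : a • (L - x) + b • (L - y) = L - (a • x + b • y) := by
        simp only [smul_eq_mul]; linear_combination L * hab
      rwa [e] at this
    have := conc_ray (s := L - s) (s1 := L - s2) hc2 (fun s => hp0 _) (by linarith) (by linarith)
      (h := h) (by simpa using hs2) hh (by linarith [hs.2]) (by linarith [hs.1])
    simpa using this
  linarith

lemma integrable_secLen {K : Set (ℝ × ℝ)} (h : Body K) : Integrable (secLen K) := by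
  have hm := measurable_secLen h.isOpen.measurableSet
  refine ⟨hm.aestronglyMeasurable, ?_⟩
  rw [hasFiniteIntegral_iff_ofReal (Eventually.of_forall fun s => secLen_nonneg _ _),
    lintegral_secLen h.bdd h.isOpen.measurableSet]
  exact h.bdd.measure_lt_top

lemma area_gt {Ω : Set E2} (ho : IsOpen Ω) (hb : Bornology.IsBounded Ω) (hc : Convex ℝ Ω)
    (hn : Ω.Nonempty) {c : E2} {r : ℝ} (hr : 0 < r) (hball : Metric.ball c r ⊆ Ω) :
    r * Metric.diam Ω < (volume Ω).toReal := by
  obtain ⟨p, hp, q, hq, hpq, hdiam, hm⟩ := exists_diam ho hb hn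
  obtain ⟨e, he, heq, hfr⟩ := diam_frame hpq hp hq hm
  rw [← hdiam]
  set L := dist p q with hL
  have hB : Body (fr p e ⁻¹' Ω) := body_fr p he ho hb hc hn
  set K' := fr p e ⁻¹' Ω with hK'
  have hz1 : ∀ z ∈ K', z.1 ∈ Icc 0 L := fun z hz => (hfr z (subset_closure hz)).1
  have hne : (Prod.fst '' K').Nonempty := hB.ne.image _
  have hbd := hB.bdd.image_fst
  have hcoord : ∀ x, (⟪x - p, e⟫, ⟪x - p, perp e⟫) ∈ K' ↔ x ∈ Ω := by
    intro x; rw [hK', mem_preimage, fr_inner p he]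
  have hpL : pL K' = 0 := by
    apply le_antisymm
    · apply le_of_forall_pos_le_add
      intro ε hε
      obtain ⟨x, hx, hxp⟩ := Metric.mem_closure_iff.1 hp ε hε
      have h1 : pL K' ≤ ⟪x - p, e⟫ := csInf_le hbd.bddBelow ⟨_, (hcoord x).2 hx, rfl⟩
      have h2 : ⟪x - p, e⟫ ≤ ‖x - p‖ * ‖e‖ := real_inner_le_norm _ _
      rw [he, mul_one, ← dist_eq_norm, dist_comm] at h2
      linarith
    · exact le_csInf hne (by rintro _ ⟨z, hz, rfl⟩; exact (hz1 z hz).1)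
  have hpR : pR K' = L := by
    apply le_antisymm
    · exact csSup_le hne (by rintro _ ⟨z, hz, rfl⟩; exact (hz1 z hz).2)
    · apply le_of_forall_pos_le_add
      intro ε hε
      obtain ⟨x, hx, hxq⟩ := Metric.mem_closure_iff.1 hq ε hε
      have h1 : ⟪x - p, e⟫ ≤ pR K' := le_csSup hbd.bddAbove ⟨_, (hcoord x).2 hx, rfl⟩
      have h2 : ⟪q - x, e⟫ ≤ ‖q - x‖ * ‖e‖ := real_inner_le_norm _ _
      rw [he, mul_one, ← dist_eq_norm] at h2
      have h3 : ⟪q - p, e⟫ = L := by rw [← heq, inner_fr p he]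
      have h4 : ⟪q - p, e⟫ = ⟪q - x, e⟫ + ⟪x - p, e⟫ := by rw [← inner_add_left]; congr 1; abel
      linarith
  set sc := ⟪c - p, e⟫ with hsc
  set tc := ⟪c - p, perp e⟫ with htc
  have hcfr : fr p e (sc, tc) = c := fr_inner p he c
  have hmem : ∀ z : ℝ × ℝ, (z.1 - sc) ^ 2 + (z.2 - tc) ^ 2 < r ^ 2 → z ∈ K' := by
    intro z hz
    apply hball
    rw [mem_ball_iff_norm]
    apply lt_of_pow_lt_pow_left₀ 2 hr.le
    have := norm_fr_sub (c := p) he z (sc, tc)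
    rw [hcfr] at this
    rw [this]; exact hz
  have hrs : ∀ r', 0 < r' → r' < r → r' ≤ sc ∧ sc + r' ≤ L := by
    intro r' h0 h1
    have a1 := (hz1 (sc - r', tc) (hmem _ (by simp; nlinarith))).1
    have a2 := (hz1 (sc + r', tc) (hmem _ (by simp; nlinarith))).2
    simp only at a1 a2
    exact ⟨by linarith, by linarith⟩
  have hr1 : r ≤ sc := le_of_forall_lt_imp_le_of_dense (fun a ha => by
    rcases le_or_gt a 0 with h | h
    · linarith [(hrs (r / 2) (by linarith) (by linarith)).1]
    · exact (hrs a h ha).1)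
  have hr2 : r ≤ L - sc := le_of_forall_lt_imp_le_of_dense (fun a ha => by
    rcases le_or_gt a 0 with h | h
    · linarith [(hrs (r / 2) (by linarith) (by linarith)).2]
    · linarith [(hrs a h ha).2])
  set τ := r ^ 2 / L with hτ
  have hτL : τ * L = r ^ 2 := by rw [hτ]; field_simp
  have hτ0 : 0 < τ := by positivity
  have hτr : τ ≤ r / 2 := by
    rw [hτ, div_le_iff₀ hpq]; nlinarith
  set w := √(r ^ 2 - τ ^ 2) with hw
  have hw2 : w ^ 2 = r ^ 2 - τ ^ 2 := Real.sq_sqrt (by nlinarith)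
  have hw0 : 0 ≤ w := Real.sqrt_nonneg _
  have hsec : ∀ s, (s - sc) ^ 2 = τ ^ 2 → 2 * w ≤ secLen K' s := by
    intro s hs
    have hsub : Ioo (tc - w) (tc + w) ⊆ Prod.mk s ⁻¹' K' := by
      intro t ht
      apply hmem
      simp only [hs]
      have : (t - tc) ^ 2 < w ^ 2 := by
        apply sq_lt_sq'
        · linarith [ht.1]
        · linarith [ht.2]
      linarith
    have h1 := measure_mono (μ := volume) hsub
    rw [Real.volume_Ioo, ← ofReal_secLen hB.bdd, ENNReal.ofReal_le_ofReal_iff (secLen_nonneg _ _)] at h1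
    linarith
  have hconc := secLen_concave hB
  have hvol := vol_sec hB
  rw [hpL, hpR] at hconc hvol
  have harea := conc_area hconc (secLen_nonneg K') (s1 := sc - τ) (s2 := sc + τ) (h := 2 * w) (by linarith) (by linarith) (by linarith)
    (hsec _ (by ring)) (hsec _ (by ring)) (by positivity) (integrable_secLen hB)
  rw [← hvol, volume_fr p he] at harea
  have hw_gt : r * L < w * (L + 2 * τ) := by
    apply lt_of_pow_lt_pow_left₀ 2 (by positivity)
    rw [mul_pow, mul_pow, hw2]
    -- (r^2 - τ^2)(L+2τ)^2 - r^2 L^2, with r^2 = τ L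
    rw [← hτL]
    have hτl : τ ≤ L / 4 := by linarith
    have : (τ * L - τ ^ 2) * (L + 2 * τ) ^ 2 - τ * L * L ^ 2 = τ ^ 2 * (3 * L ^ 2 - 4 * τ ^ 2) := by ring
    have : 0 < τ ^ 2 * (3 * L ^ 2 - 4 * τ ^ 2) := by
      apply mul_pos (by positivity); nlinarith
    linarith
  nlinarith

/-- A standard sequence of bump functions shrinking to the origin. -/
def bmp (n : ℕ) : ContDiffBump (0 : E2) where
  rIn := 1 / (2 * ((n : ℝ) + 1))
  rOut := 1 / ((n : ℝ) + 1)
  rIn_pos := by positivity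
  rIn_lt_rOut := by
    apply one_div_lt_one_div_of_lt <;> linarith [n.cast_nonneg (α := ℝ)]

/-- Mollification. -/
def mol (w : E2 → ℝ) (n : ℕ) (x : E2) : ℝ := ∫ t, (bmp n).normed volume t * w (x - t)

lemma mol_eq (w : E2 → ℝ) (n : ℕ) :
    mol w n = convolution ((bmp n).normed volume) w (ContinuousLinearMap.lsmul ℝ ℝ) volume := by
  ext x; rfl

lemma mol_contDiff {w : E2 → ℝ} (hw : Continuous w) (n : ℕ) : ContDiff ℝ (⊤ : ℕ∞) (mol w n) := by
  rw [mol_eq]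
  exact (bmp n).hasCompactSupport_normed.contDiff_convolution_left _ (bmp n).contDiff_normed
    hw.locallyIntegrable

lemma mol_dist {w : E2 → ℝ} {C : NNReal} (hw : LipschitzWith C w) (n : ℕ) (x : E2) :
    |mol w n x - w x| ≤ C * (1 / ((n : ℝ) + 1)) := by
  rw [mol_eq, ← Real.dist_eq]
  apply ContDiffBump.dist_normed_convolution_le hw.continuous.aestronglyMeasurable
  intro y hy
  refine (hw.dist_le_mul y x).trans ?_
  gcongr
  exact (Metric.mem_ball.1 hy).le

lemma bmp_int (n : ℕ) : Integrable (fun t => (bmp n).normed volume t) (volume : Measure E2) :=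
  (bmp n).continuous_normed.integrable_of_hasCompactSupport (bmp n).hasCompactSupport_normed

lemma mol_int {w : E2 → ℝ} (hw : Continuous w) (n : ℕ) (x : E2) :
    Integrable (fun t => (bmp n).normed volume t * w (x - t)) (volume : Measure E2) := by
  have h1 := (bmp n).continuous_normed (μ := (volume : Measure E2))
  apply Continuous.integrable_of_hasCompactSupport (by fun_prop)
  exact ((bmp n).hasCompactSupport_normed (μ := (volume : Measure E2))).mul_right

lemma mol_lip {w : E2 → ℝ} {C : NNReal} (hw : LipschitzWith C w) (n : ℕ) :
    LipschitzWith C (mol w n) := by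
  apply LipschitzWith.of_dist_le_mul
  intro x y
  rw [Real.dist_eq, mol, mol, ← integral_sub (mol_int hw.continuous n x) (mol_int hw.continuous n y)]
  refine (abs_integral_le_integral_abs).trans ?_
  have : ∫ t, (bmp n).normed volume t * (C * dist x y) = C * dist x y := by
    rw [integral_mul_const, (bmp n).integral_normed, one_mul]
  rw [← this]
  apply integral_mono_of_nonneg (Eventually.of_forall fun t => abs_nonneg _) ((bmp_int n).mul_const _)
  refine Eventually.of_forall fun t => ?_
  simp only
  rw [← mul_sub, abs_mul, abs_of_nonneg ((bmp n).nonneg_normed t)]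
  gcongr
  · exact (bmp n).nonneg_normed t
  · rw [← Real.dist_eq]
    have := hw.dist_le_mul (x - t) (y - t)
    simpa using this

lemma mol_fderiv {w : E2 → ℝ} {C : NNReal} (hw : LipschitzWith C w) (n : ℕ) (x : E2) :
    fderiv ℝ (mol w n) x =
      convolution ((bmp n).normed volume) (fderiv ℝ w) (ContinuousLinearMap.lsmul ℝ ℝ) volume x := by
  have hd : ∀ᵐ t : E2, DifferentiableAt ℝ w (x - t) := by
    have h := hw.ae_differentiableAt (μ := (volume : Measure E2))
    have hq : Measure.QuasiMeasurePreserving (fun t : E2 => x - t) volume volume :=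
      (Measure.measurePreserving_sub_left volume x).quasiMeasurePreserving
    exact hq.ae h
  have := (hasFDerivAt_integral_of_dominated_loc_of_lip (𝕜 := ℝ) (μ := (volume : Measure E2)) (s := univ) (x₀ := x)
    (F := fun x t => (bmp n).normed volume t * w (x - t))
    (F' := fun t => (bmp n).normed volume t • fderiv ℝ w (x - t))
    (bound := fun t => (bmp n).normed volume t * C) univ_mem
    (Eventually.of_forall fun y => (mol_int hw.continuous n y).aestronglyMeasurable)
    (mol_int hw.continuous n x) ?_ ?_ ((bmp_int n).mul_const _) ?_).2
  · exact this.fderiv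
  · have m1 : Measurable (fun t => fderiv ℝ w (x - t)) :=
      (measurable_fderiv ℝ w).comp (measurable_const.sub measurable_id)
    have m2 : Measurable (fun t => (bmp n).normed volume t) :=
      ((bmp n).continuous_normed (μ := (volume : Measure E2))).measurable
    exact (m2.smul m1).aestronglyMeasurable
  · refine Eventually.of_forall fun t => ?_
    apply LipschitzOnWith.of_dist_le_mul
    intro y _ z _
    rw [Real.dist_eq, ← mul_sub, abs_mul, Real.coe_nnabs, abs_mul, NNReal.abs_eq, mul_assoc]
    gcongr
    rw [← Real.dist_eq]
    have := hw.dist_le_mul (y - t) (z - t)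
    simpa using this
  · filter_upwards [hd] with t ht
    have h1 : HasFDerivAt (fun y => w (y - t)) (fderiv ℝ w (x - t)) x := by
      have := ht.hasFDerivAt.comp x ((hasFDerivAt_id x).sub_const t)
      rw [ContinuousLinearMap.comp_id] at this
      exact this
    exact h1.const_smul ((bmp n).normed volume t)

lemma mol_fderiv_tendsto {w : E2 → ℝ} {C : NNReal} (hw : LipschitzWith C w) :
    ∀ᵐ x : E2, Tendsto (fun n => fderiv ℝ (mol w n) x) atTop (nhds (fderiv ℝ w x)) := by
  have hl : LocallyIntegrable (fderiv ℝ w) (volume : Measure E2) := by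
    have : MemLp (fderiv ℝ w) ⊤ (volume : Measure E2) :=
      memLp_top_of_bound (measurable_fderiv ℝ w).aestronglyMeasurable C
        (Eventually.of_forall fun x => norm_fderiv_le_of_lipschitz ℝ hw)
    exact this.locallyIntegrable le_top
  have := ContDiffBump.ae_convolution_tendsto_right_of_locallyIntegrable (φ := bmp) (l := atTop) (K := 2)
    (μ := (volume : Measure E2)) (g := fderiv ℝ w) ?_ ?_ hl
  · filter_upwards [this] with x hx
    simpa only [mol_fderiv hw] using hx
  · exact tendsto_one_div_add_atTop_nhds_zero_nat
  · refine Eventually.of_forall fun n => ?_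
    show 1 / ((n : ℝ) + 1) ≤ 2 * (1 / (2 * ((n : ℝ) + 1)))
    apply le_of_eq; field_simp

lemma mol_support {w : E2 → ℝ} (n : ℕ) {r : ℝ} (hs : ∀ x, r ≤ ‖x‖ → w x = 0) (x : E2)
    (hx : r + 1 / ((n : ℝ) + 1) ≤ ‖x‖) : mol w n x = 0 := by
  rw [mol]
  have : ∀ t, (bmp n).normed volume t * w (x - t) = 0 := by
    intro t
    by_cases ht : ‖t‖ < 1 / ((n : ℝ) + 1)
    · rw [hs, mul_zero]
      have := norm_sub_norm_le x t
      linarith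
    · have : t ∉ Function.support ((bmp n).normed (volume : Measure E2)) := by
        rw [(bmp n).support_normed_eq]
        rw [mem_ball_zero_iff]; exact ht
      rw [Function.notMem_support.1 this, zero_mul]
  simp [this]

lemma sq_int_nonneg (μ : Measure E2) (u : E2 → ℝ) : 0 ≤ ∫ x, (u x)^2 ∂μ :=
  integral_nonneg fun x => sq_nonneg _

lemma fd_int_nonneg (μ : Measure E2) (u : E2 → ℝ) : 0 ≤ ∫ x, ‖fderiv ℝ u x‖^2 ∂μ :=
  integral_nonneg fun x => sq_nonneg _

lemma dEig1_mul_le {Ω : Set E2} {u : E2 → ℝ} (h1 : ContDiff ℝ (⊤ : ℕ∞) u) (h2 : HasCompactSupport u)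
    (h3 : tsupport u ⊆ Ω) : dEig1 Ω * ∫ x, (u x)^2 ≤ ∫ x, ‖fderiv ℝ u x‖^2 := by
  by_cases h : (∫ x, (u x)^2) = 0
  · rw [h, mul_zero]; exact fd_int_nonneg _ _
  · have hp : 0 < ∫ x, (u x)^2 := lt_of_le_of_ne (sq_int_nonneg _ _) (Ne.symm h)
    rw [← le_div_iff₀ hp]
    apply csInf_le
    · refine ⟨0, ?_⟩
      rintro _ ⟨v, -, -, -, -, rfl⟩
      exact div_nonneg (fd_int_nonneg _ _) (sq_int_nonneg _ _)
    · exact ⟨u, h1, h2, h3, h, rfl⟩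

lemma dEig1_nonneg (Ω : Set E2) : 0 ≤ dEig1 Ω := by
  apply Real.sInf_nonneg
  rintro _ ⟨v, -, -, -, -, rfl⟩
  exact div_nonneg (fd_int_nonneg _ _) (sq_int_nonneg _ _)

lemma le_dEig1 {Ω : Set E2} (ho : IsOpen Ω) (hn : Ω.Nonempty) {k : ℝ}
    (h : ∀ u : E2 → ℝ, ContDiff ℝ (⊤ : ℕ∞) u → HasCompactSupport u → tsupport u ⊆ Ω →
      k * ∫ x, (u x)^2 ≤ ∫ x, ‖fderiv ℝ u x‖^2) : k ≤ dEig1 Ω := by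
  apply le_csInf
  · obtain ⟨c, hc⟩ := hn
    obtain ⟨u, h1, h2, h3, h4, h5⟩ := exists_contDiff_tsupport_subset (n := (⊤ : ℕ∞)) (ho.mem_nhds hc)
    refine ⟨_, u, h3, h2, h1, ?_, rfl⟩
    have hc2 : Continuous fun x => u x ^ 2 := h3.continuous.pow 2
    have := hc2.integral_pos_of_hasCompactSupport_nonneg_nonzero (μ := volume) h2.sq' (fun x => sq_nonneg _)
      (x := c) (by simp [h5])
    exact this.ne'
  · rintro _ ⟨u, h1, h2, h3, h4, rfl⟩
    have hp : 0 < ∫ x, (u x)^2 := lt_of_le_of_ne (sq_int_nonneg _ _) (Ne.symm h4)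
    rw [le_div_iff₀ hp]
    exact h u h1 h2 h3

lemma nEig1_mul_le {Ω : Set E2} {u : E2 → ℝ} (h1 : ContDiff ℝ (⊤ : ℕ∞) u) 
    (h3 : (∫ x in Ω, u x) = 0) : nEig1 Ω * ∫ x in Ω, (u x)^2 ≤ ∫ x in Ω, ‖fderiv ℝ u x‖^2 := by
  by_cases h : (∫ x in Ω, (u x)^2) = 0
  · rw [h, mul_zero]; exact fd_int_nonneg _ _
  · have hp : 0 < ∫ x in Ω, (u x)^2 := lt_of_le_of_ne (sq_int_nonneg _ _) (Ne.symm h)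
    rw [← le_div_iff₀ hp]
    apply csInf_le
    · refine ⟨0, ?_⟩
      rintro _ ⟨v, -, -, -, rfl⟩
      exact div_nonneg (fd_int_nonneg _ _) (sq_int_nonneg _ _)
    · exact ⟨u, h1, h3, h, rfl⟩

lemma nEig1_nonneg (Ω : Set E2) : 0 ≤ nEig1 Ω := by
  apply Real.sInf_nonneg
  rintro _ ⟨v, -, -, -, rfl⟩
  exact div_nonneg (fd_int_nonneg _ _) (sq_int_nonneg _ _)

lemma vol_pos {Ω : Set E2} (ho : IsOpen Ω) (hb : Bornology.IsBounded Ω) (hn : Ω.Nonempty) :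
    0 < (volume Ω).toReal :=
  ENNReal.toReal_pos (ho.measure_pos volume hn).ne' hb.measure_lt_top.ne

lemma le_nEig1 {Ω : Set E2} (ho : IsOpen Ω) (hb : Bornology.IsBounded Ω) (hn : Ω.Nonempty) {k : ℝ}
    (h : ∀ u : E2 → ℝ, ContDiff ℝ (⊤ : ℕ∞) u → (∫ x in Ω, u x) = 0 →
      k * ∫ x in Ω, (u x)^2 ≤ ∫ x in Ω, ‖fderiv ℝ u x‖^2) : k ≤ nEig1 Ω := by
  apply le_csInf
  · have hA := vol_pos ho hb hn
    have hf : volume Ω < ⊤ := hb.measure_lt_top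
    set e : E2 := dirv 0
    have he : ‖e‖ = 1 := norm_dirv 0
    set m := (∫ x in Ω, ⟪x, e⟫) / (volume Ω).toReal with hm
    set u : E2 → ℝ := fun x => ⟪x, e⟫ - m with hu
    have hus : ContDiff ℝ (⊤ : ℕ∞) u := (contDiff_id.inner ℝ contDiff_const).sub contDiff_const
    have hu0 : ∫ x in Ω, u x = 0 := by
      rw [integral_sub (integrableOn_cont hb (by fun_prop)) (integrableOn_cont hb (by fun_prop))]
      rw [setIntegral_const, smul_eq_mul, hm, Measure.real]
      field_simp; ring
    refine ⟨_, u, hus, hu0, ?_, rfl⟩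
    intro h0
    rw [integral_eq_zero_iff_of_nonneg (fun x => sq_nonneg _)
      (integrableOn_cont hb (hus.continuous.pow 2))] at h0
    have hnull := line_null (m • e) he
    have : volume Ω = 0 := by
      have h1 : ∀ᵐ x ∂(volume.restrict Ω), False := by
        have h2 : ∀ᵐ x ∂(volume.restrict Ω), ⟪x - m • e, e⟫ ≠ 0 :=
          ae_restrict_of_ae (by rw [ae_iff]; simpa using hnull)
        filter_upwards [h0, h2] with x hx h2
        apply h2
        have : u x ^ 2 = 0 := hx
        have hux : u x = 0 := by simpa using this
        rw [inner_sub_left, real_inner_smul_left, real_inner_self_eq_norm_sq, he]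
        simp only [hu] at hux; linarith
      rw [ae_iff] at h1
      simpa using h1
    exact (ho.measure_pos volume hn).ne' this
  · rintro _ ⟨u, h1, h3, h4, rfl⟩
    have hp : 0 < ∫ x in Ω, (u x)^2 := lt_of_le_of_ne (sq_int_nonneg _ _) (Ne.symm h4)
    rw [le_div_iff₀ hp]
    exact h u h1 h3

lemma int_scale (F : E2 → ℝ) (c : E2) {ρ : ℝ} (hρ : 0 < ρ) :
    ∫ x, F x = ρ ^ 2 * ∫ x, F (c + ρ • x) := by
  have h1 := Measure.integral_comp_smul (volume : Measure E2) (fun x => F (c + x)) ρ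
  rw [h1, integral_add_left_eq_self (fun x => F x) c]
  simp only [finrank_euclideanSpace_fin, smul_eq_mul]
  rw [abs_of_pos (by positivity)]
  field_simp

lemma scale_fd (u : E2 → ℝ) (hu : Differentiable ℝ u) (c : E2) {ρ : ℝ} (hρ : 0 < ρ) :
    ∫ x, ‖fderiv ℝ (fun x => u (c + ρ • x)) x‖ ^ 2 = ∫ x, ‖fderiv ℝ u x‖ ^ 2 := by
  rw [int_scale (fun x => ‖fderiv ℝ u x‖ ^ 2) c hρ, ← integral_const_mul]
  congr 1; ext x
  have h1 : HasFDerivAt (fun x : E2 => c + ρ • x) (ρ • ContinuousLinearMap.id ℝ E2) x :=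
    ((hasFDerivAt_id x).const_smul ρ).const_add c
  have h2 := ((hu (c + ρ • x)).hasFDerivAt.comp x h1).fderiv
  have h3 : fderiv ℝ (fun x => u (c + ρ • x)) x = ρ • fderiv ℝ u (c + ρ • x) := by
    have : (fun x => u (c + ρ • x)) = u ∘ (fun x => c + ρ • x) := rfl
    rw [this, h2, ContinuousLinearMap.comp_smul, ContinuousLinearMap.comp_id]
  rw [h3, norm_smul, mul_pow, Real.norm_eq_abs, sq_abs]

/-- Test functions for the disc of radius `ρ`, read on the unit disc. -/
lemma dEig1_disc_scale {u : E2 → ℝ} (h1 : ContDiff ℝ (⊤ : ℕ∞) u) {ρ r : ℝ} (hρ : 0 < ρ) (hr : r < ρ)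
    (h3 : ∀ x, r ≤ ‖x‖ → u x = 0) :
    dEig1 unitDisc * ∫ x, (u x)^2 ≤ ρ ^ 2 * ∫ x, ‖fderiv ℝ u x‖^2 := by
  have hsub : tsupport (fun x => u (0 + ρ • x)) ⊆ Metric.closedBall 0 (r / ρ) := by
    apply closure_minimal _ Metric.isClosed_closedBall
    intro x hx
    rw [mem_closedBall_zero_iff]
    by_contra hlt
    push Not at hlt
    apply hx
    apply h3
    rw [zero_add, norm_smul, Real.norm_eq_abs, abs_of_pos hρ]
    rw [div_lt_iff₀ hρ] at hlt
    linarith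
  have := dEig1_mul_le (Ω := unitDisc) (u := fun x => u (0 + ρ • x)) (by fun_prop)
    (HasCompactSupport.of_support_subset_isCompact (isCompact_closedBall (0:E2) (r/ρ)) 
      ((subset_tsupport _).trans hsub)) (hsub.trans (by
        apply Metric.closedBall_subset_ball
        rw [div_lt_one hρ]; exact hr))
  rw [scale_fd u (h1.differentiable (by simp)) 0 hρ] at this
  rw [int_scale (fun x => u x ^ 2) 0 hρ]
  nlinarith [sq_nonneg ρ]

lemma dEig1_ball_le {Ω : Set E2} {c : E2} {ρ : ℝ} (hρ : 0 < ρ) (h : Metric.ball c ρ ⊆ Ω) :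
    ρ ^ 2 * dEig1 Ω ≤ dEig1 unitDisc := by
  apply le_dEig1 Metric.isOpen_ball ⟨0, by simp⟩
  intro u h1 h2 h3
  have hρ' : 0 < ρ⁻¹ := by positivity
  set T : E2 ≃ₜ E2 := (Homeomorph.smulOfNeZero ρ⁻¹ hρ'.ne').trans (Homeomorph.addLeft (-(ρ⁻¹ • c))) with hT
  have hTx : ∀ x, T x = -(ρ⁻¹ • c) + ρ⁻¹ • x := fun x => rfl
  have hs : HasCompactSupport (u ∘ T) := h2.comp_homeomorph T
  have hts : tsupport (u ∘ T) ⊆ Ω := by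
    rw [tsupport_comp_eq_preimage]
    intro x hx
    apply h
    have := h3 hx
    rw [hTx, mem_ball_zero_iff, neg_add_eq_sub, ← smul_sub, norm_smul, Real.norm_eq_abs, abs_of_pos hρ',
      inv_mul_lt_iff₀ hρ, mul_one] at this
    rwa [mem_ball_iff_norm]
  have e : u ∘ T = fun x => u (-(ρ⁻¹ • c) + ρ⁻¹ • x) := rfl
  have := dEig1_mul_le (Ω := Ω) (u := u ∘ T) (by rw [e]; fun_prop) hs hts
  rw [e, scale_fd u (h1.differentiable (by simp)) _ hρ'] at this
  rw [int_scale (fun x => u x ^ 2) (-(ρ⁻¹ • c)) hρ']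
  refine le_trans (le_of_eq ?_) this
  field_simp

lemma dEig1_lip {W : E2 → ℝ} {C : NNReal} (hW : LipschitzWith C W) {R : ℝ} (hR : 0 < R)
    (hs : ∀ x, R ≤ ‖x‖ → W x = 0) :
    dEig1 unitDisc * ∫ x, (W x)^2 ≤ R ^ 2 * ∫ x, ‖fderiv ℝ W x‖^2 := by
  have hinv : ∀ n : ℕ, 1 / ((n : ℝ) + 1) ≤ 1 := fun n => by
    rw [div_le_one (by positivity)]; linarith [n.cast_nonneg (α := ℝ)]
  have hinv0 : ∀ n : ℕ, 0 < 1 / ((n : ℝ) + 1) := fun n => by positivity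
  have key : ∀ n : ℕ, dEig1 unitDisc * ∫ x, (mol W n x)^2 ≤ 
      (R + 2 * (1 / ((n:ℝ) + 1))) ^ 2 * ∫ x, ‖fderiv ℝ (mol W n) x‖^2 := by
    intro n
    exact dEig1_disc_scale (mol_contDiff hW.continuous n) (r := R + 1 / ((n:ℝ)+1)) (by linarith [hinv0 n])
      (by linarith [hinv0 n]) (mol_support n hs)
  have hm0 : ∀ n x, x ∉ Metric.closedBall (0:E2) (R + 1) → mol W n x = 0 := by
    intro n x hx
    rw [mem_closedBall_zero_iff, not_le] at hx
    exact mol_support n hs x (by linarith [hinv n])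
  have hm0' : ∀ n x, x ∉ Metric.closedBall (0:E2) (R + 1) → fderiv ℝ (mol W n) x = 0 := by
    intro n x hx
    have : mol W n =ᶠ[nhds x] fun _ => 0 := by
      filter_upwards [Metric.isClosed_closedBall.isOpen_compl.mem_nhds hx] with y hy
      exact hm0 n y hy
    rw [this.fderiv_eq]; simp
  obtain ⟨B, hB⟩ := (isCompact_closedBall (0:E2) (R+1)).exists_bound_of_continuousOn hW.continuous.continuousOn
  have hK : IntegrableOn (fun _ : E2 => (B + C)^2) (Metric.closedBall (0:E2) (R+1)) :=
    integrableOn_const (isCompact_closedBall (0:E2) (R+1)).measure_lt_top.ne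
  have hK' : IntegrableOn (fun _ : E2 => (C:ℝ)^2) (Metric.closedBall (0:E2) (R+1)) :=
    integrableOn_const (isCompact_closedBall (0:E2) (R+1)).measure_lt_top.ne
  have mK : MeasurableSet (Metric.closedBall (0:E2) (R+1)) := Metric.isClosed_closedBall.measurableSet
  have t1 : Tendsto (fun n => ∫ x, (mol W n x)^2) atTop (nhds (∫ x, (W x)^2)) := by
    apply tendsto_integral_of_dominated_convergence ((Metric.closedBall (0:E2) (R+1)).indicator fun _ => (B + C)^2)
    · intro n; exact ((mol_contDiff hW.continuous n).continuous.pow 2).aestronglyMeasurable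
    · rwa [integrable_indicator_iff mK]
    · intro n
      refine Eventually.of_forall fun x => ?_
      by_cases hx : x ∈ Metric.closedBall (0:E2) (R+1)
      · rw [indicator_of_mem hx, norm_pow]
        gcongr
        have h1 := hB x hx
        have h2 := mol_dist hW n x
        have h3 : (C:ℝ) * (1 / ((n:ℝ)+1)) ≤ C * 1 := by gcongr; exact hinv n
        rw [Real.norm_eq_abs] at h1 ⊢
        have := abs_sub_abs_le_abs_sub (mol W n x) (W x)
        linarith
      · rw [indicator_of_notMem hx, hm0 n x hx]; simp
    · refine Eventually.of_forall fun x => ?_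
      apply Tendsto.pow
      rw [tendsto_iff_norm_sub_tendsto_zero]
      apply squeeze_zero (fun n => norm_nonneg _) (fun n => mol_dist hW n x)
      have := tendsto_one_div_add_atTop_nhds_zero_nat (𝕜 := ℝ)
      simpa using this.const_mul (C:ℝ)
  have t2 : Tendsto (fun n => ∫ x, ‖fderiv ℝ (mol W n) x‖^2) atTop (nhds (∫ x, ‖fderiv ℝ W x‖^2)) := by
    apply tendsto_integral_of_dominated_convergence ((Metric.closedBall (0:E2) (R+1)).indicator fun _ => (C:ℝ)^2)
    · intro n
      exact ((measurable_fderiv ℝ _).norm.pow_const 2).aestronglyMeasurable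
    · rwa [integrable_indicator_iff mK]
    · intro n
      refine Eventually.of_forall fun x => ?_
      by_cases hx : x ∈ Metric.closedBall (0:E2) (R+1)
      · rw [indicator_of_mem hx, norm_pow, norm_norm]
        gcongr
        exact norm_fderiv_le_of_lipschitz ℝ (mol_lip hW n)
      · rw [indicator_of_notMem hx, hm0' n x hx]; simp
    · filter_upwards [mol_fderiv_tendsto hW] with x hx
      exact hx.norm.pow 2
  have t3 : Tendsto (fun n : ℕ => (R + 2 * (1 / ((n:ℝ) + 1))) ^ 2) atTop (nhds (R^2)) := by
    have := tendsto_one_div_add_atTop_nhds_zero_nat (𝕜 := ℝ)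
    have := ((this.const_mul 2).const_add R).pow 2
    simpa using this
  exact le_of_tendsto_of_tendsto' (b := atTop) (t1.const_mul _) (t3.mul t2) key

lemma nEig1_lip {Ω : Set E2} (ho : IsOpen Ω) (hb : Bornology.IsBounded Ω) (hn : Ω.Nonempty)
    {W : E2 → ℝ} {C : NNReal} (hW : LipschitzWith C W) (h0 : ∫ x in Ω, W x = 0) :
    nEig1 Ω * ∫ x in Ω, (W x)^2 ≤ ∫ x in Ω, ‖fderiv ℝ W x‖^2 := by
  have hA := vol_pos ho hb hn
  have hf : volume Ω ≠ ⊤ := hb.measure_lt_top.ne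
  have hinv : ∀ n : ℕ, 1 / ((n : ℝ) + 1) ≤ 1 := fun n => by
    rw [div_le_one (by positivity)]; linarith [n.cast_nonneg (α := ℝ)]
  obtain ⟨B, hB⟩ := hb.isCompact_closure.exists_bound_of_continuousOn hW.continuous.continuousOn
  have hbd : ∀ n, ∀ x ∈ Ω, |mol W n x| ≤ B + C := by
    intro n x hx
    have h1 := hB x (subset_closure hx)
    have h2 := mol_dist hW n x
    have h3 : (C:ℝ) * (1 / ((n:ℝ)+1)) ≤ C * 1 := by gcongr; exact hinv n
    rw [Real.norm_eq_abs] at h1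
    have := abs_sub_abs_le_abs_sub (mol W n x) (W x)
    linarith
  have hpt : ∀ x, Tendsto (fun n => mol W n x) atTop (nhds (W x)) := by
    intro x
    rw [tendsto_iff_norm_sub_tendsto_zero]
    apply squeeze_zero (fun n => norm_nonneg _) (fun n => mol_dist hW n x)
    have := tendsto_one_div_add_atTop_nhds_zero_nat (𝕜 := ℝ)
    simpa using this.const_mul (C:ℝ)
  have cm : ∀ n, Continuous (mol W n) := fun n => (mol_contDiff hW.continuous n).continuous
  have t0 : Tendsto (fun n => ∫ x in Ω, mol W n x) atTop (nhds 0) := by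
    rw [← h0]
    apply tendsto_integral_of_dominated_convergence (fun _ => B + C)
    · intro n; exact (cm n).aestronglyMeasurable
    · exact integrableOn_const hf
    · intro n
      filter_upwards [ae_restrict_mem ho.measurableSet] with x hx
      exact hbd n x hx
    · exact Eventually.of_forall hpt
  have t1 : Tendsto (fun n => ∫ x in Ω, (mol W n x)^2) atTop (nhds (∫ x in Ω, (W x)^2)) := by
    apply tendsto_integral_of_dominated_convergence (fun _ => (B + C)^2)
    · intro n; exact ((cm n).pow 2).aestronglyMeasurable
    · exact integrableOn_const hf
    · intro n
      filter_upwards [ae_restrict_mem ho.measurableSet] with x hx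
      rw [norm_pow]
      gcongr
      exact hbd n x hx
    · exact Eventually.of_forall fun x => (hpt x).pow 2
  have t2 : Tendsto (fun n => ∫ x in Ω, ‖fderiv ℝ (mol W n) x‖^2) atTop (nhds (∫ x in Ω, ‖fderiv ℝ W x‖^2)) := by
    apply tendsto_integral_of_dominated_convergence (fun _ => (C:ℝ)^2)
    · intro n
      exact ((measurable_fderiv ℝ _).norm.pow_const 2).aestronglyMeasurable
    · exact integrableOn_const hf
    · intro n
      refine Eventually.of_forall fun x => ?_
      rw [norm_pow, norm_norm]
      gcongr
      exact norm_fderiv_le_of_lipschitz ℝ (mol_lip hW n)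
    · filter_upwards [ae_restrict_of_ae (mol_fderiv_tendsto hW)] with x hx
      exact hx.norm.pow 2
  have key : ∀ n : ℕ, nEig1 Ω * ((∫ x in Ω, (mol W n x)^2) - (∫ x in Ω, mol W n x) ^ 2 / (volume Ω).toReal) ≤ 
      ∫ x in Ω, ‖fderiv ℝ (mol W n) x‖^2 := by
    intro n
    set m := (∫ x in Ω, mol W n x) / (volume Ω).toReal with hm
    have i1 : IntegrableOn (fun x => mol W n x) Ω := integrableOn_cont hb (cm n)
    have i2 : IntegrableOn (fun x => mol W n x ^ 2) Ω := integrableOn_cont hb ((cm n).pow 2)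
    have i3 : IntegrableOn (fun x => 2 * m * mol W n x) Ω := i1.const_mul _
    have i4 : IntegrableOn (fun x : E2 => m) Ω := integrableOn_const hf
    have i5 : IntegrableOn (fun x : E2 => m ^ 2) Ω := integrableOn_const hf
    have i6 : IntegrableOn (fun x => mol W n x ^ 2 - 2 * m * mol W n x) Ω := i2.sub i3
    have e1 : ∫ x in Ω, (mol W n x - m) = 0 := by
      rw [integral_sub i1 i4, setIntegral_const, smul_eq_mul, Measure.real, hm]
      field_simp; ring
    have e2 : ∫ x in Ω, (mol W n x - m)^2 = (∫ x in Ω, (mol W n x)^2) - (∫ x in Ω, mol W n x) ^ 2 / (volume Ω).toReal := by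
      have : (fun x => (mol W n x - m)^2) = fun x => (mol W n x ^ 2 - 2 * m * mol W n x) + m ^ 2 := by ext x; ring
      rw [this, integral_add i6 i5, integral_sub i2 i3, integral_const_mul, setIntegral_const, smul_eq_mul, Measure.real, hm]
      field_simp; ring
    have := nEig1_mul_le (Ω := Ω) (u := fun x => mol W n x - m) ((mol_contDiff hW.continuous n).sub contDiff_const) e1
    rw [e2] at this
    simpa only [fderiv_sub_const] using this
  have := le_of_tendsto_of_tendsto' (b := atTop) ((t1.sub ((t0.pow 2).div_const _)).const_mul _) t2 key
  simpa using this

lemma conc_moment {a b : ℝ} {p : ℝ → ℝ} (hab : a < b) (hconc : ConcaveOn ℝ (Ioo a b) p)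
    (hp0 : ∀ s, 0 ≤ p s) (hIntg : Integrable p) :
    ∫ s in Ioo a b, s * p s ≤ (a + 2 * (b - a) / 3) * ∫ s in Ioo a b, p s := by
  set L := b - a with hL
  have hL0 : 0 < L := by linarith
  set τ := 2 * L / 3 with hτ
  have hc2 : ConcaveOn ℝ (Ioo 0 L) (fun s => p (a + s)) := by
    refine ⟨convex_Ioo _ _, fun x hx y hy α β hα hβ hαβ => ?_⟩
    have := hconc.2 (show a + x ∈ Ioo a b from ⟨by linarith [hx.1], by linarith [hx.2]⟩)
      (show a + y ∈ Ioo a b from ⟨by linarith [hy.1], by linarith [hy.2]⟩) hα hβ hαβ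
    have e : α • (a + x) + β • (a + y) = a + (α • x + β • y) := by
      simp only [smul_eq_mul]; linear_combination a * hαβ
    rwa [e] at this
  have hτ0 : 0 < τ := by positivity
  have hτL : τ < L := by linarith
  set q := p (a + τ) with hq
  have pt : ∀ s ∈ Icc a b, s ∈ Ioo a b → q / τ * ((a + τ - s) * (s - a)) ≤ (a + τ - s) * p s := by
    intro s _ hs
    rcases le_or_gt (s - a) τ with h | h
    · have := conc_ray hc2 (fun s => hp0 _) hτ0 hτL (h := q) le_rfl (hp0 _) (s := s - a) (by linarith [hs.1]) h
      simp only [add_sub_cancel] at this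
      have h2 : 0 ≤ a + τ - s := by linarith
      calc q / τ * ((a + τ - s) * (s - a)) = (a + τ - s) * (q * ((s - a) / τ)) := by ring
        _ ≤ _ := by gcongr
    · have h0 : 0 < s - a := by linarith
      have := conc_ray hc2 (fun s => hp0 _) h0 (by linarith [hs.2]) (h := p s) (by simp) (hp0 _) (s := τ) hτ0.le h.le
      have h2 : p s ≤ q / τ * (s - a) := by
        rw [← mul_div_assoc, div_le_iff₀ h0] at this
        rw [div_mul_eq_mul_div, le_div_iff₀ hτ0]; exact this
      nlinarith
  have ip : IntegrableOn p (Ioo a b) := hIntg.integrableOn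
  have isp : IntegrableOn (fun s => s * p s) (Ioo a b) := by
    have h1 : IntegrableOn p (Icc a b) := hIntg.integrableOn
    have : IntegrableOn (fun s => s * p s) (Icc a b) := 
      h1.continuousOn_mul continuousOn_id isCompact_Icc
    exact this.mono_set Ioo_subset_Icc_self
  have i1 : IntegrableOn (fun s => (a + τ) * p s) (Ioo a b) := ip.const_mul _
  have i2 : IntegrableOn (fun s => q / τ * ((a + τ - s) * (s - a))) (Ioo a b) :=
    ((show Continuous fun s => q / τ * ((a + τ - s) * (s - a)) by fun_prop).continuousOn.integrableOn_compact isCompact_Icc).mono_set Ioo_subset_Icc_self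
  have i3 : IntegrableOn (fun s => (a + τ - s) * p s) (Ioo a b) := by
    have : (fun s => (a + τ - s) * p s) = fun s => (a + τ) * p s - s * p s := by ext s; ring
    rw [this]; exact i1.sub isp
  have key := setIntegral_mono_on i2 i3 measurableSet_Ioo (fun s hs => pt s (Ioo_subset_Icc_self hs) hs)
  have e0 : ∫ s in Ioo a b, q / τ * ((a + τ - s) * (s - a)) = 0 := by
    rw [← integral_Ioc_eq_integral_Ioo, ← intervalIntegral.integral_of_le hab.le,
      intervalIntegral.integral_const_mul]
    have : ∀ s, HasDerivAt (fun s => τ * (s - a) ^ 2 / 2 - (s - a) ^ 3 / 3) ((a + τ - s) * (s - a)) s := by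
      intro s
      have h1 : HasDerivAt (fun s : ℝ => s - a) 1 s := (hasDerivAt_id s).sub_const a
      refine ((((h1.pow 2).const_mul τ).div_const 2).sub ((h1.pow 3).div_const 3)).congr_deriv ?_
      simp; ring
    rw [intervalIntegral.integral_eq_sub_of_hasDerivAt (fun s _ => this s) (Continuous.intervalIntegrable (by fun_prop) _ _)]
    rw [← hL, hτ]; simp; ring_nf; simp
  rw [e0] at key
  have e1 : ∫ s in Ioo a b, (a + τ - s) * p s = (a + τ) * (∫ s in Ioo a b, p s) - ∫ s in Ioo a b, s * p s := by
    have : (fun s => (a + τ - s) * p s) = fun s => (a + τ) * p s - s * p s := by ext s; ring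
    rw [this, integral_sub i1 isp, integral_const_mul]
  linarith

lemma centroid_ball {Ω : Set E2} (ho : IsOpen Ω) (hb : Bornology.IsBounded Ω) (hc : Convex ℝ Ω)
    (hn : Ω.Nonempty) {w : ℝ} 
    (hw : ∀ n : E2, ‖n‖ = 1 → ∀ α β, (∀ x ∈ Ω, ⟪x, n⟫ ∈ Icc α β) → w ≤ β - α) :
    ∃ c, Metric.ball c (w / 3) ⊆ Ω := by
  have hA := vol_pos ho hb hn
  have iid : IntegrableOn (fun x : E2 => x) Ω :=
    (continuous_id.continuousOn.integrableOn_compact hb.isCompact_closure).mono_set subset_closure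
  set A := (volume Ω).toReal with hAd
  refine ⟨A⁻¹ • ∫ x in Ω, x, ?_⟩
  set c := A⁻¹ • ∫ x in Ω, x with hcd
  intro y hy
  by_contra hyn
  obtain ⟨n, hn1, hsep⟩ := exists_unit_sep ho hc hn hyn
  have hB := body_fr c hn1 ho hb hc hn
  set K := fr c n ⁻¹' Ω with hK
  have hmom : ∫ z in K, z.1 = 0 := by
    have h1 := setIntegral_fr c hn1 Ω (fun x => ⟪x - c, n⟫)
    simp only [inner_fr c hn1] at h1
    rw [h1]
    have : (fun x : E2 => ⟪x - c, n⟫) = fun x => ⟪n, x⟫ - ⟪n, c⟫ := by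
      ext x; rw [← inner_sub_right, real_inner_comm]
    rw [this, integral_sub (integrableOn_cont hb (by fun_prop)) (integrableOn_cont hb (by fun_prop)),
      integral_inner iid, setIntegral_const, hcd, real_inner_smul_right, Measure.real, smul_eq_mul, ← hAd]
    field_simp; ring
  have h1 := conc_moment (proj_eq hB).1 (secLen_concave hB) (secLen_nonneg K) (integrable_secLen hB)
  rw [← int_sec1_Ioo hB (φ := fun s => s) (integrableOn_fst hB continuous_id), hmom, ← vol_sec hB,
    volume_fr c hn1] at h1
  have h2 : 0 ≤ pL K + 2 * (pR K - pL K) / 3 := by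
    by_contra h; push Not at h
    nlinarith
  have hwK : w ≤ pR K - pL K := by
    have := hw n hn1 (pL K + ⟪c, n⟫) (pR K + ⟪c, n⟫) (by
      intro x hx
      have hx' : (⟪x - c, n⟫, ⟪x - c, perp n⟫) ∈ K := by rw [hK, mem_preimage, fr_inner c hn1]; exact hx
      have : ⟪x - c, n⟫ ∈ Ioo (pL K) (pR K) := by rw [← (proj_eq hB).2]; exact ⟨_, hx', rfl⟩
      rw [inner_sub_left] at this
      exact ⟨by linarith [this.1], by linarith [this.2]⟩)
    linarith
  have h3 : pR K ≤ ⟪y - c, n⟫ := by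
    apply csSup_le (hB.ne.image _)
    rintro _ ⟨z, hz, rfl⟩
    have := hsep _ hz
    have h4 := inner_fr c hn1 z
    rw [inner_sub_left] at h4 ⊢
    linarith
  have h5 : ⟪y - c, n⟫ ≤ ‖y - c‖ * ‖n‖ := real_inner_le_norm _ _
  rw [hn1, mul_one] at h5
  rw [mem_ball_iff_norm] at hy
  linarith

lemma strip_bound {Ω : Set E2} (ho : IsOpen Ω) (hb : Bornology.IsBounded Ω) (hc : Convex ℝ Ω)
    (hne : Ω.Nonempty) {n : E2} (hn : ‖n‖ = 1) {α β : ℝ} (hw : ∀ x ∈ Ω, ⟪x, n⟫ ∈ Icc α β) :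
    (volume Ω).toReal ^ 2 * nEig1 Ω ≤ π ^ 2 * (β - α) ^ 2 := by
  have hA := vol_pos ho hb hne
  have hf : volume Ω ≠ ⊤ := hb.measure_lt_top.ne
  set A := (volume Ω).toReal with hAd
  set e : E2 := -perp n with he
  have he1 : ‖e‖ = 1 := by rw [he, norm_neg, norm_perp, hn]
  have hpe : perp e = n := by
    apply E2_ext <;> simp [he, perp]
  have hB := body_fr 0 he1 ho hb hc hne
  set K := fr 0 e ⁻¹' Ω with hK
  set H := β - α with hH
  have hH0 : 0 ≤ H := by
    obtain ⟨x, hx⟩ := hne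
    have := hw x hx
    linarith [this.1, this.2]
  have hpH : ∀ s, secLen K s ≤ H := by
    intro s
    have hsub : Prod.mk s ⁻¹' K ⊆ Icc α β := by
      intro t ht
      have := hw _ ht
      have h2 := inner_fr' 0 he1 (s, t)
      rw [hpe, sub_zero] at h2
      rwa [h2] at this
    unfold secLen
    apply ENNReal.toReal_le_of_le_ofReal hH0
    calc _ ≤ volume (Icc α β) := measure_mono hsub
      _ = _ := by rw [Real.volume_Icc]
  set p := secLen K with hp
  set a := pL K with ha
  set b := pR K with hbd
  have hab : a < b := (proj_eq hB).1
  have hIntg : Integrable p := integrable_secLen hB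
  have hcont : ContinuousOn p (Ioo a b) := (secLen_concave hB).continuousOn isOpen_Ioo
  have hvol : A = ∫ s in a..b, p s := by
    rw [intervalIntegral.integral_of_le hab.le, integral_Ioc_eq_integral_Ioo, ← vol_sec hB, volume_fr 0 he1]
  set θ : ℝ → ℝ := fun s => π / A * ∫ t in a..s, p t with hθ
  have hθa : θ a = 0 := by simp [hθ]
  have hθb : θ b = π := by simp only [hθ]; rw [← hvol]; field_simp
  have hp0 : ∀ s, 0 ≤ p s := secLen_nonneg K
  have hθlip : LipschitzWith (Real.toNNReal (π / A * H)) θ := by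
    apply LipschitzWith.of_dist_le_mul
    intro x y
    rw [Real.coe_toNNReal _ (by positivity), Real.dist_eq, hθ]
    simp only
    rw [← mul_sub, intervalIntegral.integral_interval_sub_left hIntg.intervalIntegrable hIntg.intervalIntegrable,
      abs_mul, abs_of_pos (by positivity), mul_assoc]
    gcongr
    have := intervalIntegral.norm_integral_le_of_norm_le_const (a := y) (b := x) (f := p) (C := H)
      (fun s _ => by rw [Real.norm_eq_abs, abs_of_nonneg (hp0 s)]; exact hpH s)
    rwa [Real.norm_eq_abs, ← Real.dist_eq] at this
  have hθd : ∀ s ∈ Ioo a b, HasDerivAt θ (π / A * p s) s := by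
    intro s hs
    have h1 : ContinuousAt p s := hcont.continuousAt (isOpen_Ioo.mem_nhds hs)
    have := intervalIntegral.integral_hasDerivAt_right (a := a) (b := s) hIntg.intervalIntegrable
      (hcont.stronglyMeasurableAtFilter isOpen_Ioo s hs) h1
    exact this.const_mul _
  have hθc : Continuous θ := hθlip.continuous
  -- integrals of trig functions
  have trig : ∀ m : ℝ, m ≠ 0 → sin (m * π) = 0 → ∫ s in Ioo a b, cos (m * θ s) * p s = 0 := by
    intro m hm hs
    rw [← integral_Ioc_eq_integral_Ioo, ← intervalIntegral.integral_of_le hab.le]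
    have hd : ∀ s ∈ Ioo a b, HasDerivAt (fun s => A / (m * π) * sin (m * θ s)) (cos (m * θ s) * p s) s := by
      intro s hs
      refine ((((hθd s hs).const_mul m).sin).const_mul (A / (m * π))).congr_deriv ?_
      field_simp
    rw [intervalIntegral.integral_eq_sub_of_hasDerivAt_of_le hab.le (by fun_prop) hd]
    · rw [hθa, hθb, hs]; simp
    · have : IntegrableOn p (Icc a b) := hIntg.integrableOn
      have h2 : IntegrableOn (fun s => cos (m * θ s) * p s) (Icc a b) :=
        this.continuousOn_mul (by fun_prop) isCompact_Icc
      exact (h2.mono_set (by rw [uIcc_of_le hab.le])).intervalIntegrable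
  set u : E2 → ℝ := fun x => cos (θ ⟪x, e⟫) with hu
  have hred : ∀ φ : ℝ → ℝ, Continuous φ → ∫ x in Ω, φ (⟪x, e⟫) = ∫ s in Ioo a b, φ s * p s := by
    intro φ hφ
    rw [← int_sec1_Ioo hB (integrableOn_fst hB hφ)]
    have h1 := setIntegral_fr 0 he1 Ω (fun x => φ (⟪x - 0, e⟫))
    simp only [inner_fr 0 he1] at h1
    simp only [sub_zero] at h1
    exact h1.symm
  have hu0 : ∫ x in Ω, u x = 0 := by
    have := hred (fun s => cos (θ s)) (by fun_prop)
    rw [hu]; simp only; rw [this]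
    have := trig 1 one_ne_zero (by simp)
    simpa using this
  have hulip : LipschitzWith (1 * Real.toNNReal (π / A * H) * 1) u := by
    have h1 : LipschitzWith 1 Real.cos := by
      apply LipschitzWith.of_dist_le_mul
      intro x y
      rw [Real.dist_eq, Real.dist_eq]
      simpa using Real.abs_cos_sub_cos_le x y
    have h2 : LipschitzWith 1 (fun x : E2 => ⟪x, e⟫) := by
      apply LipschitzWith.of_dist_le_mul
      intro x y
      rw [Real.dist_eq, ← inner_sub_left, dist_eq_norm]
      have := abs_real_inner_le_norm (x - y) e
      rw [he1] at this
      simpa using this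
    exact (h1.comp hθlip).comp h2
  have key := nEig1_lip ho hb hne hulip hu0
  have hfd : ∀ x ∈ Ω, ‖fderiv ℝ u x‖ ^ 2 ≤ (π / A * H) ^ 2 * sin (θ ⟪x, e⟫) ^ 2 := by
    intro x hx
    have hs : ⟪x, e⟫ ∈ Ioo a b := by
      rw [← (proj_eq hB).2]
      refine ⟨(⟪x - 0, e⟫, ⟪x - 0, perp e⟫), ?_, by simp⟩
      rw [hK, mem_preimage, fr_inner 0 he1]; exact hx
    have h1 : HasFDerivAt (fun x : E2 => ⟪x, e⟫) (innerSL ℝ e) x := by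
      have := (innerSL ℝ e).hasFDerivAt (x := x)
      refine this.congr_of_eventuallyEq (Eventually.of_forall fun y => ?_)
      simp [real_inner_comm]
    have h2 := ((hθd _ hs).cos).comp_hasFDerivAt x h1
    have h3 : fderiv ℝ u x = (-sin (θ ⟪x, e⟫) * (π / A * p ⟪x, e⟫)) • innerSL ℝ e := h2.fderiv
    rw [h3, norm_smul, innerSL_apply_norm, he1, mul_one, Real.norm_eq_abs, sq_abs, mul_pow, mul_comm, neg_sq]
    gcongr
    · exact mul_nonneg (by positivity) (hp0 _)
    · exact hpH _
  have i1 : IntegrableOn (fun x : E2 => sin (θ ⟪x, e⟫) ^ 2) Ω := integrableOn_cont hb (by fun_prop)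
  have i2 : IntegrableOn (fun x : E2 => cos (θ ⟪x, e⟫) ^ 2) Ω := integrableOn_cont hb (by fun_prop)
  have i3 : IntegrableOn (fun x => ‖fderiv ℝ u x‖ ^ 2) Ω := by
    refine IntegrableOn.of_bound (lt_top_iff_ne_top.2 hf) ((measurable_fderiv ℝ u).norm.pow_const 2).aestronglyMeasurable
      (((1 * Real.toNNReal (π / A * H) * 1 : NNReal) : ℝ) ^ 2) (Eventually.of_forall fun x => ?_)
    rw [norm_pow, norm_norm]
    gcongr
    exact norm_fderiv_le_of_lipschitz ℝ hulip
  have k2 : ∫ x in Ω, ‖fderiv ℝ u x‖ ^ 2 ≤ (π / A * H) ^ 2 * ∫ x in Ω, sin (θ ⟪x, e⟫) ^ 2 := by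
    rw [← integral_const_mul]
    exact setIntegral_mono_on i3 (i1.const_mul _) ho.measurableSet hfd
  have s1 : (∫ x in Ω, cos (θ ⟪x, e⟫) ^ 2) + ∫ x in Ω, sin (θ ⟪x, e⟫) ^ 2 = A := by
    rw [← integral_add i2 i1]
    simp [Measure.real, hAd]
  have s2 : (∫ x in Ω, cos (θ ⟪x, e⟫) ^ 2) - ∫ x in Ω, sin (θ ⟪x, e⟫) ^ 2 = 0 := by
    rw [← integral_sub i2 i1]
    have h1 := hred (fun s => cos (2 * θ s)) (by fun_prop)
    rw [trig 2 two_ne_zero (by simp)] at h1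
    rw [← h1]
    congr 1; ext x
    rw [Real.cos_two_mul']
  have k3 : ∫ x in Ω, u x ^ 2 = A / 2 := by
    show ∫ x in Ω, cos (θ ⟪x, e⟫) ^ 2 = A / 2
    linarith
  have k4 : ∫ x in Ω, sin (θ ⟪x, e⟫) ^ 2 = A / 2 := by linarith
  rw [k3] at key
  rw [k4] at k2
  have k5 : nEig1 Ω * (A / 2) ≤ (π / A * H) ^ 2 * (A / 2) := key.trans k2
  have k6 : nEig1 Ω ≤ (π / A * H) ^ 2 := le_of_mul_le_mul_right k5 (by positivity)
  calc A ^ 2 * nEig1 Ω ≤ A ^ 2 * (π / A * H) ^ 2 := by gcongr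
    _ = _ := by field_simp

/-- The upper hyperbola. -/
lemma upper_hyp {Ω : Set E2} (ho : IsOpen Ω) (hb : Bornology.IsBounded Ω) (hc : Convex ℝ Ω)
    (hne : Ω.Nonempty) :
    (volume Ω).toReal ^ 2 * nEig1 Ω * dEig1 Ω ≤ 9 * π ^ 2 * dEig1 unitDisc := by
  set S : Set ℝ := {H | ∃ n : E2, ‖n‖ = 1 ∧ ∃ α β, (∀ x ∈ Ω, ⟪x, n⟫ ∈ Icc α β) ∧ H = β - α} with hS
  have hS0 : ∀ H ∈ S, 0 ≤ H := by
    rintro _ ⟨n, hn, α, β, h, rfl⟩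
    obtain ⟨x, hx⟩ := hne
    have := h x hx
    linarith [this.1, this.2]
  have hSb : BddBelow S := ⟨0, hS0⟩
  have hSne : S.Nonempty := by
    obtain ⟨R, hR⟩ := hb.subset_closedBall 0
    refine ⟨R - (-R), dirv 0, norm_dirv 0, -R, R, ?_, rfl⟩
    intro x hx
    have h1 := abs_real_inner_le_norm x (dirv 0)
    rw [norm_dirv, mul_one] at h1
    have h2 := mem_closedBall_zero_iff.1 (hR hx)
    exact ⟨by linarith [neg_abs_le ⟪x, dirv 0⟫], by linarith [le_abs_self ⟪x, dirv 0⟫]⟩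
  set w := sInf S with hw
  have hw0 : 0 ≤ w := le_csInf hSne hS0
  have h1 : (volume Ω).toReal ^ 2 * nEig1 Ω ≤ π ^ 2 * w ^ 2 := by
    have hq : √((volume Ω).toReal ^ 2 * nEig1 Ω) / π ≤ w := by
      apply le_csInf hSne
      rintro H hH
      have hH0 := hS0 H hH
      obtain ⟨n, hn, α, β, h, rfl⟩ := hH
      rw [div_le_iff₀ pi_pos]
      apply Real.sqrt_le_iff.2 ⟨by positivity, ?_⟩
      have := strip_bound ho hb hc hne hn h
      linarith
    rw [div_le_iff₀ pi_pos, Real.sqrt_le_iff] at hq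
    linarith [hq.2]
  have hd := dEig1_nonneg Ω
  have hd' := dEig1_nonneg unitDisc
  rcases hw0.eq_or_lt with h0 | h0
  · rw [← h0] at h1
    have : (volume Ω).toReal ^ 2 * nEig1 Ω * dEig1 Ω ≤ 0 := mul_nonpos_of_nonpos_of_nonneg (by linarith) hd
    have : 0 ≤ 9 * π ^ 2 * dEig1 unitDisc := by positivity
    linarith
  · obtain ⟨c, hball⟩ := centroid_ball ho hb hc hne (w := w) (fun n hn α β h => csInf_le hSb ⟨n, hn, α, β, h, rfl⟩)
    have h2 := dEig1_ball_le (by positivity) hball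
    calc _ ≤ π ^ 2 * w ^ 2 * dEig1 Ω := by gcongr
      _ = 9 * π ^ 2 * ((w / 3) ^ 2 * dEig1 Ω) := by ring
      _ ≤ _ := by gcongr

lemma lower_hyp {Ω : Set E2} (ho : IsOpen Ω) (hb : Bornology.IsBounded Ω) (hc : Convex ℝ Ω)
    (hne : Ω.Nonempty) : 0 < dEig1 Ω ∧
    π ^ 4 / 4 < (volume Ω).toReal ^ 2 * nEig1 Ω * dEig1 Ω := by
  have hA := vol_pos ho hb hne
  obtain ⟨c, r, hr, hcr, hball, hh⟩ := hersch ho hb hc hne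
  have h1 : (π / (2 * r)) ^ 2 ≤ dEig1 Ω :=
    le_dEig1 ho hne fun u h1 h2 h3 => hh u (h1.of_le (by simp)) h2 h3
  have h2 : (π / Metric.diam Ω) ^ 2 ≤ nEig1 Ω :=
    le_nEig1 ho hb hne fun u h1 h2 => payne_weinberger ho hb hc hne (h1.of_le (by simp)) h2
  have h3 := area_gt ho hb hc hne hr hball
  have hp : 0 < (π / (2 * r)) ^ 2 := by positivity
  have hD : 0 < Metric.diam Ω := by
    obtain ⟨p, hp, q, hq, hpq, hd, -⟩ := exists_diam ho hb hne
    rw [← hd]; exact hpq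
  refine ⟨lt_of_lt_of_le hp h1, ?_⟩
  set D := Metric.diam Ω
  set A := (volume Ω).toReal
  calc π ^ 4 / 4 = (r * D) ^ 2 * (π / D) ^ 2 * (π / (2 * r)) ^ 2 := by field_simp; norm_num
    _ < A ^ 2 * (π / D) ^ 2 * (π / (2 * r)) ^ 2 := by gcongr
    _ ≤ A ^ 2 * nEig1 Ω * dEig1 Ω := by
      have := mul_nonneg (sq_nonneg A) (nEig1_nonneg Ω)
      gcongr

lemma vol_ball_E2 (c : E2) {r : ℝ} (hr : 0 ≤ r) : (volume (Metric.ball c r)).toReal = π * r ^ 2 := by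
  rw [EuclideanSpace.volume_ball_fin_two]
  rw [ENNReal.toReal_mul, ENNReal.toReal_pow, ENNReal.toReal_ofReal hr]
  simp [mul_comm, pi_pos.le]

/-- Brunn–Minkowski for parallel sets. -/
lemma bm_E2 {A C : Set E2} (hA : IsOpen A) (hAb : Bornology.IsBounded A) (hAn : A.Nonempty)
    (hC : MeasurableSet C) (hCb : Bornology.IsBounded C) {ε : ℝ} (hε : 0 < ε)
    (h : ∀ a ∈ A, ∀ x, dist x a < ε → x ∈ C) :
    (√(volume A).toReal + √π * ε) ^ 2 ≤ (volume C).toReal := by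
  have he : ‖dirv 0‖ = 1 := norm_dirv 0
  set e := dirv 0
  have hlin : ∀ z w : ℝ × ℝ, fr 0 e (z + w) = fr 0 e z + fr 0 e w := by
    intro z w; simp only [fr, Prod.fst_add, Prod.snd_add, add_smul, zero_add]; abel
  have hne : ∀ K : Set E2, K.Nonempty → (fr 0 e ⁻¹' K).Nonempty := by
    rintro K ⟨x, hx⟩
    exact ⟨(⟪x - 0, e⟫, ⟪x - 0, perp e⟫), by rw [mem_preimage, fr_inner 0 he]; exact hx⟩
  have := bm2 (A := fr 0 e ⁻¹' A) (B := fr 0 e ⁻¹' (Metric.ball 0 ε)) (C := fr 0 e ⁻¹' C)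
    (isOpen_fr 0 e hA) (isOpen_fr 0 e Metric.isOpen_ball) (hne _ hAn) (hne _ ⟨0, by simpa using hε⟩)
    (bdd_fr 0 he hAb) (bdd_fr 0 he Metric.isBounded_ball) (bdd_fr 0 he hCb)
    ((continuous_fr 0 e).measurable hC) (by
      intro z hz w hw
      rw [mem_preimage, hlin]
      apply h _ hz
      rw [dist_eq_norm]
      simpa using hw)
  rw [volume_fr 0 he, volume_fr 0 he, volume_fr 0 he, vol_ball_E2 0 hε.le, Real.sqrt_mul pi_pos.le,
    Real.sqrt_sq hε.le] at this
  exact this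

/-- Distribution function. -/
def dist_fn (v : E2 → ℝ) (t : ℝ) : ℝ := (volume {x | t < v x}).toReal

/-- Decreasing rearrangement (radial profile). -/
def rearr (v : E2 → ℝ) (r : ℝ) : ℝ := sInf {t | 0 ≤ t ∧ dist_fn v t ≤ π * r ^ 2}

structure Tst (v : E2 → ℝ) : Prop where
  cont : Continuous v
  cpt : HasCompactSupport v
  nonneg : ∀ x, 0 ≤ v x

lemma Tst.open_set {v : E2 → ℝ} (h : Tst v) (t : ℝ) : IsOpen {x | t < v x} :=
  isOpen_lt continuous_const h.cont

lemma Tst.bdd {v : E2 → ℝ} (h : Tst v) {t : ℝ} (ht : 0 ≤ t) : Bornology.IsBounded {x | t < v x} := by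
  apply h.cpt.isCompact.isBounded.subset
  intro x hx
  apply subset_tsupport
  rw [Function.mem_support]
  have : t < v x := hx
  linarith

lemma Tst.finite {v : E2 → ℝ} (h : Tst v) {t : ℝ} (ht : 0 ≤ t) : volume {x | t < v x} ≠ ⊤ :=
  (h.bdd ht).measure_lt_top.ne

lemma Tst.anti {v : E2 → ℝ} (h : Tst v) {s t : ℝ} (hs : 0 ≤ s) (hst : s ≤ t) :
    dist_fn v t ≤ dist_fn v s :=
  ENNReal.toReal_mono (h.finite hs) (measure_mono fun x hx => lt_of_le_of_lt hst hx)

lemma Tst.right {v : E2 → ℝ} (h : Tst v) {t c : ℝ} (ht : 0 ≤ t) (hc : c < dist_fn v t) :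
    ∃ s, t < s ∧ c < dist_fn v s := by
  have hU : {x | t < v x} = ⋃ n : ℕ, {x | t + 1 / ((n : ℝ) + 1) < v x} := by
    ext x
    simp only [mem_setOf_eq, mem_iUnion]
    constructor
    · intro hx
      obtain ⟨n, hn⟩ := exists_nat_one_div_lt (sub_pos.2 hx)
      exact ⟨n, by linarith⟩
    · rintro ⟨n, hn⟩
      have : 0 < 1 / ((n : ℝ) + 1) := by positivity
      linarith
  have hmono : Monotone fun n : ℕ => {x | t + 1 / ((n : ℝ) + 1) < v x} := by
    intro a b hab x hx
    have : 1 / ((b : ℝ) + 1) ≤ 1 / ((a : ℝ) + 1) := Nat.one_div_le_one_div hab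
    have hx : t + 1 / ((a : ℝ) + 1) < v x := hx
    show t + 1 / ((b : ℝ) + 1) < v x
    linarith
  have ht1 := tendsto_measure_iUnion_atTop (μ := (volume : Measure E2)) hmono
  rw [← hU] at ht1
  have ht2 := (ENNReal.tendsto_toReal (h.finite ht)).comp ht1
  have := (ht2.eventually (lt_mem_nhds hc)).exists
  obtain ⟨n, hn⟩ := this
  exact ⟨t + 1 / ((n : ℝ) + 1), by have : 0 < 1 / ((n : ℝ) + 1) := by positivity
                                   linarith, hn⟩

lemma Tst.top {v : E2 → ℝ} (h : Tst v) : ∃ T, 0 ≤ T ∧ dist_fn v T = 0 := by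
  obtain ⟨B, hB⟩ := h.cpt.exists_bound_of_continuous h.cont
  refine ⟨max B 0, le_max_right _ _, ?_⟩
  have : {x | max B 0 < v x} = ∅ := by
    ext x
    simp only [mem_setOf_eq, mem_empty_iff_false, iff_false, not_lt]
    exact ((le_abs_self _).trans (hB x)).trans (le_max_left _ _)
  rw [dist_fn, this]; simp

lemma rearr_nonneg (v : E2 → ℝ) (r : ℝ) : 0 ≤ rearr v r := Real.sInf_nonneg fun _ h => h.1

lemma Tst.lt_rearr {v : E2 → ℝ} (h : Tst v) {t r : ℝ} (ht : 0 ≤ t) :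
    t < rearr v r ↔ π * r ^ 2 < dist_fn v t := by
  have hbdd : BddBelow {t | 0 ≤ t ∧ dist_fn v t ≤ π * r ^ 2} := ⟨0, fun _ h => h.1⟩
  constructor
  · intro hlt
    by_contra hle
    push Not at hle
    exact absurd (csInf_le hbdd ⟨ht, hle⟩) (not_le.2 hlt)
  · intro hlt
    obtain ⟨s, hs, hcs⟩ := h.right ht hlt
    refine lt_of_lt_of_le hs (le_csInf ?_ ?_)
    · obtain ⟨T, hT, h0⟩ := h.top
      exact ⟨T, hT, by rw [h0]; positivity⟩
    · rintro t' ⟨h1, h2⟩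
      by_contra h3
      push Not at h3
      have := h.anti h1 h3.le
      linarith

lemma Tst.rearr_le {v : E2 → ℝ} (h : Tst v) {t r : ℝ} (ht : 0 ≤ t) :
    rearr v r ≤ t ↔ dist_fn v t ≤ π * r ^ 2 := by
  rw [← not_lt, h.lt_rearr ht, not_lt]

lemma Tst.rearr_anti {v : E2 → ℝ} (h : Tst v) {r s : ℝ} (hr : 0 ≤ r) (hrs : r ≤ s) :
    rearr v s ≤ rearr v r := by
  rw [h.rearr_le (rearr_nonneg _ _)]
  have := (h.rearr_le (rearr_nonneg v r)).1 le_rfl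
  refine this.trans ?_
  gcongr

lemma Tst.rearr_step {v : E2 → ℝ} (h : Tst v) {C : NNReal} (hC : LipschitzWith C v) {r ε : ℝ} (hr : 0 ≤ r)
    (hε : 0 < ε) : rearr v r ≤ rearr v (r + ε) + C * ε := by
  set t := rearr v (r + ε) with ht
  have ht0 : 0 ≤ t := rearr_nonneg _ _
  have ht1 : 0 ≤ t + C * ε := by positivity
  have hm := (h.rearr_le (r := r + ε) ht0).1 le_rfl
  rw [h.rearr_le ht1]
  rcases eq_empty_or_nonempty {x | t + C * ε < v x} with he | hne
  · rw [dist_fn, he]; simp; positivity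
  · have := bm_E2 (h.open_set (t + C * ε)) (h.bdd ht1) hne (h.open_set t).measurableSet (h.bdd ht0) hε (by
      intro a ha x hx
      have h1 := hC.dist_le_mul x a
      have h2 : (C : ℝ) * dist x a ≤ C * ε := by gcongr
      rw [Real.dist_eq] at h1
      have ha : t + C * ε < v a := ha
      show t < v x
      linarith [neg_abs_le (v x - v a)])
    have h2 : (√(dist_fn v (t + C * ε)) + √π * ε) ^ 2 ≤ (√π * (r + ε)) ^ 2 := by
      rw [mul_pow, Real.sq_sqrt pi_pos.le]; exact this.trans hm
    have h3 := abs_le_of_sq_le_sq h2 (by positivity)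
    have h4 : √(dist_fn v (t + C * ε)) ≤ √π * r := by linarith [le_abs_self (√(dist_fn v (t + C * ε)) + √π * ε), h3]
    have h5 := (Real.sqrt_le_left (by positivity)).1 h4
    rwa [mul_pow, Real.sq_sqrt pi_pos.le] at h5

lemma Tst.rearr_lip {v : E2 → ℝ} (h : Tst v) {C : NNReal} (hC : LipschitzWith C v) {r s : ℝ} (hr : 0 ≤ r)
    (hs : 0 ≤ s) : |rearr v r - rearr v s| ≤ C * |r - s| := by
  wlog hrs : r ≤ s generalizing r s
  · rw [abs_sub_comm, abs_sub_comm r s]; exact this hs hr (le_of_not_ge hrs)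
  rcases hrs.eq_or_lt with rfl | hlt
  · simp
  have h1 := h.rearr_step hC hr (sub_pos.2 hlt)
  have h2 := h.rearr_anti hr hrs
  rw [add_sub_cancel] at h1
  rw [abs_of_nonneg (by linarith), abs_sub_comm, abs_of_pos (by linarith)]
  linarith

/-- The contraction principle. -/
lemma tri_area {g f : ℝ} (h : g ≤ f) :
    volume {q : ℝ × ℝ | g ≤ q.1 ∧ q.1 < q.2 ∧ q.2 < f} = ENNReal.ofReal ((f - g) ^ 2 / 2) := by
  have hm : MeasurableSet {q : ℝ × ℝ | g ≤ q.1 ∧ q.1 < q.2 ∧ q.2 < f} :=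
    (measurableSet_le measurable_const measurable_fst).inter
      ((measurableSet_lt measurable_fst measurable_snd).inter (measurableSet_lt measurable_snd measurable_const))
  rw [Measure.volume_eq_prod, Measure.prod_apply hm]
  have : ∀ s, volume (Prod.mk s ⁻¹' {q : ℝ × ℝ | g ≤ q.1 ∧ q.1 < q.2 ∧ q.2 < f}) =
      (Icc g f).indicator (fun s => ENNReal.ofReal (f - s)) s := by
    intro s
    by_cases hs : s ∈ Icc g f
    · rw [indicator_of_mem hs, ← Real.volume_Ioo]
      congr 1; ext t; simp [hs.1]
    · rw [indicator_of_notMem hs]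
      convert measure_empty (μ := (volume : Measure ℝ))
      ext t
      simp only [mem_preimage, mem_setOf_eq, mem_empty_iff_false, iff_false]
      rintro ⟨h1, h2, h3⟩
      exact hs ⟨h1, by linarith⟩
  simp_rw [this]
  rw [lintegral_indicator measurableSet_Icc, ← ofReal_integral_eq_lintegral_ofReal]
  · congr 1
    rw [integral_Icc_eq_integral_Ioc, ← intervalIntegral.integral_of_le h,
      intervalIntegral.integral_comp_sub_left (fun x => x), integral_id]
    ring
  · exact (show Continuous fun s => f - s by fun_prop).continuousOn.integrableOn_compact isCompact_Icc
  · filter_upwards [ae_restrict_mem measurableSet_Icc] with s hs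
    simpa using hs.2

lemma tonelli_tri {f g : E2 → ℝ} (hf : Measurable f) (hg : Measurable g) (h0 : ∀ x, 0 ≤ g x) (h : ∀ x, g x ≤ f x) :
    ∫⁻ x, ENNReal.ofReal ((f x - g x) ^ 2 / 2) =
      ∫⁻ q : ℝ × ℝ, volume {x | 0 ≤ q.1 ∧ q.1 < q.2 ∧ q.2 < f x ∧ g x ≤ q.1} := by
  set S : Set (E2 × (ℝ × ℝ)) := {z | 0 ≤ z.2.1 ∧ z.2.1 < z.2.2 ∧ z.2.2 < f z.1 ∧ g z.1 ≤ z.2.1} with hS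
  have m1 : Measurable fun z : E2 × (ℝ × ℝ) => z.2.1 := measurable_fst.comp measurable_snd
  have m2 : Measurable fun z : E2 × (ℝ × ℝ) => z.2.2 := measurable_snd.comp measurable_snd
  have hm : MeasurableSet S :=
    (measurableSet_le measurable_const m1).inter ((measurableSet_lt m1 m2).inter
      ((measurableSet_lt m2 (hf.comp measurable_fst)).inter (measurableSet_le (hg.comp measurable_fst) m1)))
  have e1 := Measure.prod_apply (μ := (volume : Measure E2)) (ν := (volume : Measure (ℝ × ℝ))) hm
  have e2 := Measure.prod_apply_symm (μ := (volume : Measure E2)) (ν := (volume : Measure (ℝ × ℝ))) hm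
  rw [e1] at e2
  have e3 : ∀ x, volume (Prod.mk x ⁻¹' S) = ENNReal.ofReal ((f x - g x) ^ 2 / 2) := by
    intro x
    rw [← tri_area (h x)]
    congr 1
    ext q
    simp only [hS, mem_preimage, mem_setOf_eq]
    constructor
    · rintro ⟨a, b, c, d⟩; exact ⟨d, b, c⟩
    · rintro ⟨d, b, c⟩; exact ⟨(h0 x).trans d, b, c, d⟩
  simp_rw [e3] at e2
  exact e2

lemma contraction {f g F G : E2 → ℝ} (hf : Measurable f) (hg : Measurable g) (hF : Measurable F)
    (hG : Measurable G) (h0 : ∀ x, 0 ≤ g x) (h : ∀ x, g x ≤ f x) (H0 : ∀ x, 0 ≤ G x) (H : ∀ x, G x ≤ F x)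
    (hle : ∀ s t, 0 ≤ s → s < t → volume {x | t < F x ∧ G x ≤ s} ≤ volume {x | t < f x ∧ g x ≤ s}) :
    ∫⁻ x, ENNReal.ofReal ((F x - G x) ^ 2) ≤ ∫⁻ x, ENNReal.ofReal ((f x - g x) ^ 2) := by
  have key : ∫⁻ x, ENNReal.ofReal ((F x - G x) ^ 2 / 2) ≤ ∫⁻ x, ENNReal.ofReal ((f x - g x) ^ 2 / 2) := by
    rw [tonelli_tri hf hg h0 h, tonelli_tri hF hG H0 H]
    apply lintegral_mono
    intro q
    simp only
    by_cases hq : 0 ≤ q.1 ∧ q.1 < q.2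
    · simpa [hq.1, hq.2] using hle q.1 q.2 hq.1 hq.2
    · have : {x | 0 ≤ q.1 ∧ q.1 < q.2 ∧ q.2 < F x ∧ G x ≤ q.1} = ∅ := by
        ext x; simp only [mem_setOf_eq, mem_empty_iff_false, iff_false]
        rintro ⟨a, b, -⟩; exact hq ⟨a, b⟩
      rw [this]; simp
  have e : ∀ φ : E2 → ℝ, ∫⁻ x, ENNReal.ofReal ((φ x) ^ 2) = 2 * ∫⁻ x, ENNReal.ofReal ((φ x) ^ 2 / 2) := by
    intro φ
    rw [← lintegral_const_mul' _ _ (by simp)]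
    congr 1; ext x
    have : (2 : ENNReal) = ENNReal.ofReal 2 := by simp
    rw [this, ← ENNReal.ofReal_mul (by norm_num)]
    congr 1; ring
  rw [e, e (fun x => f x - g x)]
  gcongr

lemma dist_fn_nonneg (v : E2 → ℝ) (t : ℝ) : 0 ≤ dist_fn v t := ENNReal.toReal_nonneg

lemma lt_rad {m r : ℝ} (hm : 0 ≤ m) (hr : 0 ≤ r) : π * r ^ 2 < m ↔ r < √(m / π) := by
  rw [Real.lt_sqrt hr, lt_div_iff₀ pi_pos, mul_comm]

lemma Tst.W_lip {v : E2 → ℝ} (h : Tst v) {C : NNReal} (hC : LipschitzWith C v) :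
    LipschitzWith C (fun x : E2 => rearr v ‖x‖) := by
  apply LipschitzWith.of_dist_le_mul
  intro x y
  rw [Real.dist_eq, dist_eq_norm]
  refine (h.rearr_lip hC (norm_nonneg _) (norm_nonneg _)).trans ?_
  gcongr
  exact abs_norm_sub_norm_le x y

lemma Tst.Weps_cont {v : E2 → ℝ} (h : Tst v) {C : NNReal} (hC : LipschitzWith C v) (ε : ℝ) :
    Continuous (fun x : E2 => rearr v (max (‖x‖ - ε) 0)) := by
  have : LipschitzWith C (fun x : E2 => rearr v (max (‖x‖ - ε) 0)) := by
    apply LipschitzWith.of_dist_le_mul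
    intro x y
    rw [Real.dist_eq, dist_eq_norm]
    refine (h.rearr_lip hC (le_max_right _ _) (le_max_right _ _)).trans ?_
    gcongr
    refine (abs_max_sub_max_le_abs _ _ _).trans ?_
    rw [sub_sub_sub_cancel_right]
    exact abs_norm_sub_norm_le x y
  exact this.continuous

lemma Tst.level {v : E2 → ℝ} (h : Tst v) {t : ℝ} (ht : 0 ≤ t) :
    {x : E2 | t < rearr v ‖x‖} = Metric.ball 0 √(dist_fn v t / π) := by
  ext x
  rw [mem_setOf_eq, h.lt_rearr ht, lt_rad (dist_fn_nonneg _ _) (norm_nonneg _), mem_ball_zero_iff]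

lemma vol_rad {m : ℝ} (hm : 0 ≤ m) : (volume (Metric.ball (0:E2) √(m / π))).toReal = m := by
  rw [vol_ball_E2 _ (Real.sqrt_nonneg _), Real.sq_sqrt (by positivity)]
  field_simp

lemma Tst.level_vol {v : E2 → ℝ} (h : Tst v) {t : ℝ} (ht : 0 ≤ t) :
    volume {x : E2 | t < rearr v ‖x‖} = volume {x | t < v x} := by
  rw [h.level ht, ← ENNReal.toReal_eq_toReal_iff' Metric.isBounded_ball.measure_lt_top.ne (h.finite ht),
    vol_rad (dist_fn_nonneg _ _)]
  rfl

lemma Tst.level_eps {v f : E2 → ℝ} (h : Tst v) {ε s t : ℝ} (hε : 0 < ε) (hs : 0 ≤ s) (hst : s < t)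
    (hfm : Measurable f) (hfb : Bornology.IsBounded {x | t < f x})
    (hf : ∀ a, t < v a → ∀ x, dist x a < ε → t < f x) :
    volume {x : E2 | t < rearr v (max (‖x‖ - ε) 0) ∧ rearr v ‖x‖ ≤ s} ≤ volume {x | t < f x ∧ v x ≤ s} := by
  have ht : 0 ≤ t := by linarith
  have hm0 := dist_fn_nonneg v t
  rcases eq_empty_or_nonempty {x | t < v x} with he | hne
  · have h0 : dist_fn v t = 0 := by rw [dist_fn, he]; simp
    have : {x : E2 | t < rearr v (max (‖x‖ - ε) 0) ∧ rearr v ‖x‖ ≤ s} = ∅ := by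
      ext x
      simp only [mem_setOf_eq, mem_empty_iff_false, iff_false]
      rintro ⟨h1, -⟩
      rw [h.lt_rearr ht, h0] at h1
      have : 0 ≤ π * max (‖x‖ - ε) 0 ^ 2 := by positivity
      linarith
    rw [this]; simp
  set Rt := √(dist_fn v t / π) with hRt
  set Rs := √(dist_fn v s / π) with hRs
  have hRt0 : 0 ≤ Rt := Real.sqrt_nonneg _
  have hsub : {x : E2 | t < rearr v (max (‖x‖ - ε) 0) ∧ rearr v ‖x‖ ≤ s} ⊆
      Metric.ball 0 (Rt + ε) \ Metric.ball 0 Rs := by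
    rintro x ⟨h1, h2⟩
    refine ⟨?_, ?_⟩
    · rw [h.lt_rearr ht, lt_rad hm0 (le_max_right _ _)] at h1
      rw [mem_ball_zero_iff]
      linarith [le_max_left (‖x‖ - ε) 0]
    · rw [← h.level hs]
      exact not_lt.2 h2
  refine (measure_mono hsub).trans ?_
  rcases le_or_gt (Rt + ε) Rs with hle | hlt
  · rw [diff_eq_empty.2 (Metric.ball_subset_ball hle)]; simp
  rw [measure_diff (Metric.ball_subset_ball hlt.le) measurableSet_ball.nullMeasurableSet Metric.isBounded_ball.measure_lt_top.ne]
  have e1 : volume (Metric.ball (0:E2) Rs) = volume {x | s < v x} := by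
    rw [← h.level hs, h.level_vol hs]
  have e2 : volume (Metric.ball (0:E2) (Rt + ε)) ≤ volume {x | t < f x} := by
    rw [← ENNReal.toReal_le_toReal Metric.isBounded_ball.measure_lt_top.ne hfb.measure_lt_top.ne,
      vol_ball_E2 _ (by positivity)]
    have := bm_E2 (h.open_set t) (h.bdd ht) hne (measurableSet_lt measurable_const hfm) hfb hε
      (fun a ha x hx => hf a ha x hx)
    refine le_trans (le_of_eq ?_) this
    have e3 : √(volume {x | t < v x}).toReal = √π * Rt := by
      rw [hRt, ← Real.sqrt_mul pi_pos.le]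
      congr 1
      rw [dist_fn]; field_simp
    rw [e3, ← mul_add, mul_pow, Real.sq_sqrt pi_pos.le]
  rw [e1]
  calc volume (Metric.ball (0:E2) (Rt + ε)) - volume {x | s < v x}
      ≤ volume {x | t < f x} - volume {x | s < v x} := by gcongr
    _ ≤ volume ({x | t < f x} \ {x | s < v x}) := le_measure_diff
    _ = _ := by
      congr 1; ext x; simp

lemma taylor_bd {u : E2 → ℝ} (hu : Differentiable ℝ u) {C1 : NNReal} (hC : LipschitzWith C1 (fderiv ℝ u))
    {x y : E2} {ε : ℝ} (hxy : dist x y < ε) :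
    |u y| ≤ |u x| + ε * (‖fderiv ℝ u x‖ + C1 * ε) := by
  have hε : 0 ≤ ε := dist_nonneg.trans hxy.le
  have hyx : ‖y - x‖ ≤ ε := by rw [← dist_eq_norm, dist_comm]; exact hxy.le
  have h1 := (convex_closedBall x ε).norm_image_sub_le_of_norm_fderiv_le' (𝕜 := ℝ) (f := u) (C := C1 * ε)
    (φ := fderiv ℝ u x) (x := x) (y := y) (fun z _ => hu z) (by
      intro z hz
      rw [← dist_eq_norm]
      refine (hC.dist_le_mul z x).trans ?_
      gcongr
      exact hz) (Metric.mem_closedBall_self hε) (by rw [Metric.mem_closedBall, dist_comm]; exact hxy.le)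
  have h2 : |fderiv ℝ u x (y - x)| ≤ ‖fderiv ℝ u x‖ * ‖y - x‖ := (fderiv ℝ u x).le_opNorm (y - x)
  have h3 : ‖fderiv ℝ u x‖ * ‖y - x‖ ≤ ‖fderiv ℝ u x‖ * ε := by gcongr
  have h4 : C1 * ε * ‖y - x‖ ≤ C1 * ε * ε := by gcongr
  have h5 : |u y| ≤ |u x| + |fderiv ℝ u x (y - x)| + |u y - u x - fderiv ℝ u x (y - x)| := by
    calc |u y| = |u x + fderiv ℝ u x (y - x) + (u y - u x - fderiv ℝ u x (y - x))| := by congr 1; ring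
      _ ≤ _ := (abs_add_le _ _).trans (by gcongr; exact abs_add_le _ _)
  rw [Real.norm_eq_abs] at h1
  linarith

lemma Tst.fderiv_W {v : E2 → ℝ} (h : Tst v) {x : E2} (hx : x ≠ 0)
    (hd : DifferentiableAt ℝ (fun x : E2 => rearr v ‖x‖) x) :
    ∃ d, ‖fderiv ℝ (fun x : E2 => rearr v ‖x‖) x‖ ≤ d ∧
      Tendsto (fun n : ℕ => ((n : ℝ) + 1) * (rearr v (max (‖x‖ - 1 / ((n:ℝ) + 1)) 0) - rearr v ‖x‖)) atTop (nhds d) := by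
  have hxn : 0 < ‖x‖ := norm_pos_iff.2 hx
  set W := fun x : E2 => rearr v ‖x‖ with hW
  set e : E2 := -(‖x‖⁻¹ • x) with he
  have hc : Tendsto (fun n : ℕ => (n : ℝ) + 1) atTop atTop :=
    tendsto_atTop_add_const_right _ _ tendsto_natCast_atTop_atTop
  have hl : ∀ e : E2, Tendsto (fun n : ℕ => ((n : ℝ) + 1) * (W (x + ((n:ℝ) + 1)⁻¹ • e) - W x)) atTop
      (nhds (fderiv ℝ W x e)) := fun e => (hd.hasFDerivAt.lim_real e).comp hc
  have hev : ∀ᶠ n : ℕ in atTop, 1 / ((n:ℝ) + 1) < ‖x‖ :=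
    (tendsto_one_div_add_atTop_nhds_zero_nat (𝕜 := ℝ)).eventually (gt_mem_nhds hxn)
  have t1 : Tendsto (fun n : ℕ => ((n : ℝ) + 1) * (rearr v (max (‖x‖ - 1 / ((n:ℝ) + 1)) 0) - rearr v ‖x‖)) atTop
      (nhds (fderiv ℝ W x e)) := by
    refine (hl e).congr' ?_
    filter_upwards [hev] with n hn
    have : x + ((n:ℝ) + 1)⁻¹ • e = ((‖x‖ - 1 / ((n:ℝ) + 1)) / ‖x‖) • x := by
      rw [he, sub_div, div_self hxn.ne', sub_smul, one_smul, smul_neg, smul_smul, ← sub_eq_add_neg]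
      congr 2
      field_simp
    have h2 : ‖x + ((n:ℝ) + 1)⁻¹ • e‖ = max (‖x‖ - 1 / ((n:ℝ) + 1)) 0 := by
      rw [this, norm_smul, max_eq_left (by linarith), norm_div, norm_norm, Real.norm_eq_abs, abs_of_pos (by linarith)]
      field_simp
    simp only [hW, h2]
  refine ⟨_, ?_, t1⟩
  have hle : ∀ g : E2, ‖g‖ = 1 → fderiv ℝ W x g ≤ fderiv ℝ W x e := by
    intro g hg
    refine le_of_tendsto_of_tendsto' (b := atTop) (hl g) t1 fun n => ?_
    have hn : 0 < (n:ℝ) + 1 := by positivity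
    gcongr
    apply h.rearr_anti (le_max_right _ _)
    apply max_le _ (norm_nonneg _)
    have h1 := norm_sub_le (x + ((n:ℝ) + 1)⁻¹ • g) (((n:ℝ) + 1)⁻¹ • g)
    rw [add_sub_cancel_right, norm_smul, hg, Real.norm_eq_abs, abs_of_pos (by positivity), mul_one] at h1
    rw [one_div]; linarith
  have hd0 : 0 ≤ fderiv ℝ W x e := by
    refine ge_of_tendsto' t1 fun n => ?_
    have hn : 0 < (n:ℝ) + 1 := by positivity
    apply mul_nonneg hn.le
    rw [sub_nonneg]
    apply h.rearr_anti (le_max_right _ _)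
    apply max_le _ (norm_nonneg _)
    have : 0 < 1 / ((n:ℝ) + 1) := by positivity
    linarith
  apply ContinuousLinearMap.opNorm_le_of_unit_norm hd0
  intro g hg
  rw [Real.norm_eq_abs, abs_le]
  have h1 := hle g hg
  have h2 := hle (-g) (by rw [norm_neg, hg])
  rw [map_neg] at h2
  exact ⟨by linarith, h1⟩

lemma Tst.step {u : E2 → ℝ} (h : Tst fun x => |u x|) (hu : Differentiable ℝ u) (hfd : Continuous (fderiv ℝ u))
    {C0 C1 : NNReal}
    (hC0 : LipschitzWith C0 u) (hC1 : LipschitzWith C1 (fderiv ℝ u)) {ρ : ℝ}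
    (hρ : ∀ x, ρ ≤ ‖x‖ → u x = 0) {ε : ℝ} (hε : 0 < ε) (hε1 : ε ≤ 1) :
    ∫⁻ x : E2, ENNReal.ofReal ((rearr (fun x => |u x|) (max (‖x‖ - ε) 0) - rearr (fun x => |u x|) ‖x‖) ^ 2) ≤
      ENNReal.ofReal (ε ^ 2) * ((∫⁻ x, ENNReal.ofReal (‖fderiv ℝ u x‖ ^ 2)) +
        ENNReal.ofReal ε * (ENNReal.ofReal (2 * C1 * C0 + C1 ^ 2) * volume (Metric.ball (0:E2) (ρ + 1)))) := by
  set v : E2 → ℝ := fun x => |u x| with hv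
  set B := Metric.ball (0:E2) (ρ + 1) with hB
  set p : E2 → ℝ := B.indicator (fun x => ‖fderiv ℝ u x‖ + C1 * ε) with hp
  have hvC : LipschitzWith C0 v := by
    have := (lipschitzWith_one_norm (E := ℝ)).comp hC0
    rw [one_mul] at this; exact this
  have hpm : Measurable p := (by fun_prop : Continuous fun x => ‖fderiv ℝ u x‖ + C1 * ε).measurable.indicator Metric.isOpen_ball.measurableSet
  have hp0 : ∀ x, 0 ≤ p x := fun x => indicator_nonneg (fun x _ => by positivity) x
  set f : E2 → ℝ := fun x => v x + ε * p x with hf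
  have hfm : Measurable f := h.cont.measurable.add (hpm.const_mul _)
  have hrr : ∀ x : E2, rearr v ‖x‖ ≤ rearr v (max (‖x‖ - ε) 0) := fun x =>
    h.rearr_anti (le_max_right _ _) (max_le (by linarith) (norm_nonneg _))
  have h1 := contraction (f := f) (g := v) (F := fun x => rearr v (max (‖x‖ - ε) 0)) (G := fun x => rearr v ‖x‖)
    hfm h.cont.measurable (h.Weps_cont hvC ε).measurable (h.W_lip hvC).continuous.measurable h.nonneg
    (fun x => by have := mul_nonneg hε.le (hp0 x); simp only [hf]; linarith)
    (fun x => rearr_nonneg _ _) hrr (by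
      intro s t hs hst
      apply h.level_eps hε hs hst hfm
      · apply (Metric.isBounded_ball (x := (0:E2)) (r := ρ + 1)).subset
        intro x hx
        by_contra hxB
        have hx' : t < f x := hx
        have h2 : p x = 0 := indicator_of_notMem hxB _
        have h3 : u x = 0 := hρ x (by
          rw [mem_ball_zero_iff] at hxB; push Not at hxB; linarith)
        simp only [hf, hv, h2, h3, abs_zero] at hx'
        linarith
      · intro a ha x hxa
        have ha' : ‖a‖ < ρ := by
          by_contra hcon
          push Not at hcon
          have : t < |u a| := ha
          rw [hρ a hcon, abs_zero] at this
          linarith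
        have hxB : x ∈ B := by
          rw [mem_ball_zero_iff]
          have : ‖x‖ ≤ ‖x - a‖ + ‖a‖ := by simpa using norm_add_le (x - a) a
          rw [dist_eq_norm] at hxa
          linarith
        have h4 := taylor_bd hu hC1 hxa
        have h5 : p x = ‖fderiv ℝ u x‖ + C1 * ε := indicator_of_mem hxB _
        simp only [hf, h5, hv]
        exact lt_of_lt_of_le ha h4)
  refine h1.trans ?_
  calc ∫⁻ x, ENNReal.ofReal ((f x - v x) ^ 2)
      ≤ ∫⁻ x, ENNReal.ofReal (ε ^ 2) * (ENNReal.ofReal (‖fderiv ℝ u x‖ ^ 2) +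
          B.indicator (fun _ => ENNReal.ofReal ε * ENNReal.ofReal (2 * C1 * C0 + C1 ^ 2)) x) := by
        apply lintegral_mono
        intro x
        have e1 : f x - v x = ε * p x := by simp only [hf]; ring
        show ENNReal.ofReal ((f x - v x) ^ 2) ≤ _
        rw [e1, mul_pow, ENNReal.ofReal_mul (by positivity)]
        refine mul_le_mul_right ?_ _
        by_cases hx : x ∈ B
        · rw [hp, indicator_of_mem hx, indicator_of_mem hx, ← ENNReal.ofReal_mul hε.le,
            ← ENNReal.ofReal_add (by positivity) (by positivity)]
          apply ENNReal.ofReal_le_ofReal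
          have hD : ‖fderiv ℝ u x‖ ≤ C0 := norm_fderiv_le_of_lipschitz ℝ hC0
          have hn := norm_nonneg (fderiv ℝ u x)
          have hc1 := C1.coe_nonneg
          have a1 : 2 * (C1 * ε) * ‖fderiv ℝ u x‖ ≤ 2 * (C1 * ε) * C0 := by gcongr
          have a2 : (C1:ℝ) ^ 2 * (ε * ε) ≤ C1 ^ 2 * (ε * 1) := by gcongr
          nlinarith
        · rw [hp, indicator_of_notMem hx, indicator_of_notMem hx]
          simp
    _ = _ := by
        rw [lintegral_const_mul' _ _ ENNReal.ofReal_ne_top, lintegral_add_right _ (measurable_const.indicator Metric.isOpen_ball.measurableSet),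
          lintegral_indicator_const Metric.isOpen_ball.measurableSet, mul_assoc]

lemma polya_szego {u : E2 → ℝ} (h1 : ContDiff ℝ (⊤ : ℕ∞) u) (h2 : HasCompactSupport u) {C0 : NNReal}
    (hC0 : LipschitzWith C0 u) (h : Tst fun x => |u x|) :
    ∫ x : E2, ‖fderiv ℝ (fun x : E2 => rearr (fun x => |u x|) ‖x‖) x‖ ^ 2 ≤ ∫ x, ‖fderiv ℝ u x‖ ^ 2 := by
  set v : E2 → ℝ := fun x => |u x| with hv
  set W : E2 → ℝ := fun x => rearr v ‖x‖ with hW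
  have hvC : LipschitzWith C0 v := by
    have := (lipschitzWith_one_norm (E := ℝ)).comp hC0
    rw [one_mul] at this; exact this
  have hfc : ContDiff ℝ 1 (fderiv ℝ u) := h1.fderiv_right (m := 1) (by norm_cast)
  have hfs : HasCompactSupport (fderiv ℝ u) := h2.fderiv ℝ
  obtain ⟨C1, hC1⟩ := hfc.lipschitzWith_of_hasCompactSupport hfs one_ne_zero
  obtain ⟨ρ, hρ⟩ := h2.isCompact.isBounded.subset_ball 0
  have hρ' : ∀ x, ρ ≤ ‖x‖ → u x = 0 := by
    intro x hx
    apply image_eq_zero_of_notMem_tsupport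
    intro hx'
    have := hρ hx'
    rw [mem_ball_zero_iff] at this
    linarith
  set M := ENNReal.ofReal (2 * C1 * C0 + C1 ^ 2) * volume (Metric.ball (0:E2) (ρ + 1)) with hM
  have hMt : M ≠ ⊤ := ENNReal.mul_ne_top ENNReal.ofReal_ne_top Metric.isBounded_ball.measure_lt_top.ne
  set J := ∫⁻ x, ENNReal.ofReal (‖fderiv ℝ u x‖ ^ 2) with hJ
  set q : ℕ → E2 → ℝ := fun n x => ((n : ℝ) + 1) * (rearr v (max (‖x‖ - 1 / ((n:ℝ) + 1)) 0) - rearr v ‖x‖) with hq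
  have hqc : ∀ n, Continuous (q n) := fun n =>
    continuous_const.mul ((h.Weps_cont hvC _).sub (h.W_lip hvC).continuous)
  have hstep : ∀ n : ℕ, ∫⁻ x, ENNReal.ofReal (q n x ^ 2) ≤ J + ENNReal.ofReal (1 / ((n:ℝ) + 1)) * M := by
    intro n
    have hn : (0:ℝ) < (n:ℝ) + 1 := by positivity
    have := h.step (h1.differentiable (by simp)) hfc.continuous hC0 hC1 hρ' (ε := 1 / ((n:ℝ) + 1)) (by positivity)
      (by rw [div_le_one hn]; linarith [n.cast_nonneg (α := ℝ)])
    calc ∫⁻ x, ENNReal.ofReal (q n x ^ 2)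
        = ENNReal.ofReal (((n:ℝ) + 1) ^ 2) * ∫⁻ x : E2, ENNReal.ofReal ((rearr v (max (‖x‖ - 1 / ((n:ℝ) + 1)) 0) - rearr v ‖x‖) ^ 2) := by
          rw [← lintegral_const_mul' _ _ ENNReal.ofReal_ne_top]
          apply lintegral_congr
          intro x
          rw [← ENNReal.ofReal_mul (by positivity), hq, mul_pow]
      _ ≤ ENNReal.ofReal (((n:ℝ) + 1) ^ 2) * (ENNReal.ofReal ((1 / ((n:ℝ) + 1)) ^ 2) * (J + ENNReal.ofReal (1 / ((n:ℝ) + 1)) * M)) := by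
          gcongr
      _ = _ := by
          rw [← mul_assoc, ← ENNReal.ofReal_mul (by positivity)]
          have : ((n:ℝ) + 1) ^ 2 * (1 / ((n:ℝ) + 1)) ^ 2 = 1 := by field_simp
          rw [this]; simp
  have hlim : Tendsto (fun n : ℕ => J + ENNReal.ofReal (1 / ((n:ℝ) + 1)) * M) atTop (nhds J) := by
    have t1 : Tendsto (fun n : ℕ => ENNReal.ofReal (1 / ((n:ℝ) + 1))) atTop (nhds 0) := by
      have := ENNReal.tendsto_ofReal (tendsto_one_div_add_atTop_nhds_zero_nat (𝕜 := ℝ))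
      simpa using this
    have t2 := ENNReal.Tendsto.mul_const t1 (Or.inr hMt) (b := M)
    have t3 := tendsto_const_nhds (x := J).add t2
    simpa using t3
  have hae : ∀ᵐ x : E2, ENNReal.ofReal (‖fderiv ℝ W x‖ ^ 2) ≤ liminf (fun n => ENNReal.ofReal (q n x ^ 2)) atTop := by
    have hne : ∀ᵐ x : E2, x ≠ 0 := by
      rw [ae_iff]; simp
    filter_upwards [(h.W_lip hvC).ae_differentiableAt, hne] with x hx hx0
    obtain ⟨d, hd, ht⟩ := h.fderiv_W hx0 hx
    have := ENNReal.tendsto_ofReal (ht.pow 2)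
    rw [this.liminf_eq]
    apply ENNReal.ofReal_le_ofReal
    gcongr
  have hfat : ∫⁻ x, ENNReal.ofReal (‖fderiv ℝ W x‖ ^ 2) ≤ J := by
    calc ∫⁻ x, ENNReal.ofReal (‖fderiv ℝ W x‖ ^ 2)
        ≤ ∫⁻ x, liminf (fun n => ENNReal.ofReal (q n x ^ 2)) atTop := lintegral_mono_ae hae
      _ ≤ liminf (fun n => ∫⁻ x, ENNReal.ofReal (q n x ^ 2)) atTop :=
          lintegral_liminf_le fun n => ((hqc n).pow 2).measurable.ennreal_ofReal
      _ ≤ liminf (fun n : ℕ => J + ENNReal.ofReal (1 / ((n:ℝ) + 1)) * M) atTop :=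
          liminf_le_liminf (Eventually.of_forall hstep)
      _ = J := hlim.liminf_eq
  have hIntg : Integrable fun x => ‖fderiv ℝ u x‖ ^ 2 := by
    have : HasCompactSupport fun x => ‖fderiv ℝ u x‖ ^ 2 := hfs.norm.sq'
    exact (hfc.continuous.norm.pow 2).integrable_of_hasCompactSupport this
  rw [integral_eq_lintegral_of_nonneg_ae (Eventually.of_forall fun x => by positivity)
      (((measurable_fderiv ℝ W).norm.pow_const 2).aestronglyMeasurable),
    integral_eq_lintegral_of_nonneg_ae (Eventually.of_forall fun x => by positivity) hIntg.1]
  apply ENNReal.toReal_mono _ hfat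
  exact hIntg.lintegral_lt_top.ne

theorem faber_krahn {Ω : Set E2} (ho : IsOpen Ω) (hb : Bornology.IsBounded Ω) (hn : Ω.Nonempty) :
    π * dEig1 unitDisc ≤ (volume Ω).toReal * dEig1 Ω := by
  have hA := vol_pos ho hb hn
  set A := (volume Ω).toReal with hAdef
  suffices H : π * dEig1 unitDisc / A ≤ dEig1 Ω by
    rw [div_le_iff₀ hA] at H; linarith
  apply le_dEig1 ho hn
  intro u h1 h2 h3
  set v : E2 → ℝ := fun x => |u x| with hv
  have hcv : HasCompactSupport v := h2.norm
  have h : Tst v := ⟨h1.continuous.abs, hcv, fun x => abs_nonneg _⟩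
  obtain ⟨C0, hC0⟩ := h1.lipschitzWith_of_hasCompactSupport h2 (by simp)
  have hvC : LipschitzWith C0 v := by
    have := (lipschitzWith_one_norm (E := ℝ)).comp hC0
    rw [one_mul] at this; exact this
  have hps := polya_szego h1 h2 hC0 h
  set W : E2 → ℝ := fun x => rearr v ‖x‖ with hW
  have hWl : LipschitzWith C0 W := h.W_lip hvC
  have hm : dist_fn v 0 ≤ A := by
    apply ENNReal.toReal_mono hb.measure_lt_top.ne
    apply measure_mono
    intro x hx
    apply h3
    apply subset_tsupport
    have : 0 < |u x| := hx
    exact abs_pos.1 this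
  have hR : 0 < √(A / π) := Real.sqrt_pos.2 (by positivity)
  have hs : ∀ x, √(A / π) ≤ ‖x‖ → W x = 0 := by
    intro x hx
    apply le_antisymm _ (rearr_nonneg _ _)
    rw [h.rearr_le le_rfl]
    have : A / π ≤ ‖x‖ ^ 2 := by
      rw [Real.sqrt_le_left (norm_nonneg _)] at hx; exact hx
    rw [div_le_iff₀ pi_pos] at this
    linarith
  have hd := dEig1_lip hWl hR hs
  rw [Real.sq_sqrt (by positivity)] at hd
  have hWs : HasCompactSupport W := by
    apply HasCompactSupport.of_support_subset_isCompact (isCompact_closedBall (0:E2) √(A / π))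
    intro x hx
    rw [mem_closedBall_zero_iff]
    by_contra hcon
    push Not at hcon
    exact hx (hs x hcon.le)
  have hiW : Integrable fun x => W x ^ 2 := (hWl.continuous.pow 2).integrable_of_hasCompactSupport hWs.sq'
  have hiu : Integrable fun x => u x ^ 2 := (h1.continuous.pow 2).integrable_of_hasCompactSupport h2.sq'
  have hle : ∫ x, u x ^ 2 ≤ ∫ x, W x ^ 2 := by
    have hc := contraction (f := W) (g := fun _ => 0) (F := v) (G := fun _ => 0) hWl.continuous.measurable
      measurable_const h.cont.measurable measurable_const (fun _ => le_rfl) (fun x => rearr_nonneg _ _)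
      (fun _ => le_rfl) h.nonneg (by
        intro s t hs hst
        have := h.level_vol (t := t) (hs.trans hst.le)
        simp only [hs, and_true]
        exact this.ge)
    simp only [sub_zero] at hc
    rw [integral_eq_lintegral_of_nonneg_ae (Eventually.of_forall fun x => sq_nonneg _) hiu.1,
      integral_eq_lintegral_of_nonneg_ae (Eventually.of_forall fun x => sq_nonneg _) hiW.1]
    apply ENNReal.toReal_mono hiW.lintegral_lt_top.ne
    have e : ∀ x, v x ^ 2 = u x ^ 2 := fun x => sq_abs _
    simpa only [e] using hc
  have hd0 : 0 ≤ dEig1 unitDisc := dEig1_nonneg _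
  have hpp := pi_pos
  calc π * dEig1 unitDisc / A * ∫ x, u x ^ 2 = π / A * (dEig1 unitDisc * ∫ x, u x ^ 2) := by ring
    _ ≤ π / A * (dEig1 unitDisc * ∫ x, W x ^ 2) := by gcongr
    _ ≤ π / A * (A / π * ∫ x, ‖fderiv ℝ W x‖ ^ 2) := by gcongr
    _ = ∫ x, ‖fderiv ℝ W x‖ ^ 2 := by field_simp
    _ ≤ _ := hps

def wC (r : ℝ) : ℝ := ∫ θ in (0:ℝ)..π, cos (r * cos θ) * sin θ ^ 2
def wC1 (r : ℝ) : ℝ := ∫ θ in (0:ℝ)..π, -(sin (r * cos θ) * cos θ) * sin θ ^ 2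
def wC2 (r : ℝ) : ℝ := ∫ θ in (0:ℝ)..π, -(cos (r * cos θ) * cos θ ^ 2) * sin θ ^ 2

lemma wC_deriv (r : ℝ) : HasDerivAt wC (wC1 r) r := by
  have := intervalIntegral.hasDerivAt_integral_of_dominated_loc_of_deriv_le (μ := volume) (a := 0) (b := π)
    (F := fun r θ => cos (r * cos θ) * sin θ ^ 2) (F' := fun r θ => -(sin (r * cos θ) * cos θ) * sin θ ^ 2)
    (x₀ := r) (s := univ) (bound := fun _ => 1) univ_mem
    (Eventually.of_forall fun x => by
      exact (by fun_prop : Continuous fun θ => cos (x * cos θ) * sin θ ^ 2).aestronglyMeasurable)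
    ((by fun_prop : Continuous fun θ => cos (r * cos θ) * sin θ ^ 2).intervalIntegrable _ _)
    (by exact (by fun_prop : Continuous fun θ => -(sin (r * cos θ) * cos θ) * sin θ ^ 2).aestronglyMeasurable)
    (Eventually.of_forall fun θ _ x _ => by
      rw [norm_mul, norm_neg, norm_mul, norm_pow]
      have h1 := abs_sin_le_one (x * cos θ)
      have h2 := abs_cos_le_one θ
      have h3 := abs_sin_le_one θ
      simp only [Real.norm_eq_abs]
      exact mul_le_one₀ (mul_le_one₀ h1 (abs_nonneg _) h2) (by positivity) (pow_le_one₀ (abs_nonneg _) h3))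
    (by simp)
    (Eventually.of_forall fun θ _ x _ => by
      have h1 : HasDerivAt (fun x => x * cos θ) (cos θ) x := by simpa using (hasDerivAt_id x).mul_const (cos θ)
      exact (h1.cos.mul_const _).congr_deriv (by ring))
  exact this.2

lemma wC1_deriv (r : ℝ) : HasDerivAt wC1 (wC2 r) r := by
  have := intervalIntegral.hasDerivAt_integral_of_dominated_loc_of_deriv_le (μ := volume) (a := 0) (b := π)
    (F := fun r θ => -(sin (r * cos θ) * cos θ) * sin θ ^ 2)
    (F' := fun r θ => -(cos (r * cos θ) * cos θ ^ 2) * sin θ ^ 2)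
    (x₀ := r) (s := univ) (bound := fun _ => 1) univ_mem
    (Eventually.of_forall fun x => by
      exact (by fun_prop : Continuous fun θ => -(sin (x * cos θ) * cos θ) * sin θ ^ 2).aestronglyMeasurable)
    ((by fun_prop : Continuous fun θ => -(sin (r * cos θ) * cos θ) * sin θ ^ 2).intervalIntegrable _ _)
    (by exact (by fun_prop : Continuous fun θ => -(cos (r * cos θ) * cos θ ^ 2) * sin θ ^ 2).aestronglyMeasurable)
    (Eventually.of_forall fun θ _ x _ => by
      rw [norm_mul, norm_neg, norm_mul, norm_pow, norm_pow]
      have h1 := abs_cos_le_one (x * cos θ)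
      have h2 := abs_cos_le_one θ
      have h3 := abs_sin_le_one θ
      simp only [Real.norm_eq_abs]
      exact mul_le_one₀ (mul_le_one₀ h1 (by positivity) (pow_le_one₀ (abs_nonneg _) h2)) (by positivity)
        (pow_le_one₀ (abs_nonneg _) h3))
    (by simp)
    (Eventually.of_forall fun θ _ x _ => by
      have h1 : HasDerivAt (fun x => x * cos θ) (cos θ) x := by simpa using (hasDerivAt_id x).mul_const (cos θ)
      exact (((h1.sin.mul_const (cos θ)).neg).mul_const (sin θ ^ 2)).congr_deriv (by ring))
  exact this.2

lemma wC_ode (r : ℝ) : r * wC2 r + 3 * wC1 r + r * wC r = 0 := by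
  have h : ∫ θ in (0:ℝ)..π, (r * (-(cos (r * cos θ) * cos θ ^ 2) * sin θ ^ 2)
      + 3 * (-(sin (r * cos θ) * cos θ) * sin θ ^ 2) + r * (cos (r * cos θ) * sin θ ^ 2)) = 0 := by
    rw [intervalIntegral.integral_eq_sub_of_hasDerivAt (f := fun θ => - sin (r * cos θ) * sin θ ^ 3)]
    · simp
    · intro θ _
      have h1 : HasDerivAt (fun θ => r * cos θ) (r * (- sin θ)) θ := (hasDerivAt_cos θ).const_mul r
      refine ((h1.sin.neg).mul ((hasDerivAt_sin θ).pow 3)).congr_deriv ?_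
      have h2 : cos θ ^ 2 = 1 - sin θ ^ 2 := cos_sq' θ
      have : ∀ A B : ℝ, -(A * (r * -sin θ)) * sin θ ^ 3 + -B * (3 * sin θ ^ 2 * cos θ) =
        r * (-(A * cos θ ^ 2) * sin θ ^ 2) + 3 * (-(B * cos θ) * sin θ ^ 2) + r * (A * sin θ ^ 2) := by
        intro A B; rw [h2]; ring
      simpa using this (cos (r * cos θ)) (sin (r * cos θ))
    · exact Continuous.intervalIntegrable (by fun_prop) _ _
  rw [intervalIntegral.integral_add, intervalIntegral.integral_add, intervalIntegral.integral_const_mul,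
    intervalIntegral.integral_const_mul, intervalIntegral.integral_const_mul] at h
  · exact h
  all_goals exact Continuous.intervalIntegrable (by fun_prop) _ _

lemma wC_zero : 0 < wC 0 := by
  have : wC 0 = π / 2 := by
    simp [wC]
  rw [this]; positivity

def wg (r : ℝ) : ℝ := r * wC r
def wg1 (r : ℝ) : ℝ := wC r + r * wC1 r

lemma wC_cont : Continuous wC := continuous_iff_continuousAt.2 fun r => (wC_deriv r).continuousAt
lemma wC1_cont : Continuous wC1 := continuous_iff_continuousAt.2 fun r => (wC1_deriv r).continuousAt
lemma wg_cont : Continuous wg := continuous_id.mul wC_cont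
lemma wg1_cont : Continuous wg1 := wC_cont.add (continuous_id.mul wC1_cont)

lemma wg_deriv (r : ℝ) : HasDerivAt wg (wg1 r) r :=
  ((hasDerivAt_id r).mul (wC_deriv r)).congr_deriv (by simp [wg1])

lemma wg1_deriv (r : ℝ) : HasDerivAt wg1 (- wC1 r - r * wC r) r :=
  ((wC_deriv r).add ((hasDerivAt_id r).mul (wC1_deriv r))).congr_deriv (by
    have := wC_ode r
    simp only [id]; linarith)

/-- `(r g')' = (1 - r²) C` -/
lemma rwg1_deriv (r : ℝ) : HasDerivAt (fun r => r * wg1 r) ((1 - r ^ 2) * wC r) r :=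
  ((hasDerivAt_id r).mul (wg1_deriv r)).congr_deriv (by simp only [id, wg1]; ring)

lemma exists_wk : ∃ k, 0 < k ∧ wg1 k = 0 ∧ ∀ r, 0 ≤ r → r < k → 0 < wg1 r := by
  have h0 : 0 < wg1 0 := by simpa [wg1] using wC_zero
  have hex : ∃ r, 0 ≤ r ∧ wg1 r ≤ 0 := by
    by_contra hcon
    push Not at hcon
    have hmono : StrictMonoOn wg (Ici 0) := by
      apply strictMonoOn_of_deriv_pos (convex_Ici 0) wg_cont.continuousOn
      intro x hx
      rw [interior_Ici] at hx
      rw [(wg_deriv x).deriv]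
      exact hcon x (le_of_lt hx)
    have hg2 : 0 < wg 2 := by
      have := hmono (mem_Ici.2 le_rfl) (mem_Ici.2 zero_le_two) zero_lt_two
      simpa [wg] using this
    have hanti : AntitoneOn (fun r => r * wg1 r + (3/2) * wg 2 * r) (Ici 2) := by
      have hd : ∀ r, HasDerivAt (fun r => r * wg1 r + (3/2) * wg 2 * r) ((1 - r ^ 2) * wC r + (3/2) * wg 2) r := by
        intro r
        have h2 : HasDerivAt (fun r => (3/2) * wg 2 * r) ((3/2) * wg 2) r := by
          simpa using (hasDerivAt_id r).const_mul ((3/2) * wg 2)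
        exact (rwg1_deriv r).add h2
      apply antitoneOn_of_deriv_nonpos (convex_Ici 2)
      · exact fun r _ => (hd r).continuousAt.continuousWithinAt
      · exact fun r _ => (hd r).differentiableAt.differentiableWithinAt
      · intro r hr
        rw [interior_Ici] at hr
        have hr2 : 2 < r := hr
        rw [(hd r).deriv]
        have hge : wg 2 ≤ wg r := hmono.monotoneOn (mem_Ici.2 zero_le_two) (mem_Ici.2 (by linarith)) hr2.le
        have hCr : wC r = wg r / r := by simp only [wg]; field_simp
        have : (1 - r ^ 2) * wC r = - ((r ^ 2 - 1) / r) * wg r := by rw [hCr]; ring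
        have h3 : 3/2 ≤ (r ^ 2 - 1) / r := by
          rw [le_div_iff₀ (by linarith)]; nlinarith
        rw [this]
        nlinarith
    set c := 2 * wg1 2 + (3/2) * wg 2 * 2 with hc
    have hcp : 0 < wg1 2 := hcon 2 zero_le_two
    set r := 2 + c / ((3/2) * wg 2) with hr
    have hr2 : 2 ≤ r := by rw [hr]; have : 0 ≤ c / ((3/2) * wg 2) := by positivity
                           linarith
    have := hanti (mem_Ici.2 le_rfl) (mem_Ici.2 hr2) hr2
    have hrr : (3/2) * wg 2 * r = (3/2) * wg 2 * 2 + c := by rw [hr]; field_simp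
    have hpos : 0 < r * wg1 r := mul_pos (by linarith) (hcon r (by linarith))
    simp only at this
    rw [hrr] at this
    nlinarith
  obtain ⟨b, hb0, hb⟩ := hex
  set S := Icc 0 b ∩ {r | wg1 r = 0} with hS
  have hScl : IsClosed S := isClosed_Icc.inter (isClosed_eq wg1_cont continuous_const)
  have hSn : S.Nonempty := by
    have := intermediate_value_Icc' hb0 wg1_cont.continuousOn
    obtain ⟨x, hx, hx'⟩ := this ⟨hb, h0.le⟩
    exact ⟨x, hx, hx'⟩
  have hSb : BddBelow S := ⟨0, fun x hx => hx.1.1⟩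
  have hk := hScl.csInf_mem hSn hSb
  set k := sInf S
  have hk0 : 0 < k := by
    rcases hk.1.1.eq_or_lt with h | h
    · have : wg1 k = 0 := hk.2
      rw [← h] at this; linarith
    · exact h
  refine ⟨k, hk0, hk.2, ?_⟩
  intro r hr hrk
  by_contra hcon
  push Not at hcon
  obtain ⟨x, hx, hx'⟩ := intermediate_value_Icc' hr wg1_cont.continuousOn ⟨hcon, h0.le⟩
  have : k ≤ x := csInf_le hSb ⟨⟨hx.1, by linarith [hx.2, hk.1.2]⟩, hx'⟩
  linarith [hx.2]

def wk : ℝ := Classical.choose exists_wk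
lemma wk_pos : 0 < wk := (Classical.choose_spec exists_wk).1
lemma wk_zero : wg1 wk = 0 := (Classical.choose_spec exists_wk).2.1
lemma wg1_pos {r : ℝ} (h0 : 0 ≤ r) (h : r < wk) : 0 < wg1 r := (Classical.choose_spec exists_wk).2.2 r h0 h
lemma wg1_nonneg {r : ℝ} (h0 : 0 ≤ r) (h : r ≤ wk) : 0 ≤ wg1 r := by
  rcases h.eq_or_lt with rfl | h
  · exact wk_zero.ge
  · exact (wg1_pos h0 h).le

lemma wg_mono : StrictMonoOn wg (Icc 0 wk) := by
  apply strictMonoOn_of_deriv_pos (convex_Icc _ _) wg_cont.continuousOn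
  intro x hx
  rw [interior_Icc] at hx
  rw [(wg_deriv x).deriv]
  exact wg1_pos hx.1.le hx.2

lemma wg_pos {r : ℝ} (h0 : 0 < r) (h : r ≤ wk) : 0 < wg r := by
  have := wg_mono ⟨le_rfl, wk_pos.le⟩ ⟨h0.le, h⟩ h0
  simpa [wg] using this

lemma wC_pos {r : ℝ} (h0 : 0 ≤ r) (h : r ≤ wk) : 0 < wC r := by
  rcases h0.eq_or_lt with rfl | h0
  · exact wC_zero
  · exact pos_of_mul_pos_right (wg_pos h0 h) h0.le

lemma wC1_nonpos {r : ℝ} (h0 : 0 < r) (h : r ≤ wk) : wC1 r ≤ 0 := by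
  have hd : ∀ r, HasDerivAt (fun r => r ^ 3 * wC1 r) (- r ^ 3 * wC r) r := by
    intro r
    refine ((hasDerivAt_pow 3 r).mul (wC1_deriv r)).congr_deriv ?_
    have := wC_ode r
    simp only [Nat.cast_ofNat]
    linear_combination r ^ 2 * this
  have hanti : AntitoneOn (fun r => r ^ 3 * wC1 r) (Icc 0 wk) := by
    apply antitoneOn_of_deriv_nonpos (convex_Icc _ _)
    · exact fun r _ => (hd r).continuousAt.continuousWithinAt
    · exact fun r _ => (hd r).differentiableAt.differentiableWithinAt
    · intro r hr
      rw [interior_Icc] at hr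
      rw [(hd r).deriv]
      have h1 := wC_pos hr.1.le hr.2.le
      have h2 : 0 ≤ r ^ 3 := by have := hr.1.le; positivity
      nlinarith
  have := hanti ⟨le_rfl, wk_pos.le⟩ ⟨h0.le, h⟩ h0.le
  simp only [ne_eq, OfNat.ofNat_ne_zero, not_false_eq_true, zero_pow, zero_mul] at this
  by_contra hcon
  push Not at hcon
  have : 0 < r ^ 3 * wC1 r := by positivity
  linarith

lemma wC_anti : AntitoneOn wC (Icc 0 wk) := by
  apply antitoneOn_of_deriv_nonpos (convex_Icc _ _) wC_cont.continuousOn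
  · exact fun r _ => (wC_deriv r).differentiableAt.differentiableWithinAt
  · intro r hr
    rw [interior_Icc] at hr
    rw [(wC_deriv r).deriv]
    exact wC1_nonpos hr.1 hr.2.le

lemma fr_dirv0 (z : ℝ × ℝ) : fr 0 (dirv 0) z = !₂[z.1, z.2] := by
  apply E2_ext <;> simp [dirv]

lemma polar_disc {f : E2 → ℝ} (hf : Continuous f) {R : ℝ} (hR : 0 ≤ R) :
    ∫ x in Metric.ball (0:E2) R, f x = ∫ r in (0:ℝ)..R, r * ∫ θ in (-π)..π, f (r • dirv θ) := by
  have hpp := pi_pos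
  set S := fr 0 (dirv 0) ⁻¹' Metric.ball (0:E2) R with hS
  have hSm : MeasurableSet S := (isOpen_fr 0 (dirv 0) Metric.isOpen_ball).measurableSet
  set F : ℝ × ℝ → ℝ := fun p => p.1 * f (p.1 • dirv p.2) with hF
  have hFc : Continuous F := by
    have := continuous_dirv
    fun_prop
  have hT : polarCoord.target = Ioi (0:ℝ) ×ˢ Ioo (-π) π := rfl
  have hsymm : ∀ p : ℝ × ℝ, fr 0 (dirv 0) (polarCoord.symm p) = p.1 • dirv p.2 := by
    intro p
    rw [fr_dirv0]
    apply E2_ext <;> simp [dirv, polarCoord]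
  rw [← setIntegral_fr 0 (norm_dirv 0), ← integral_indicator hSm, ← integral_comp_polarCoord_symm]
  have hpt : ∀ p ∈ polarCoord.target, p.1 • S.indicator (fun z => f (fr 0 (dirv 0) z)) (polarCoord.symm p) =
      (Iio R ×ˢ (univ : Set ℝ)).indicator F p := by
    intro p hp
    rw [hT] at hp
    have hp1 : 0 < p.1 := hp.1
    have hiff : polarCoord.symm p ∈ S ↔ p ∈ Iio R ×ˢ (univ : Set ℝ) := by
      simp only [hS, mem_preimage, hsymm, mem_ball_zero_iff, norm_smul, norm_dirv, mul_one, Real.norm_eq_abs,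
        abs_of_pos hp1, mem_prod, mem_Iio, mem_univ, and_true]
    by_cases hm : p ∈ Iio R ×ˢ (univ : Set ℝ)
    · rw [indicator_of_mem hm, indicator_of_mem (hiff.2 hm), hsymm, smul_eq_mul]
    · rw [indicator_of_notMem hm, indicator_of_notMem (fun h => hm (hiff.1 h)), smul_zero]
  rw [setIntegral_congr_fun (by rw [hT]; exact measurableSet_Ioi.prod measurableSet_Ioo) hpt,
    setIntegral_indicator (measurableSet_Iio.prod MeasurableSet.univ)]
  have hset : polarCoord.target ∩ Iio R ×ˢ (univ : Set ℝ) = Ioo 0 R ×ˢ Ioo (-π) π := by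
    rw [hT, prod_inter_prod, inter_univ]; rfl
  rw [hset, Measure.volume_eq_prod, setIntegral_prod]
  · rw [intervalIntegral.integral_of_le hR, integral_Ioc_eq_integral_Ioo]
    apply integral_congr_ae
    refine Eventually.of_forall fun r => ?_
    simp only [hF]
    rw [intervalIntegral.integral_of_le (by linarith), integral_Ioc_eq_integral_Ioo, integral_const_mul]
  · apply (hFc.continuousOn.integrableOn_compact (isCompact_Icc.prod isCompact_Icc) :
      IntegrableOn F (Icc 0 R ×ˢ Icc (-π) π) _).mono_set
    exact prod_mono Ioo_subset_Icc_self Ioo_subset_Icc_self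

lemma radial_disc {φ : ℝ → ℝ} (hφ : Continuous φ) {R : ℝ} (hR : 0 ≤ R) :
    ∫ x in Metric.ball (0:E2) R, φ ‖x‖ = 2 * π * ∫ r in (0:ℝ)..R, r * φ r := by
  rw [polar_disc (f := fun x => φ ‖x‖) (by fun_prop) hR, ← intervalIntegral.integral_const_mul]
  apply intervalIntegral.integral_congr
  intro r hr
  rw [uIcc_of_le hR] at hr
  simp only [norm_smul, norm_dirv, mul_one, Real.norm_eq_abs, abs_of_nonneg hr.1]
  rw [intervalIntegral.integral_const]
  simp; ring

lemma compare_ball {Ω : Set E2} (ho : IsOpen Ω) (hb : Bornology.IsBounded Ω) {c : E2} {R : ℝ}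
    (hv : (volume Ω).toReal = (volume (Metric.ball c R)).toReal) {f : E2 → ℝ} (hf : Continuous f) {m : ℝ}
    (h1 : ∀ x, x ∈ Metric.ball c R → m ≤ f x) (h2 : ∀ x, x ∉ Metric.ball c R → f x ≤ m) :
    ∫ x in Ω, f x ≤ ∫ x in Metric.ball c R, f x := by
  set B := Metric.ball c R with hB
  have hBo : IsOpen B := Metric.isOpen_ball
  have hBb : Bornology.IsBounded B := Metric.isBounded_ball
  have hg : Continuous fun x => f x - m := by fun_prop
  have i1 : IntegrableOn (fun x => f x - m) Ω := integrableOn_cont hb hg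
  have i2 : IntegrableOn (fun x => f x - m) B := integrableOn_cont hBb hg
  have key : ∫ x in Ω, (f x - m) ≤ ∫ x in B, (f x - m) := by
    rw [← integral_indicator ho.measurableSet, ← integral_indicator hBo.measurableSet]
    apply integral_mono ((integrable_indicator_iff ho.measurableSet).2 i1)
      ((integrable_indicator_iff hBo.measurableSet).2 i2)
    intro x
    by_cases hx : x ∈ B
    · rw [indicator_of_mem hx]
      have := h1 x hx
      by_cases hx' : x ∈ Ω
      · rw [indicator_of_mem hx']
      · rw [indicator_of_notMem hx']; linarith
    · rw [indicator_of_notMem hx]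
      have := h2 x hx
      by_cases hx' : x ∈ Ω
      · rw [indicator_of_mem hx']; linarith
      · rw [indicator_of_notMem hx']
  have j1 : IntegrableOn (fun x => f x) Ω := integrableOn_cont hb hf
  have j2 : IntegrableOn (fun x => f x) B := integrableOn_cont hBb hf
  have k1 : IntegrableOn (fun _ => m) Ω := integrableOn_cont hb continuous_const
  have k2 : IntegrableOn (fun _ => m) B := integrableOn_cont hBb continuous_const
  rw [integral_sub j1 k1, integral_sub j2 k2, setIntegral_const, setIntegral_const] at key
  simp only [Measure.real, hv] at key
  linarith

def hH (s : ℝ) : ℝ := if s ≤ wk then wC s else wg wk / s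
def hH1 (s : ℝ) : ℝ := if s ≤ wk then wC1 s else - wg wk / s ^ 2

lemma hH_deriv (s : ℝ) : HasDerivAt hH (hH1 s) s := by
  have hk := wk_pos
  have hd2 : ∀ s, s ≠ 0 → HasDerivAt (fun s => wg wk / s) (- wg wk / s ^ 2) s := by
    intro s hs
    refine ((hasDerivAt_const s (wg wk)).div (hasDerivAt_id s) hs).congr_deriv ?_
    simp
  rcases lt_trichotomy s wk with h | h | h
  · have e : hH =ᶠ[nhds s] wC := by
      filter_upwards [Iio_mem_nhds h] with x hx
      simp [hH, le_of_lt (mem_Iio.1 hx)]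
    rw [hH1, if_pos h.le]
    exact (wC_deriv s).congr_of_eventuallyEq e
  · subst h
    rw [hH1, if_pos le_rfl]
    have hl : HasDerivWithinAt hH (wC1 wk) (Iic wk) wk := by
      apply (wC_deriv wk).hasDerivWithinAt.congr
      · intro x hx; simp [hH, mem_Iic.1 hx]
      · simp [hH]
    have hk1 : wC1 wk = - wg wk / wk ^ 2 := by
      have := wk_zero
      simp only [wg1] at this
      simp only [wg]
      field_simp
      linarith
    have hr : HasDerivWithinAt hH (wC1 wk) (Ici wk) wk := by
      rw [hk1]
      have e2 : hH wk = wg wk / wk := by simp [hH, wg]; field_simp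
      apply (hd2 wk hk.ne').hasDerivWithinAt.congr
      · intro x hx
        rcases (mem_Ici.1 hx).eq_or_lt with rfl | hx
        · exact e2
        · simp [hH, not_le.2 hx]
      · exact e2
    have := hl.union hr
    rw [Iic_union_Ici, hasDerivWithinAt_univ] at this
    exact this
  · have e : hH =ᶠ[nhds s] fun s => wg wk / s := by
      filter_upwards [Ioi_mem_nhds h] with x hx
      simp [hH, not_le.2 (mem_Ioi.1 hx)]
    rw [hH1, if_neg (not_le.2 h)]
    exact (hd2 s (by linarith)).congr_of_eventuallyEq e

lemma hH_cont : Continuous hH := continuous_iff_continuousAt.2 fun r => (hH_deriv r).continuousAt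

def hG1 (s : ℝ) : ℝ := if s ≤ wk then wg1 s else 0

lemma hG1_eq {s : ℝ} : hH s + s * hH1 s = hG1 s := by
  have hk := wk_pos
  simp only [hH, hH1, hG1]
  split_ifs with h
  · simp [wg1]
  · have : s ≠ 0 := by linarith
    field_simp; ring

lemma hG1_cont : Continuous hG1 := by
  apply Continuous.if_le wg1_cont continuous_const continuous_id continuous_const
  intro x hx
  have : x = wk := hx
  rw [this, wk_zero]

lemma hG_eq (s : ℝ) : s * hH s = if s ≤ wk then wg s else wg wk := by
  have hk := wk_pos
  simp only [hH]
  split_ifs with h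
  · simp [wg]
  · have : s ≠ 0 := by linarith
    field_simp

lemma wgk_pos : 0 < wg wk := wg_pos wk_pos le_rfl

lemma wg_nonneg {s : ℝ} (h0 : 0 ≤ s) (h : s ≤ wk) : 0 ≤ wg s := mul_nonneg h0 (wC_pos h0 h).le

lemma hG_nonneg {s : ℝ} (h : 0 ≤ s) : 0 ≤ s * hH s := by
  rw [hG_eq]
  split_ifs with h'
  · exact wg_nonneg h h'
  · exact wgk_pos.le

lemma hG_le {s : ℝ} (h : 0 ≤ s) : s * hH s ≤ wg wk := by
  rw [hG_eq]
  split_ifs with h'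
  · exact wg_mono.monotoneOn ⟨h, h'⟩ ⟨wk_pos.le, le_rfl⟩ h'
  · exact le_rfl

lemma hG_ge {s : ℝ} (h : wk ≤ s) : s * hH s = wg wk := by
  rw [hG_eq]
  split_ifs with h'
  · rw [le_antisymm h' h]
  · rfl

lemma hH_pos {s : ℝ} (h : 0 ≤ s) : 0 < hH s := by
  simp only [hH]
  split_ifs with h'
  · exact wC_pos h h'
  · exact div_pos wgk_pos (by linarith [wk_pos])

lemma hH_wk : hH wk = wC wk := by simp [hH]

lemma hH_le_wk {s : ℝ} (h : wk ≤ s) : hH s ≤ wC wk := by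
  have hk := wk_pos
  have h1 := hG_ge h
  have h2 : hH s = wg wk / s := by
    have : s ≠ 0 := by linarith
    rw [← h1]; field_simp
  rw [h2, div_le_iff₀ (by linarith)]
  have := wC_pos hk.le le_rfl
  simp only [wg]
  nlinarith

lemma wk_le_hH {s : ℝ} (h0 : 0 ≤ s) (h : s ≤ wk) : wC wk ≤ hH s := by
  simp only [hH, if_pos h]
  exact wC_anti ⟨h0, h⟩ ⟨wk_pos.le, le_rfl⟩ h

lemma hH_le {s : ℝ} (h0 : 0 ≤ s) : hH s ≤ wC 0 := by
  have hk := wk_pos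
  have h1 : wC wk ≤ wC 0 := wC_anti ⟨le_rfl, hk.le⟩ ⟨hk.le, le_rfl⟩ hk.le
  rcases le_total s wk with h | h
  · simp only [hH, if_pos h]
    exact wC_anti ⟨le_rfl, hk.le⟩ ⟨h0, h⟩ h0
  · exact (hH_le_wk h).trans h1

/-- the energy density -/
def hN (s : ℝ) : ℝ := hH s ^ 2 + hG1 s ^ 2

lemma hN_cont : Continuous hN := (hH_cont.pow 2).add (hG1_cont.pow 2)

lemma hN_ge {s : ℝ} (h0 : 0 ≤ s) (h : s ≤ wk) : wC wk ^ 2 ≤ hN s := by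
  have h1 := wk_le_hH h0 h
  have h2 := wC_pos wk_pos.le le_rfl
  simp only [hN]
  nlinarith [sq_nonneg (hG1 s)]

lemma hN_le {s : ℝ} (h : wk ≤ s) : hN s ≤ wC wk ^ 2 := by
  have h1 := hH_le_wk h
  have h2 := hH_pos (wk_pos.le.trans h)
  have h3 : hG1 s = 0 := by
    simp only [hG1]
    split_ifs with h'
    · rw [le_antisymm h' h, wk_zero]
    · rfl
  simp only [hN, h3]
  nlinarith

lemma hN_bdd : ∃ M, 0 ≤ M ∧ ∀ s, 0 ≤ s → hN s ≤ M := by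
  obtain ⟨x, hx, hmax⟩ := isCompact_Icc.exists_isMaxOn (nonempty_Icc.2 wk_pos.le) hN_cont.continuousOn
  refine ⟨hN x, by simp only [hN]; positivity, ?_⟩
  intro s hs
  rcases le_total s wk with h | h
  · exact hmax ⟨hs, h⟩
  · exact (hN_le h).trans (hN_ge hx.1 hx.2)

/-- The ODE identity in integrated form. -/
lemma hN_int {R : ℝ} (hR : 0 < R) :
    ∫ r in (0:ℝ)..R, r * hN (wk / R * r) = ∫ r in (0:ℝ)..R, r * (wk / R * r * hH (wk / R * r)) ^ 2 := by
  set κ := wk / R with hκ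
  have hk := wk_pos
  have hκR : κ * R = wk := by rw [hκ]; field_simp
  have hκ0 : 0 < κ := by positivity
  have key : ∫ r in (0:ℝ)..R, (r * hN (κ * r) - r * (κ * r * hH (κ * r)) ^ 2) = 0 := by
    rw [intervalIntegral.integral_congr (g := fun r => r * (wC (κ * r) ^ 2 + wg1 (κ * r) ^ 2) - r * wg (κ * r) ^ 2)]
    · have hd : ∀ r, HasDerivAt (fun r => κ⁻¹ ^ 2 * ((κ * r) * wg1 (κ * r) * wg (κ * r)))
          (r * (wC (κ * r) ^ 2 + wg1 (κ * r) ^ 2) - r * wg (κ * r) ^ 2) r := by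
        intro r
        have h0 : HasDerivAt (fun r => κ * r) κ r := by simpa using (hasDerivAt_id r).const_mul κ
        have h1 : HasDerivAt (fun r => κ * r * wg1 (κ * r)) _ r := (rwg1_deriv (κ * r)).comp r h0
        have h2 : HasDerivAt (fun r => wg (κ * r)) _ r := (wg_deriv (κ * r)).comp r h0
        refine ((h1.mul h2).const_mul (κ⁻¹ ^ 2)).congr_deriv ?_
        simp only [wg]
        field_simp
        ring
      rw [intervalIntegral.integral_eq_sub_of_hasDerivAt (fun r _ => hd r)]
      · simp [hκR, wk_zero]
      · have := wC_cont
        have := wg1_cont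
        have := wg_cont
        exact Continuous.intervalIntegrable (by fun_prop) _ _
    · intro r hr
      rw [uIcc_of_le hR.le] at hr
      have hle : κ * r ≤ wk := by rw [← hκR]; gcongr; exact hr.2
      simp only [hG_eq, if_pos hle, hN, hH, hG1, wg]
  have := hN_cont
  have := hH_cont
  rw [intervalIntegral.integral_sub (Continuous.intervalIntegrable (by fun_prop) _ _)
    (Continuous.intervalIntegrable (by fun_prop) _ _)] at key
  linarith

def fW (κ : ℝ) (e x : E2) : ℝ := ⟪x, e⟫ * hH (κ * ‖x‖)

def gW (κ : ℝ) (e x : E2) : E2 := hH (κ * ‖x‖) • e + (κ * hH1 (κ * ‖x‖) / ‖x‖ * ⟪x, e⟫) • x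

lemma hasFDerivAt_norm {x : E2} (hx : x ≠ 0) : HasFDerivAt (fun x : E2 => ‖x‖) (‖x‖⁻¹ • innerSL ℝ x) x := by
  have hn : 0 < ‖x‖ := norm_pos_iff.2 hx
  have h1 : HasFDerivAt (fun x : E2 => ‖x‖ ^ 2) (2 • innerSL ℝ x) x := (hasStrictFDerivAt_norm_sq x).hasFDerivAt
  have h2 := h1.sqrt (by positivity)
  have e : (fun x : E2 => √(‖x‖ ^ 2)) = fun x : E2 => ‖x‖ := by
    ext y; exact Real.sqrt_sq (norm_nonneg _)
  rw [e] at h2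
  refine h2.congr_fderiv ?_
  ext y
  simp [Real.sqrt_sq hn.le]
  field_simp

lemma fW_fderiv (κ : ℝ) (e : E2) {x : E2} (hx : x ≠ 0) :
    HasFDerivAt (fW κ e) (innerSL ℝ (gW κ e x)) x := by
  have hn : 0 < ‖x‖ := norm_pos_iff.2 hx
  have h1 : HasFDerivAt (fun x : E2 => κ * ‖x‖) (κ • ‖x‖⁻¹ • innerSL ℝ x) x := (hasFDerivAt_norm hx).const_mul κ
  have h2 : HasFDerivAt (fun x : E2 => hH (κ * ‖x‖)) (hH1 (κ * ‖x‖) • κ • ‖x‖⁻¹ • innerSL ℝ x) x :=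
    HasDerivAt.comp_hasFDerivAt (h₂ := hH) x (hH_deriv (κ * ‖x‖)) h1
  have h3 : HasFDerivAt (fun x : E2 => ⟪x, e⟫) (innerSL ℝ e) x := by
    have : (fun x : E2 => ⟪x, e⟫) = fun x => innerSL ℝ e x := by ext y; simp [real_inner_comm]
    rw [this]; exact (innerSL ℝ e).hasFDerivAt
  refine (h3.mul h2).congr_fderiv ?_
  ext y
  simp [gW, inner_add_left, inner_smul_left]
  ring

lemma fW_fderiv0 (κ : ℝ) (e : E2) : HasFDerivAt (fW κ e) (innerSL ℝ (hH 0 • e)) 0 := by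
  rw [hasFDerivAt_iff_isLittleO_nhds_zero]
  have h1 : (fun h : E2 => fW κ e (0 + h) - fW κ e 0 - innerSL ℝ (hH 0 • e) h) =
      fun h => ⟪h, e⟫ * (hH (κ * ‖h‖) - hH 0) := by
    ext h
    simp [fW, inner_smul_left, real_inner_comm]
    ring
  rw [h1]
  have h2 : (fun h : E2 => ⟪h, e⟫) =O[nhds 0] fun h => ‖h‖ := by
    apply Asymptotics.IsBigO.of_bound ‖e‖
    refine Eventually.of_forall fun h => ?_
    rw [norm_norm, mul_comm]
    exact norm_inner_le_norm h e
  have h3 : (fun h : E2 => hH (κ * ‖h‖) - hH 0) =o[nhds 0] fun _ => (1:ℝ) := by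
    rw [Asymptotics.isLittleO_one_iff]
    have hc : Continuous fun h : E2 => hH (κ * ‖h‖) - hH 0 := by
      have := hH_cont
      fun_prop
    have := hc.tendsto 0
    simpa using this
  have := h2.mul_isLittleO h3
  simp only [mul_one] at this
  exact this.of_norm_right

lemma gW_sum (κ : ℝ) {x : E2} (hx : x ≠ 0) :
    ‖gW κ !₂[1, 0] x‖ ^ 2 + ‖gW κ !₂[0, 1] x‖ ^ 2 = hN (κ * ‖x‖) := by
  have hn : 0 < ‖x‖ := norm_pos_iff.2 hx
  have hs : x 0 ^ 2 + x 1 ^ 2 = ‖x‖ ^ 2 := (norm_sq_E2 x).symm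
  rw [norm_sq_E2, norm_sq_E2, hN, ← hG1_eq]
  simp only [gW, inner_E2]
  simp
  set H := hH (κ * ‖x‖)
  set q := κ * hH1 (κ * ‖x‖) / ‖x‖ with hq
  have e1 : κ * ‖x‖ * hH1 (κ * ‖x‖) = q * (x 0 ^ 2 + x 1 ^ 2) := by
    rw [hs, hq]; field_simp
  rw [e1]
  ring

lemma fW_lip {κ : ℝ} (hκ : 0 ≤ κ) : ∃ C : NNReal, LipschitzWith C (fW κ !₂[1, 0]) ∧ LipschitzWith C (fW κ !₂[0, 1]) := by
  obtain ⟨M, hM0, hM⟩ := hN_bdd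
  have hCC : 0 ≤ √M + hH 0 := add_nonneg (Real.sqrt_nonneg _) (hH_pos le_rfl).le
  have hb : ∀ e : E2, ‖e‖ = 1 → (∀ x, x ≠ 0 → ‖gW κ e x‖ ^ 2 ≤ M) →
      LipschitzWith (Real.toNNReal (√M + hH 0)) (fW κ e) := by
    intro e he hg
    apply lipschitzWith_of_nnnorm_fderiv_le (𝕜 := ℝ)
    · intro x
      rcases eq_or_ne x 0 with rfl | hx
      · exact (fW_fderiv0 κ e).differentiableAt
      · exact (fW_fderiv κ e hx).differentiableAt
    · intro x
      rw [← NNReal.coe_le_coe, coe_nnnorm, Real.coe_toNNReal _ hCC]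
      rcases eq_or_ne x 0 with rfl | hx
      · rw [(fW_fderiv0 κ e).fderiv, innerSL_apply_norm, norm_smul, he, Real.norm_eq_abs,
          abs_of_pos (hH_pos le_rfl)]
        linarith [Real.sqrt_nonneg M]
      · rw [(fW_fderiv κ e hx).fderiv, innerSL_apply_norm]
        have := Real.le_sqrt_of_sq_le (hg x hx)
        linarith [hH_pos (le_refl 0)]
  refine ⟨Real.toNNReal (√M + hH 0), hb _ ?_ ?_, hb _ ?_ ?_⟩
  · simp [EuclideanSpace.norm_eq]
  · intro x hx
    have h1 := gW_sum κ hx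
    have h2 := hM (κ * ‖x‖) (by positivity)
    nlinarith [sq_nonneg ‖gW κ !₂[0, 1] x‖]
  · simp [EuclideanSpace.norm_eq]
  · intro x hx
    have h1 := gW_sum κ hx
    have h2 := hM (κ * ‖x‖) (by positivity)
    nlinarith [sq_nonneg ‖gW κ !₂[1, 0] x‖]

/-- potential -/
def hΓ (s : ℝ) : ℝ := ∫ t in (0:ℝ)..s, t * hH t

lemma hΓ_deriv (s : ℝ) : HasDerivAt hΓ (s * hH s) s := by
  have := hH_cont
  have hc : Continuous fun t => t * hH t := by fun_prop
  exact intervalIntegral.integral_hasDerivAt_right (hc.intervalIntegrable _ _)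
    (hc.stronglyMeasurableAtFilter _ _) hc.continuousAt

lemma hΓ_cont : Continuous hΓ := continuous_iff_continuousAt.2 fun r => (hΓ_deriv r).continuousAt

lemma hΓ_lip {s t : ℝ} (hs : 0 ≤ s) (ht : 0 ≤ t) : |hΓ s - hΓ t| ≤ wg wk * |s - t| := by
  have := (convex_Ici (0:ℝ)).norm_image_sub_le_of_norm_hasDerivWithin_le (f := hΓ) (f' := fun s => s * hH s)
    (C := wg wk) (x := t) (y := s) (fun x _ => (hΓ_deriv x).hasDerivWithinAt) (fun x hx => by
      rw [Real.norm_eq_abs, abs_of_nonneg (hG_nonneg hx)]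
      exact hG_le hx) ht hs
  simpa using this

lemma hΓ_ge {s : ℝ} (hs : 0 ≤ s) : wg wk * (s - wk) ≤ hΓ s := by
  have hk := wk_pos
  have hc := hH_cont
  have hgk := wgk_pos
  have hnn : ∀ s, 0 ≤ s → 0 ≤ hΓ s := fun s hs =>
    intervalIntegral.integral_nonneg hs fun t ht => hG_nonneg ht.1
  rcases le_total s wk with h | h
  · have := hnn s hs
    nlinarith
  · have hcc : Continuous fun t => t * hH t := by fun_prop
    have e : hΓ s = hΓ wk + ∫ t in wk..s, t * hH t :=
      (intervalIntegral.integral_add_adjacent_intervals (hcc.intervalIntegrable _ _) (hcc.intervalIntegrable _ _)).symm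
    have e2 : ∫ t in wk..s, t * hH t = ∫ t in wk..s, wg wk := by
      apply intervalIntegral.integral_congr
      intro t ht
      rw [uIcc_of_le h] at ht
      exact hG_ge ht.1
    rw [intervalIntegral.integral_const, smul_eq_mul] at e2
    have := hnn wk hk.le
    rw [e, e2]
    linarith

lemma hΓ_fderiv (κ : ℝ) {x : E2} (hx : x ≠ 0) :
    HasFDerivAt (fun x : E2 => hΓ (κ * ‖x‖)) ((κ ^ 2 * hH (κ * ‖x‖)) • innerSL ℝ x) x := by
  have hn : 0 < ‖x‖ := norm_pos_iff.2 hx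
  have h1 : HasFDerivAt (fun x : E2 => κ * ‖x‖) (κ • ‖x‖⁻¹ • innerSL ℝ x) x := (hasFDerivAt_norm hx).const_mul κ
  refine ((hΓ_deriv (κ * ‖x‖)).comp_hasFDerivAt x h1).congr_fderiv ?_
  ext y
  simp
  field_simp

lemma exists_center {Ω : Set E2} (ho : IsOpen Ω) (hb : Bornology.IsBounded Ω) (hn : Ω.Nonempty) {κ : ℝ} (hκ : 0 < κ) :
    ∃ c : E2, ∀ e : E2, ∫ x in Ω, fW κ e (x - c) = 0 := by
  have hA := vol_pos ho hb hn
  have hgk := wgk_pos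
  have hΓc := hΓ_cont
  have hHc := hH_cont
  set ψ : E2 → ℝ := fun x => hΓ (κ * ‖x‖) with hψ
  have hψc : Continuous ψ := by fun_prop
  have hL : ∀ x y, |ψ x - ψ y| ≤ (wg wk * κ) * ‖x - y‖ := by
    intro x y
    refine (hΓ_lip (by positivity) (by positivity)).trans ?_
    rw [← mul_sub, abs_mul, abs_of_pos hκ, mul_assoc]
    gcongr
    exact abs_norm_sub_norm_le x y
  set L : NNReal := ⟨wg wk * κ, by positivity⟩ with hLd
  set Φ : E2 → ℝ := fun c => ∫ x in Ω, ψ (x - c) with hΦ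
  have hIntg : ∀ c, IntegrableOn (fun x => ψ (x - c)) Ω := fun c =>
    integrableOn_cont hb (by fun_prop : Continuous fun x => ψ (x - c))
  obtain ⟨ρ, hρ⟩ := hb.subset_ball 0
  -- continuity
  have hΦc : Continuous Φ := by
    have : LipschitzWith (L * ⟨(volume Ω).toReal, hA.le⟩) Φ := by
      apply LipschitzWith.of_dist_le_mul
      intro c d
      rw [Real.dist_eq, hΦ]
      simp only
      rw [← integral_sub (hIntg c) (hIntg d), ← Real.norm_eq_abs]
      have := norm_setIntegral_le_of_norm_le_const (μ := volume) (s := Ω) (f := fun x => ψ (x - c) - ψ (x - d))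
        (C := wg wk * κ * dist c d) hb.measure_lt_top (fun x _ => by
          rw [Real.norm_eq_abs]
          refine (hL _ _).trans ?_
          rw [dist_eq_norm, show x - c - (x - d) = -(c - d) by abel, norm_neg])
      refine this.trans (le_of_eq ?_)
      simp only [NNReal.coe_mul, Measure.real]
      show _ = wg wk * κ * (volume Ω).toReal * dist c d
      ring
    exact this.continuous
  have hcoer : Tendsto Φ (cocompact E2) atTop := by
    have hlow : ∀ c, (volume Ω).toReal * (wg wk * (κ * (‖c‖ - ρ) - wk)) ≤ Φ c := by
      intro c
      have := setIntegral_mono_on (μ := volume) (s := Ω) (f := fun _ => wg wk * (κ * (‖c‖ - ρ) - wk))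
        (g := fun x => ψ (x - c)) (integrableOn_cont hb continuous_const) (hIntg c) ho.measurableSet (by
          intro x hx
          have hx' := hρ hx
          rw [mem_ball_zero_iff] at hx'
          have h1 : ‖c‖ - ‖x‖ ≤ ‖x - c‖ := by
            rw [norm_sub_rev]; exact norm_sub_norm_le c x
          refine le_trans ?_ (hΓ_ge (by positivity : 0 ≤ κ * ‖x - c‖))
          gcongr
          linarith)
      rw [setIntegral_const] at this
      exact this
    apply tendsto_atTop_mono hlow
    apply Tendsto.const_mul_atTop hA
    apply Tendsto.const_mul_atTop hgk
    apply tendsto_atTop_add_const_right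
    apply Tendsto.const_mul_atTop hκ
    exact tendsto_atTop_add_const_right _ _ tendsto_norm_cocompact_atTop
  obtain ⟨c, hc⟩ := hΦc.exists_forall_le hcoer
  refine ⟨c, fun e => ?_⟩
  have hder := hasDerivAt_integral_of_dominated_loc_of_lip (μ := volume.restrict Ω)
    (F := fun (t : ℝ) x => ψ (x - (c + t • e))) (x₀ := 0) (s := univ)
    (F' := fun x => - κ ^ 2 * fW κ e (x - c)) (bound := fun _ => wg wk * κ * ‖e‖) univ_mem
    (Eventually.of_forall fun t => by
      exact (by fun_prop : Continuous fun x => ψ (x - (c + t • e))).aestronglyMeasurable)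
    (by simp only [zero_smul, add_zero]; exact hIntg c)
    (by
      have : Continuous fun x => - κ ^ 2 * fW κ e (x - c) := by
        simp only [fW]; fun_prop
      exact this.aestronglyMeasurable)
    (Eventually.of_forall fun x => by
      apply LipschitzWith.lipschitzOnWith
      apply LipschitzWith.of_dist_le_mul
      intro s t
      rw [Real.dist_eq]
      refine (hL _ _).trans ?_
      have : x - (c + s • e) - (x - (c + t • e)) = (t - s) • e := by
        rw [sub_smul]; abel
      rw [this, norm_smul, Real.coe_nnabs, abs_of_nonneg (by positivity), Real.dist_eq, Real.norm_eq_abs, abs_sub_comm]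
      apply le_of_eq; ring)
    (integrableOn_cont hb continuous_const)
    (by
      have hne : ∀ᵐ x ∂(volume.restrict Ω), x ≠ c := by
        apply ae_restrict_of_ae
        rw [ae_iff]; simp
      filter_upwards [hne] with x hx
      have hx' : x - c ≠ 0 := sub_ne_zero.2 hx
      have h1 : HasDerivAt (fun t : ℝ => x - (c + t • e)) (-e) 0 := by
        have := (((hasDerivAt_id (0:ℝ)).smul_const e).const_add c).const_sub x
        simpa using this
      have h2 := hΓ_fderiv κ (x := x - (c + (0:ℝ) • e)) (by simpa using hx')
      have h3 := h2.comp_hasDerivAt (0:ℝ) h1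
      refine h3.congr_deriv ?_
      simp [fW, inner_sub_left]
      ring)
  have hmin : IsLocalMin (fun t : ℝ => ∫ x in Ω, ψ (x - (c + t • e))) 0 := by
    refine Eventually.of_forall fun t => ?_
    have := hc (c + t • e)
    simpa [hΦ] using this
  have := hmin.hasDerivAt_eq_zero hder.2
  rw [integral_const_mul] at this
  have hk2 : - κ ^ 2 ≠ 0 := by simp [hκ.ne']
  exact (mul_eq_zero.1 this).resolve_left hk2

lemma ball_shift (c : E2) (R : ℝ) (f : E2 → ℝ) :
    ∫ x in Metric.ball c R, f (x - c) = ∫ x in Metric.ball (0:E2) R, f x := by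
  have h := (measurePreserving_sub_right (volume : Measure E2) c).setIntegral_preimage_emb
    (Homeomorph.subRight c).measurableEmbedding f (Metric.ball (0:E2) R)
  rw [← h]
  congr 2
  ext x
  simp [dist_eq_norm]

theorem weinberger_upper {Ω : Set E2} (ho : IsOpen Ω) (hb : Bornology.IsBounded Ω) (hn : Ω.Nonempty) :
    (volume Ω).toReal * nEig1 Ω ≤ π * wk ^ 2 := by
  have hA := vol_pos ho hb hn
  set A := (volume Ω).toReal with hAdef
  have hk := wk_pos
  have hpp := pi_pos
  set R := √(A / π) with hRdef
  have hR : 0 < R := Real.sqrt_pos.2 (by positivity)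
  have hR2 : R ^ 2 = A / π := Real.sq_sqrt (by positivity)
  have hvol : (volume Ω).toReal = A := rfl
  set κ := wk / R with hκdef
  have hκ : 0 < κ := by positivity
  have hκR : κ * R = wk := by rw [hκdef]; field_simp
  obtain ⟨c, hc⟩ := exists_center ho hb hn hκ
  obtain ⟨C, hC0, hC1⟩ := fW_lip hκ.le
  have hHc := hH_cont
  have hNc := hN_cont
  have tr : LipschitzWith 1 (fun x : E2 => x - c) := (IsometryEquiv.subRight c).isometry.lipschitz
  have hL : ∀ e, LipschitzWith C (fW κ e) → LipschitzWith C (fun x => fW κ e (x - c)) := by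
    intro e he
    have := he.comp tr
    rw [mul_one] at this
    exact this
  have b0 := nEig1_lip ho hb hn (hL _ hC0) (hc _)
  have b1 := nEig1_lip ho hb hn (hL _ hC1) (hc _)
  have hcf : ∀ e : E2, Continuous fun x => fW κ e (x - c) ^ 2 := by
    intro e; simp only [fW]; fun_prop
  have i0 : IntegrableOn (fun x => fW κ !₂[1, 0] (x - c) ^ 2) Ω := integrableOn_cont hb (hcf _)
  have i1 : IntegrableOn (fun x => fW κ !₂[0, 1] (x - c) ^ 2) Ω := integrableOn_cont hb (hcf _)
  set P : E2 → ℝ := fun x => (κ * ‖x‖ * hH (κ * ‖x‖)) ^ 2 with hP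
  set N : E2 → ℝ := fun x => hN (κ * ‖x‖) with hNdef
  have hPc : Continuous P := by fun_prop
  have hNc' : Continuous N := by fun_prop
  have hsum : ∀ y : E2, fW κ !₂[1, 0] y ^ 2 + fW κ !₂[0, 1] y ^ 2 = κ⁻¹ ^ 2 * P y := by
    intro y
    have := norm_sq_E2 y
    simp only [fW, hP, inner_E2]
    simp
    field_simp
    rw [this]; ring
  have hfd : ∀ e x, fderiv ℝ (fun x => fW κ e (x - c)) x = fderiv ℝ (fW κ e) (x - c) := by
    intro e x; rw [fderiv_comp_sub]
  have hfi : ∀ e, LipschitzWith C (fW κ e) → IntegrableOn (fun x => ‖fderiv ℝ (fun x => fW κ e (x - c)) x‖ ^ 2) Ω := by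
    intro e he
    refine IntegrableOn.of_bound (C := (C:ℝ) ^ 2) hb.measure_lt_top ?_ ?_
    · exact ((measurable_fderiv ℝ (fun x => fW κ e (x - c))).norm.pow_const 2).aestronglyMeasurable
    · refine Eventually.of_forall fun x => ?_
      have := norm_fderiv_le_of_lipschitz ℝ (hL e he) (x₀ := x)
      rw [norm_pow, norm_norm]
      gcongr
  have hgrad : (∫ x in Ω, ‖fderiv ℝ (fun x => fW κ !₂[1, 0] (x - c)) x‖ ^ 2) +
      ∫ x in Ω, ‖fderiv ℝ (fun x => fW κ !₂[0, 1] (x - c)) x‖ ^ 2 = ∫ x in Ω, N (x - c) := by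
    rw [← integral_add (hfi _ hC0) (hfi _ hC1)]
    apply integral_congr_ae
    have hne : ∀ᵐ x ∂(volume.restrict Ω), x ≠ c := by
      apply ae_restrict_of_ae
      rw [ae_iff]; simp
    filter_upwards [hne] with x hx
    have hx' : x - c ≠ 0 := sub_ne_zero.2 hx
    rw [hfd, hfd, (fW_fderiv κ _ hx').fderiv, (fW_fderiv κ _ hx').fderiv, innerSL_apply_norm, innerSL_apply_norm]
    exact gW_sum κ hx'
  have hL2 : (∫ x in Ω, fW κ !₂[1, 0] (x - c) ^ 2) + ∫ x in Ω, fW κ !₂[0, 1] (x - c) ^ 2 =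
      κ⁻¹ ^ 2 * ∫ x in Ω, P (x - c) := by
    rw [← integral_add i0 i1, ← integral_const_mul]
    congr 1; ext x; exact hsum _
  have hvv : (volume Ω).toReal = (volume (Metric.ball c R)).toReal := by
    rw [vol_ball_E2 _ hR.le, hR2, hvol]; field_simp
  have inB : ∀ x, x ∈ Metric.ball c R → κ * ‖x - c‖ ≤ wk := by
    intro x hx
    rw [mem_ball_iff_norm] at hx
    rw [← hκR]; gcongr
  have outB : ∀ x, x ∉ Metric.ball c R → wk ≤ κ * ‖x - c‖ := by
    intro x hx
    rw [mem_ball_iff_norm] at hx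
    push Not at hx
    rw [← hκR]; gcongr
  have c1 : ∫ x in Ω, N (x - c) ≤ ∫ x in Metric.ball c R, N (x - c) :=
    compare_ball ho hb hvv (by fun_prop) (m := wC wk ^ 2) (fun x hx => hN_ge (by positivity) (inB x hx))
      (fun x hx => hN_le (outB x hx))
  have c2 : ∫ x in Metric.ball c R, P (x - c) ≤ ∫ x in Ω, P (x - c) := by
    have := compare_ball ho hb hvv (f := fun x => - P (x - c)) (by fun_prop) (m := - wg wk ^ 2)
      (fun x hx => by
        have h1 := hG_nonneg (s := κ * ‖x - c‖) (by positivity)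
        have h2 := hG_le (s := κ * ‖x - c‖) (by positivity)
        simp only [hP]
        nlinarith)
      (fun x hx => by
        have h1 := hG_ge (outB x hx)
        simp only [hP, h1]; exact le_rfl)
    rw [integral_neg, integral_neg] at this
    linarith
  have e1 : ∫ x in Metric.ball c R, N (x - c) = ∫ x in Metric.ball c R, P (x - c) := by
    rw [ball_shift, ball_shift, radial_disc (φ := fun r => hN (κ * r)) (by fun_prop) hR.le,
      radial_disc (φ := fun r => (κ * r * hH (κ * r)) ^ 2) (by fun_prop) hR.le, hN_int hR]
  have hPpos : 0 < ∫ x in Metric.ball c R, P (x - c) := by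
    rw [e1.symm]
    have := setIntegral_mono_on (μ := volume) (s := Metric.ball c R) (f := fun _ => wC wk ^ 2)
        (g := fun x => N (x - c)) (integrableOn_cont Metric.isBounded_ball continuous_const)
        (integrableOn_cont Metric.isBounded_ball (by fun_prop)) Metric.isOpen_ball.measurableSet
        (fun x hx => hN_ge (by positivity) (inB x hx))
    rw [setIntegral_const] at this
    simp only [Measure.real, ← hvv, smul_eq_mul] at this
    have h2 := wC_pos hk.le le_rfl
    refine lt_of_lt_of_le ?_ this
    positivity
  set I := ∫ x in Ω, P (x - c) with hI
  have hIpos : 0 < I := hPpos.trans_le c2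
  have hfin : nEig1 Ω * (κ⁻¹ ^ 2 * I) ≤ I := by
    rw [← hL2, mul_add]
    linarith
  have h3 : nEig1 Ω ≤ κ ^ 2 := by
    have : nEig1 Ω * κ⁻¹ ^ 2 ≤ 1 := by
      by_contra hcon
      push Not at hcon
      nlinarith
    rw [inv_pow, ← div_eq_mul_inv, div_le_one (by positivity)] at this
    exact this
  calc A * nEig1 Ω ≤ A * κ ^ 2 := by gcongr
    _ = π * wk ^ 2 := by rw [hκdef, div_pow, hR2]; field_simp

lemma circle_wirtinger {f f' : ℝ → ℝ} (hf : ∀ x, HasDerivAt f (f' x) x) (hf' : Continuous f')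
    (hper : ∀ x, f (x + 2 * π) = f x) {m : ℝ} (hm : ∫ x in (-π)..π, f x = 2 * π * m) :
    ∫ x in (-π)..π, (f x - m) ^ 2 ≤ ∫ x in (-π)..π, f' x ^ 2 := by
  have hpp := pi_pos
  have hfc : Continuous f := continuous_iff_continuousAt.2 fun x => (hf x).continuousAt
  have hper' : ∀ x, f' (x + 2 * π) = f' x := by
    intro x
    have h1 : HasDerivAt (fun y => f (y + 2 * π)) (f' (x + 2 * π)) x := by
      simpa using (hf (x + 2 * π)).comp_add_const x (2 * π)
    have h2 : (fun y => f (y + 2 * π)) = f := funext hper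
    rw [h2] at h1
    exact h1.unique (hf x)
  obtain ⟨t, -, ht⟩ : ∃ t ∈ Icc 0 π, f (t + π) - f t = 0 := by
    have hc : Continuous fun t => f (t + π) - f t := by fun_prop
    have e : f (π + π) - f π = -(f (0 + π) - f 0) := by
      have := hper 0
      rw [show π + π = 0 + 2 * π by ring, this]; simp
    rcases le_total 0 (f (0 + π) - f 0) with h | h
    · exact intermediate_value_Icc' hpp.le hc.continuousOn ⟨by simp only [e]; linarith, h⟩
    · exact intermediate_value_Icc hpp.le hc.continuousOn ⟨h, by simp only [e]; linarith⟩
  set c := f t with hc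
  have hg : ∀ x, HasDerivAt (fun x => f x - c) (f' x) x := fun x => (hf x).sub_const c
  have w1 := wirtinger_both (a := t) (b := t + π) (by linarith) (fun x _ => hg x) hf'.continuousOn
    (by simp [hc]) ht
  have w2 := wirtinger_both (a := t + π) (b := t + 2 * π) (by linarith) (fun x _ => hg x) hf'.continuousOn
    ht (by rw [hper]; simp [hc])
  have s1 : (π / (t + π - t)) ^ 2 = 1 := by
    rw [show t + π - t = π by ring, div_self hpp.ne']; norm_num
  have s2 : (π / (t + 2 * π - (t + π))) ^ 2 = 1 := by
    rw [show t + 2 * π - (t + π) = π by ring, div_self hpp.ne']; norm_num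
  rw [s1, one_mul] at w1
  rw [s2, one_mul] at w2
  have c1 : Continuous fun x => (f x - c) ^ 2 := by fun_prop
  have c2 : Continuous fun x => f' x ^ 2 := by fun_prop
  have a1 := intervalIntegral.integral_add_adjacent_intervals (c1.intervalIntegrable t (t + π) (μ := volume))
    (c1.intervalIntegrable (t + π) (t + 2 * π))
  have a2 := intervalIntegral.integral_add_adjacent_intervals (c2.intervalIntegrable t (t + π) (μ := volume))
    (c2.intervalIntegrable (t + π) (t + 2 * π))
  have p1 : Function.Periodic (fun x => (f x - c) ^ 2) (2 * π) := fun x => by simp only [hper]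
  have p2 : Function.Periodic (fun x => f' x ^ 2) (2 * π) := fun x => by simp only [hper']
  have b1 := p1.intervalIntegral_add_eq t (-π)
  have b2 := p2.intervalIntegral_add_eq t (-π)
  rw [show -π + 2 * π = π by ring] at b1 b2
  have key : ∫ x in (-π)..π, (f x - c) ^ 2 ≤ ∫ x in (-π)..π, f' x ^ 2 := by
    rw [← b1, ← b2, ← a1, ← a2]; linarith
  refine le_trans ?_ key
  have ii : ∀ d : ℝ, ∫ x in (-π)..π, (f x - d) ^ 2 = (∫ x in (-π)..π, f x ^ 2) - 2 * d * (2 * π * m) + 2 * π * d ^ 2 := by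
    intro d
    have e : ∀ x, (f x - d) ^ 2 = f x ^ 2 - 2 * d * f x + d ^ 2 := fun x => by ring
    simp_rw [e]
    rw [intervalIntegral.integral_add, intervalIntegral.integral_sub, intervalIntegral.integral_const_mul, hm,
      intervalIntegral.integral_const, smul_eq_mul]
    · ring
    all_goals exact Continuous.intervalIntegrable (by fun_prop) _ _
  rw [ii m, ii c]
  nlinarith [mul_nonneg hpp.le (sq_nonneg (m - c))]

def Qa (r : ℝ) : ℝ := wg1 (wk * r) / wC (wk * r)

lemma Qa_cont : ContinuousAt Qa 0 := by
  have h1 := wg1_cont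
  have h2 := wC_cont
  apply ContinuousAt.div
  · exact (by fun_prop : Continuous fun r => wg1 (wk * r)).continuousAt
  · exact (by fun_prop : Continuous fun r => wC (wk * r)).continuousAt
  · rw [mul_zero]; exact wC_zero.ne'

lemma wCk_pos {r : ℝ} (h0 : 0 ≤ r) (h1 : r ≤ 1) : 0 < wC (wk * r) := by
  have := wk_pos
  exact wC_pos (by positivity) (by nlinarith)

lemma radial_riccati {η : ℝ} (h0 : 0 < η) (h1 : η < 1) {f f' : ℝ → ℝ} (hf : ∀ x, HasDerivAt f (f' x) x)
    (hf' : Continuous f') :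
    wk ^ 2 * ∫ r in η..1, r * f r ^ 2 ≤
      (∫ r in η..1, (r * f' r ^ 2 + f r ^ 2 / r)) + f η ^ 2 * Qa η := by
  have hfc : Continuous f := continuous_iff_continuousAt.2 fun x => (hf x).continuousAt
  have hC := wC_cont
  have hC1 := wC1_cont
  have hlin : ∀ r, HasDerivAt (fun r => wk * r) wk r := fun r => by simpa using (hasDerivAt_id r).const_mul wk
  have hne : ∀ r ∈ Icc η 1, wC (wk * r) ≠ 0 := fun r hr => (wCk_pos (h0.le.trans hr.1) hr.2).ne'
  have hr0 : ∀ r ∈ Icc η 1, r ≠ 0 := fun r hr => (h0.trans_le hr.1).ne'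
  have hQ : ∀ r ∈ Icc η 1, HasDerivAt Qa (1 / r - wk ^ 2 * r - Qa r ^ 2 / r) r := by
    intro r hr
    have a1 : HasDerivAt (fun r => wg1 (wk * r)) _ r := (wg1_deriv (wk * r)).comp r (hlin r)
    have a2 : HasDerivAt (fun r => wC (wk * r)) _ r := (wC_deriv (wk * r)).comp r (hlin r)
    refine (a1.div a2 (hne r hr)).congr_deriv ?_
    have h2 := hne r hr
    have h3 := hr0 r hr
    simp only [Qa, wg1]
    field_simp
    ring
  have hQc : ContinuousOn Qa (Icc η 1) := fun r hr => (hQ r hr).continuousAt.continuousWithinAt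
  have ric := riccati h1.le (fun x _ => hf x) hf'.continuousOn hQ
    (by fun_prop (disch := assumption)) continuousOn_id (fun r hr => h0.trans_le hr.1)
  have hQ1 : Qa 1 = 0 := by simp [Qa, wk_zero]
  rw [hQ1] at ric
  have e1 : ∫ r in η..1, ((1 / r - wk ^ 2 * r - Qa r ^ 2 / r) + Qa r ^ 2 / id r) * f r ^ 2 =
      (∫ r in η..1, f r ^ 2 / r) - wk ^ 2 * ∫ r in η..1, r * f r ^ 2 := by
    rw [← intervalIntegral.integral_const_mul, ← intervalIntegral.integral_sub]
    · apply intervalIntegral.integral_congr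
      intro r hr
      simp only [id]
      ring
    · exact ContinuousOn.intervalIntegrable_of_Icc h1.le (by fun_prop (disch := assumption))
    · exact Continuous.intervalIntegrable (by fun_prop) _ _
  rw [e1] at ric
  rw [intervalIntegral.integral_add]
  · simp only [id] at ric
    linarith
  · exact Continuous.intervalIntegrable (by fun_prop) _ _
  · exact ContinuousOn.intervalIntegrable_of_Icc h1.le (by fun_prop (disch := assumption))

lemma le_at_zero {p q : ℝ → ℝ} (hp : ContinuousAt p 0) (hq : ContinuousAt q 0)
    (h : ∀ η, 0 < η → η < 1 → p η ≤ q η) : p 0 ≤ q 0 := by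
  have t : Tendsto (fun n : ℕ => 1 / ((n:ℝ) + 2)) atTop (nhds 0) := by
    have := (tendsto_one_div_add_atTop_nhds_zero_nat (𝕜 := ℝ)).comp (tendsto_add_atTop_nat 1)
    refine this.congr fun n => ?_
    simp only [Function.comp]; push_cast; ring_nf
  refine le_of_tendsto_of_tendsto' (b := atTop) (hp.tendsto.comp t) (hq.tendsto.comp t) fun n => ?_
  have hn : (0:ℝ) ≤ n := n.cast_nonneg
  exact h _ (by positivity) (by rw [div_lt_one (by positivity)]; linarith)

lemma cont_lower {φ : ℝ → ℝ} (h : Continuous φ) : Continuous fun η => ∫ r in η..1, φ r := by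
  have := (intervalIntegral.continuous_primitive (μ := volume) (f := φ) (fun a b => h.intervalIntegrable a b) 1).neg
  refine this.congr fun η => ?_
  rw [intervalIntegral.integral_symm]
  rfl

lemma zero_mode {a a' : ℝ → ℝ} (ha : ∀ x, HasDerivAt a (a' x) x) (ha' : Continuous a')
    (hm : ∫ r in (0:ℝ)..1, r * a r = 0) :
    wk ^ 2 * ∫ r in (0:ℝ)..1, r * a r ^ 2 ≤ ∫ r in (0:ℝ)..1, r * a' r ^ 2 := by
  have hk := wk_pos
  have hac : Continuous a := continuous_iff_continuousAt.2 fun x => (ha x).continuousAt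
  have hC := wC_cont
  have hC1 := wC1_cont
  set F : ℝ → ℝ := fun r => ∫ t in (0:ℝ)..r, t * a t with hF
  have hra : Continuous fun r => r * a r := by fun_prop
  have hFd : ∀ r, HasDerivAt F (r * a r) r := fun r =>
    intervalIntegral.integral_hasDerivAt_right (hra.intervalIntegrable _ _)
      (hra.stronglyMeasurableAtFilter _ _) hra.continuousAt
  have hFc : Continuous F := continuous_iff_continuousAt.2 fun x => (hFd x).continuousAt
  have hF0 : F 0 = 0 := by simp [hF]
  have hF1 : F 1 = 0 := hm
  -- slope of F
  have hFs : ContinuousAt (dslope F 0) 0 := continuousAt_dslope_same.2 (hFd 0).differentiableAt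
  have hFs0 : dslope F 0 0 = 0 := by rw [dslope_same, (hFd 0).deriv]; simp
  set D : ℝ → ℝ := fun r => (2 * wC (wk * r) + wk * r * wC1 (wk * r)) / wC (wk * r) with hD
  have hDc : ContinuousAt D 0 := by
    apply ContinuousAt.div
    · exact (by fun_prop : Continuous fun r => 2 * wC (wk * r) + wk * r * wC1 (wk * r)).continuousAt
    · exact (by fun_prop : Continuous fun r => wC (wk * r)).continuousAt
    · rw [mul_zero]; exact wC_zero.ne'
  have hlin : ∀ r, HasDerivAt (fun r => wk * r) wk r := fun r => by simpa using (hasDerivAt_id r).const_mul wk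
  have main : ∀ η, 0 < η → η < 1 → (∫ r in η..1, r * a r ^ 2) ≤
      - (F η * a η) + (1/2) * ((∫ r in η..1, r * a r ^ 2) + dslope F 0 η ^ 2 * D η)
        + (1 / (2 * wk ^ 2)) * ∫ r in η..1, r * a' r ^ 2 := by
    intro η h0 h1
    have hne : ∀ r ∈ Icc η 1, wC (wk * r) ≠ 0 := fun r hr => (wCk_pos (h0.le.trans hr.1) hr.2).ne'
    have hr0 : ∀ r ∈ Icc η 1, r ≠ 0 := fun r hr => (h0.trans_le hr.1).ne'
    set Q : ℝ → ℝ := fun r => (2 * wC (wk * r) + wk * r * wC1 (wk * r)) / (r ^ 2 * wC (wk * r)) with hQdef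
    have hQ : ∀ r ∈ Icc η 1, HasDerivAt Q (- wk ^ 2 / r - Q r ^ 2 / r⁻¹) r := by
      intro r hr
      have h2 := hne r hr
      have h3 := hr0 r hr
      have a2 : HasDerivAt (fun r => wC (wk * r)) _ r := (wC_deriv (wk * r)).comp r (hlin r)
      have a3 : HasDerivAt (fun r => wC1 (wk * r)) _ r := (wC1_deriv (wk * r)).comp r (hlin r)
      have a4 := ((a2.const_mul 2).add ((hlin r).mul a3)).div ((hasDerivAt_pow 2 r).mul a2)
        (mul_ne_zero (pow_ne_zero 2 h3) h2)
      refine a4.congr_deriv ?_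
      have ode := wC_ode (wk * r)
      have e2 : wC2 (wk * r) = - (3 * wC1 (wk * r) + wk * r * wC (wk * r)) / (wk * r) := by
        field_simp
        linarith
      simp only [hQdef, Pi.mul_apply, Pi.add_apply]
      rw [e2]
      field_simp
      ring
    have hQc : ContinuousOn Q (Icc η 1) := fun r hr => (hQ r hr).continuousAt.continuousWithinAt
    have hi0 : ∀ r ∈ Icc η 1, r⁻¹ ≠ 0 := fun r hr => inv_ne_zero (hr0 r hr)
    have hci : ContinuousOn (fun r : ℝ => r⁻¹) (Icc η 1) := by fun_prop (disch := assumption)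
    have ric := riccati h1.le (fun x _ => hFd x) hra.continuousOn hQ
      (by fun_prop (disch := assumption)) hci (fun r hr => inv_pos.2 (h0.trans_le hr.1))
    rw [hF1] at ric
    have e0 : ∫ r in η..1, r⁻¹ * (r * a r) ^ 2 = ∫ r in η..1, r * a r ^ 2 := by
      apply intervalIntegral.integral_congr
      intro r hr
      rw [uIcc_of_le h1.le] at hr
      have := hr0 r hr
      simp only
      field_simp
    have e1 : ∫ r in η..1, ((- wk ^ 2 / r - Q r ^ 2 / r⁻¹) + Q r ^ 2 / r⁻¹) * F r ^ 2 =
        - (wk ^ 2 * ∫ r in η..1, F r ^ 2 / r) := by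
      rw [← intervalIntegral.integral_const_mul, ← intervalIntegral.integral_neg]
      apply intervalIntegral.integral_congr
      intro r hr
      simp only
      ring
    have e2 : F η ^ 2 * Q η = dslope F 0 η ^ 2 * D η := by
      rw [dslope_of_ne _ h0.ne', slope_def_field, hF0]
      simp only [hQdef, hD, sub_zero]
      have := hne η ⟨le_rfl, h1.le⟩
      have hη : η ≠ 0 := h0.ne'
      field_simp
    rw [e0, e1, e2] at ric
    -- integration by parts
    have ibp : ∫ r in η..1, (r * a r * a r + F r * a' r) = F 1 * a 1 - F η * a η := by
      refine intervalIntegral.integral_eq_sub_of_hasDerivAt (f := fun r => F r * a r)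
        (f' := fun r => r * a r * a r + F r * a' r) ?_ ?_
      · intro r _
        exact (hFd r).mul (ha r)
      · exact Continuous.intervalIntegrable (by fun_prop) _ _
    rw [intervalIntegral.integral_add (Continuous.intervalIntegrable (by fun_prop) _ _)
      (Continuous.intervalIntegrable (by fun_prop) _ _), hF1] at ibp
    have e3 : ∫ r in η..1, r * a r * a r = ∫ r in η..1, r * a r ^ 2 := by
      congr 1; ext r; ring
    rw [e3] at ibp
    have amgm : - ∫ r in η..1, F r * a' r ≤
        (1/2) * wk ^ 2 * (∫ r in η..1, F r ^ 2 / r) + (1 / (2 * wk ^ 2)) * ∫ r in η..1, r * a' r ^ 2 := by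
      rw [← intervalIntegral.integral_const_mul, ← intervalIntegral.integral_const_mul,
        ← intervalIntegral.integral_neg, ← intervalIntegral.integral_add]
      · apply intervalIntegral.integral_mono_on h1.le
        · exact Continuous.intervalIntegrable (by fun_prop) _ _
        · exact ContinuousOn.intervalIntegrable_of_Icc h1.le (by fun_prop (disch := assumption))
        · intro r hr
          have hr' : 0 < r := h0.trans_le hr.1
          have : 1 / 2 * wk ^ 2 * (F r ^ 2 / r) + 1 / (2 * wk ^ 2) * (r * a' r ^ 2) - -(F r * a' r) =
            (1 / (2 * r)) * (wk * F r + r * a' r / wk) ^ 2 := by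
            field_simp; ring
          have h5 : 0 ≤ (1 / (2 * r)) * (wk * F r + r * a' r / wk) ^ 2 := by positivity
          linarith
      · exact ContinuousOn.intervalIntegrable_of_Icc h1.le (by fun_prop (disch := assumption))
      · exact Continuous.intervalIntegrable (by fun_prop) _ _
    nlinarith
  have lim := le_at_zero (cont_lower (by fun_prop : Continuous fun r => r * a r ^ 2)).continuousAt
    (((hFc.mul hac).neg.continuousAt.add (continuousAt_const.mul
      ((cont_lower (by fun_prop : Continuous fun r => r * a r ^ 2)).continuousAt.add ((hFs.pow 2).mul hDc)))).add
      (continuousAt_const.mul (cont_lower (by fun_prop : Continuous fun r => r * a' r ^ 2)).continuousAt)) main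
  simp only [Pi.neg_apply, Pi.mul_apply, Pi.add_apply, Pi.pow_apply, hF0, hFs0] at lim
  have h6 : (1/2) * (∫ r in (0:ℝ)..1, r * a r ^ 2) ≤ 1 / (2 * wk ^ 2) * ∫ r in (0:ℝ)..1, r * a' r ^ 2 := by
    simp at lim ⊢
    linarith
  have h7 := mul_le_mul_of_nonneg_left h6 (by positivity : 0 ≤ 2 * wk ^ 2)
  have h8 : 2 * wk ^ 2 * (1 / (2 * wk ^ 2) * ∫ r in (0:ℝ)..1, r * a' r ^ 2) = ∫ r in (0:ℝ)..1, r * a' r ^ 2 := by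
    field_simp
  rw [h8] at h7
  linarith

lemma cont_param {φ : ℝ → ℝ → ℝ} (h : Continuous (Function.uncurry φ)) (a b : ℝ) :
    Continuous fun r => ∫ θ in a..b, φ r θ :=
  intervalIntegral.continuous_parametric_intervalIntegral_of_continuous' h a b

lemma cont_swap {φ : ℝ → ℝ → ℝ} (h : Continuous (Function.uncurry φ)) (a b c d : ℝ) :
    ∫ r in a..b, ∫ θ in c..d, φ r θ = ∫ θ in c..d, ∫ r in a..b, φ r θ := by
  apply MeasureTheory.intervalIntegral_intervalIntegral_swap
  apply (h.continuousOn.integrableOn_compact (isCompact_uIcc.prod isCompact_uIcc) :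
      IntegrableOn _ (uIcc a b ×ˢ uIcc c d) _).mono_set
  exact prod_mono uIoc_subset_uIcc uIoc_subset_uIcc

lemma deriv_param {U Ur : ℝ → ℝ → ℝ} (hU : Continuous (Function.uncurry U)) (hUr : Continuous (Function.uncurry Ur))
    (hd : ∀ r θ, HasDerivAt (fun r => U r θ) (Ur r θ) r) (a b r : ℝ) :
    HasDerivAt (fun r => ∫ θ in a..b, U r θ) (∫ θ in a..b, Ur r θ) r := by
  obtain ⟨M, hM⟩ := ((isCompact_closedBall r 1).prod (isCompact_uIcc (a := a) (b := b))).exists_bound_of_continuousOn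
    hUr.continuousOn
  have c1 : ∀ x, Continuous fun θ => U x θ := fun x => hU.comp (by fun_prop : Continuous fun θ : ℝ => (x, θ))
  have c2 : ∀ x, Continuous fun θ => Ur x θ := fun x => hUr.comp (by fun_prop : Continuous fun θ : ℝ => (x, θ))
  have := intervalIntegral.hasDerivAt_integral_of_dominated_loc_of_deriv_le (μ := volume) (a := a) (b := b)
    (F := U) (F' := Ur) (x₀ := r) (s := Metric.ball r 1) (bound := fun _ => M) (Metric.ball_mem_nhds r one_pos)
    (Eventually.of_forall fun x => (c1 x).aestronglyMeasurable)
    ((c1 r).intervalIntegrable _ _) ((c2 r).aestronglyMeasurable)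
    (Eventually.of_forall fun θ hθ x hx =>
      hM (x, θ) ⟨Metric.ball_subset_closedBall hx, uIoc_subset_uIcc hθ⟩)
    (by simp)
    (Eventually.of_forall fun θ _ x _ => hd x θ)
  exact this.2

lemma disc_abstract {U Ur T : ℝ → ℝ → ℝ} (hU : Continuous (Function.uncurry U))
    (hUr : Continuous (Function.uncurry Ur)) (hT : Continuous (Function.uncurry T))
    (hd : ∀ r θ, HasDerivAt (fun r => U r θ) (Ur r θ) r)
    (hdθ : ∀ r θ, HasDerivAt (fun θ => U r θ) (r * T r θ) θ)
    (hper : ∀ r θ, U r (θ + 2 * π) = U r θ) {c : ℝ} (h0 : ∀ θ, U 0 θ = c)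
    (hm : ∫ r in (0:ℝ)..1, r * ∫ θ in (-π)..π, U r θ = 0) :
    wk ^ 2 * (∫ r in (0:ℝ)..1, r * ∫ θ in (-π)..π, U r θ ^ 2) ≤
      ∫ r in (0:ℝ)..1, r * ∫ θ in (-π)..π, (Ur r θ ^ 2 + T r θ ^ 2) := by
  have hpp := pi_pos
  have c1 : ∀ x, Continuous fun θ => U x θ := fun x => hU.comp (by fun_prop : Continuous fun θ : ℝ => (x, θ))
  have c2 : ∀ x, Continuous fun θ => Ur x θ := fun x => hUr.comp (by fun_prop : Continuous fun θ : ℝ => (x, θ))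
  have c3 : ∀ x, Continuous fun θ => T x θ := fun x => hT.comp (by fun_prop : Continuous fun θ : ℝ => (x, θ))
  have d2 : ∀ x, Continuous fun r => Ur r x := fun x => hUr.comp (by fun_prop : Continuous fun θ : ℝ => (θ, x))
  set a : ℝ → ℝ := fun r => (2 * π)⁻¹ * ∫ θ in (-π)..π, U r θ with ha
  set a' : ℝ → ℝ := fun r => (2 * π)⁻¹ * ∫ θ in (-π)..π, Ur r θ with ha'
  have had : ∀ r, HasDerivAt a (a' r) r := fun r => (deriv_param hU hUr hd _ _ r).const_mul _
  have hac : Continuous a := continuous_iff_continuousAt.2 fun x => (had x).continuousAt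
  have hac' : Continuous a' := continuous_const.mul (cont_param hUr _ _)
  have haI : ∀ r, ∫ θ in (-π)..π, U r θ = 2 * π * a r := fun r => by simp only [ha]; field_simp
  have haI' : ∀ r, ∫ θ in (-π)..π, Ur r θ = 2 * π * a' r := fun r => by simp only [ha']; field_simp
  -- zero mode
  have hz := zero_mode had hac' (by
    simp_rw [haI] at hm
    have e : ∫ r in (0:ℝ)..1, r * (2 * π * a r) = 2 * π * ∫ r in (0:ℝ)..1, r * a r := by
      rw [← intervalIntegral.integral_const_mul]; congr 1; ext r; ring
    rw [e] at hm
    rcases mul_eq_zero.1 hm with h | h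
    · linarith
    · exact h)
  -- expansions
  have ex : ∀ (f : ℝ → ℝ) (m : ℝ), Continuous f → ∫ θ in (-π)..π, f θ = 2 * π * m →
      ∫ θ in (-π)..π, (f θ - m) ^ 2 = (∫ θ in (-π)..π, f θ ^ 2) - 2 * π * m ^ 2 := by
    intro f m hf hfm
    have e : ∀ x, (f x - m) ^ 2 = f x ^ 2 - 2 * m * f x + m ^ 2 := fun x => by ring
    simp_rw [e]
    rw [intervalIntegral.integral_add, intervalIntegral.integral_sub, intervalIntegral.integral_const_mul, hfm,
      intervalIntegral.integral_const, smul_eq_mul]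
    · ring
    all_goals exact Continuous.intervalIntegrable (by fun_prop) _ _
  have hUc2 : Continuous fun p : ℝ × ℝ => U p.1 p.2 := hU
  have hUrc2 : Continuous fun p : ℝ × ℝ => Ur p.1 p.2 := hUr
  have hTc2 : Continuous fun p : ℝ × ℝ => T p.1 p.2 := hT
  set I2 : ℝ → ℝ := fun r => ∫ θ in (-π)..π, U r θ ^ 2 with hI2
  set G : ℝ → ℝ := fun r => ∫ θ in (-π)..π, (Ur r θ ^ 2 + T r θ ^ 2) with hG
  have hI2c : Continuous I2 := cont_param (φ := fun r θ => U r θ ^ 2) (by simp only [Function.uncurry_def]; fun_prop) _ _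
  have hGc : Continuous G := cont_param (φ := fun r θ => Ur r θ ^ 2 + T r θ ^ 2)
    (by simp only [Function.uncurry_def]; fun_prop) _ _
  set V : ℝ → ℝ := fun r => ∫ θ in (-π)..π, (U r θ - a r) ^ 2 with hV
  have hVc : Continuous V := cont_param (φ := fun r θ => (U r θ - a r) ^ 2)
    (by simp only [Function.uncurry_def]; fun_prop) _ _
  have main : ∀ η, 0 < η → η < 1 → wk ^ 2 * (∫ r in η..1, r * (I2 r - 2 * π * a r ^ 2)) ≤
      (∫ r in η..1, r * (G r - 2 * π * a' r ^ 2)) + V η * Qa η := by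
    intro η hη h1
    have hmx : ∀ r, max r η ≠ 0 := fun r => (lt_max_of_lt_right hη).ne'
    have hmx2 : ∀ r ∈ uIcc η 1, max r η = r := fun r hr => by
      rw [uIcc_of_le h1.le] at hr; exact max_eq_left hr.1
    set A : ℝ → ℝ → ℝ := fun r θ => r * (U r θ - a r) ^ 2 with hA
    set B : ℝ → ℝ → ℝ := fun r θ => r * (Ur r θ - a' r) ^ 2 + (U r θ - a r) ^ 2 / max r η with hB
    have hAc : Continuous (Function.uncurry A) := by simp only [hA, Function.uncurry_def]; fun_prop
    have hBc : Continuous (Function.uncurry B) := by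
      simp only [hB, Function.uncurry_def]
      apply Continuous.add (by fun_prop)
      exact Continuous.div (by fun_prop) (by fun_prop) fun p => hmx p.1
    have s1 : ∀ θ, wk ^ 2 * (∫ r in η..1, A r θ) ≤ (∫ r in η..1, B r θ) + (U η θ - a η) ^ 2 * Qa η := by
      intro θ
      have := radial_riccati hη h1 (f := fun r => U r θ - a r) (f' := fun r => Ur r θ - a' r)
        (fun r => (hd r θ).sub (had r)) ((d2 θ).sub hac')
      refine this.trans (le_of_eq ?_)
      congr 1
      apply intervalIntegral.integral_congr
      intro r hr
      simp only [hB, hmx2 r hr]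
    have cA : Continuous fun θ => ∫ r in η..1, A r θ :=
      cont_param (φ := fun θ r => A r θ) (hAc.comp continuous_swap) _ _
    have cB : Continuous fun θ => ∫ r in η..1, B r θ :=
      cont_param (φ := fun θ r => B r θ) (hBc.comp continuous_swap) _ _
    have cU := c1 η
    have s2 : ∫ θ in (-π)..π, wk ^ 2 * (∫ r in η..1, A r θ) ≤
        ∫ θ in (-π)..π, ((∫ r in η..1, B r θ) + (U η θ - a η) ^ 2 * Qa η) := by
      apply intervalIntegral.integral_mono_on (by linarith)
      · exact Continuous.intervalIntegrable (by fun_prop) _ _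
      · exact Continuous.intervalIntegrable (by fun_prop) _ _
      · intro θ _; exact s1 θ
    rw [intervalIntegral.integral_const_mul, intervalIntegral.integral_add (cB.intervalIntegrable _ _)
      (Continuous.intervalIntegrable (by fun_prop) _ _), intervalIntegral.integral_mul_const,
      ← cont_swap hAc, ← cont_swap hBc] at s2
    have s3 : ∀ r, ∫ θ in (-π)..π, A r θ = r * (I2 r - 2 * π * a r ^ 2) := by
      intro r
      simp only [hA, hI2]
      rw [intervalIntegral.integral_const_mul, ex _ _ (c1 r) (haI r)]
    have s4 : ∫ r in η..1, ∫ θ in (-π)..π, B r θ ≤ ∫ r in η..1, r * (G r - 2 * π * a' r ^ 2) := by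
      apply intervalIntegral.integral_mono_on h1.le
      · exact (cont_param hBc _ _).intervalIntegrable _ _
      · exact Continuous.intervalIntegrable (by fun_prop) _ _
      intro r hr
      have hr0 : 0 < r := hη.trans_le hr.1
      have w := circle_wirtinger (hdθ r) (continuous_const.mul (c3 r)) (hper r) (haI r)
      have q1 := c1 r
      have q2 := c2 r
      have q3 := c3 r
      simp only [hB, hG, max_eq_left hr.1]
      rw [intervalIntegral.integral_add (Continuous.intervalIntegrable (by fun_prop) _ _)
        (Continuous.intervalIntegrable (by fun_prop) _ _), intervalIntegral.integral_const_mul,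
        intervalIntegral.integral_div, ex _ _ (c2 r) (haI' r),
        intervalIntegral.integral_add (Continuous.intervalIntegrable (by fun_prop) _ _)
        (Continuous.intervalIntegrable (by fun_prop) _ _)]
      have w2 : ∫ θ in (-π)..π, (r * T r θ) ^ 2 = r ^ 2 * ∫ θ in (-π)..π, T r θ ^ 2 := by
        rw [← intervalIntegral.integral_const_mul]; congr 1; ext θ; ring
      rw [w2] at w
      have w3 : (∫ θ in (-π)..π, (U r θ - a r) ^ 2) / r ≤ r * ∫ θ in (-π)..π, T r θ ^ 2 := by
        rw [div_le_iff₀ hr0]; linarith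
      linarith
    simp_rw [s3] at s2
    linarith
  have hV0 : V 0 = 0 := by
    have : a 0 = c := by
      simp only [ha, h0, intervalIntegral.integral_const, smul_eq_mul]; field_simp; ring
    simp [hV, this, h0]
  have lim := le_at_zero
    (continuousAt_const.mul (cont_lower (by fun_prop : Continuous fun r => r * (I2 r - 2 * π * a r ^ 2))).continuousAt)
    ((cont_lower (by fun_prop : Continuous fun r => r * (G r - 2 * π * a' r ^ 2))).continuousAt.add
      (hVc.continuousAt.mul Qa_cont)) main
  simp only [Pi.add_apply, Pi.mul_apply, hV0, zero_mul, add_zero] at lim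
  have sp : ∀ (f g : ℝ → ℝ), Continuous f → Continuous g → ∫ r in (0:ℝ)..1, r * (f r - 2 * π * g r ^ 2) =
      (∫ r in (0:ℝ)..1, r * f r) - 2 * π * ∫ r in (0:ℝ)..1, r * g r ^ 2 := by
    intro f g hf hg
    rw [← intervalIntegral.integral_const_mul, ← intervalIntegral.integral_sub
      (Continuous.intervalIntegrable (by fun_prop) _ _) (Continuous.intervalIntegrable (by fun_prop) _ _)]
    congr 1; ext r; ring
  rw [sp _ _ hI2c hac, sp _ _ hGc hac'] at lim
  nlinarith

lemma hasDerivAt_dirv (θ : ℝ) : HasDerivAt dirv (perp (dirv θ)) θ := by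
  have e : dirv = fun θ => cos θ • (!₂[1, 0] : E2) + sin θ • (!₂[0, 1] : E2) := by
    funext t; apply E2_ext <;> simp [dirv]
  have h := ((hasDerivAt_cos θ).smul_const (!₂[1, 0] : E2)).add ((hasDerivAt_sin θ).smul_const (!₂[0, 1] : E2))
  rw [e]
  refine h.congr_deriv ?_
  apply E2_ext <;> simp [dirv, perp]

lemma continuous_perp : Continuous perp := by
  have : perp = fun e => (e 0) • (!₂[0, 1] : E2) + (e 1) • (!₂[-1, 0] : E2) := by
    funext t; apply E2_ext <;> simp [perp]
  rw [this]
  fun_prop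

lemma frame_le (L : E2 →L[ℝ] ℝ) {e : E2} (he : ‖e‖ = 1) : L e ^ 2 + L (perp e) ^ 2 ≤ ‖L‖ ^ 2 := by
  set s := L e ^ 2 + L (perp e) ^ 2 with hs
  have hs0 : 0 ≤ s := by positivity
  set w := L e • e + L (perp e) • perp e with hw
  have h1 : L w = s := by simp [hw, hs]; ring
  have he2 : e 0 ^ 2 + e 1 ^ 2 = 1 := by rw [← norm_sq_E2, he]; norm_num
  have h2 : ‖w‖ ^ 2 = s := by
    rw [norm_sq_E2]
    simp only [hw, hs, PiLp.add_apply, PiLp.smul_apply, smul_eq_mul, perp_zero', perp_one']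
    linear_combination (L e ^ 2 + L (perp e) ^ 2) * he2
  have h3 := L.le_opNorm w
  rw [h1, Real.norm_eq_abs, abs_of_nonneg hs0] at h3
  have h4 : s ^ 2 ≤ ‖L‖ ^ 2 * s := by rw [← h2, ← mul_pow, h2]; gcongr
  by_contra hc
  push Not at hc
  have : 0 < s := lt_of_le_of_lt (by positivity) hc
  nlinarith

lemma disc_lower : wk ^ 2 ≤ nEig1 unitDisc := by
  have hpp := pi_pos
  apply le_nEig1 Metric.isOpen_ball Metric.isBounded_ball ⟨0, Metric.mem_ball_self one_pos⟩
  intro u hu hu0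
  have huc : Continuous u := hu.continuous
  have hfc : Continuous (fderiv ℝ u) := hu.continuous_fderiv (by simp)
  have hud : Differentiable ℝ u := hu.differentiable (by simp)
  have hdc := continuous_dirv
  have hpc := continuous_perp
  have hdirper : ∀ θ, dirv (θ + 2 * π) = dirv θ := fun θ => by simp [dirv]
  rw [polar_disc huc zero_le_one] at hu0
  rw [polar_disc (by fun_prop) zero_le_one, polar_disc (by fun_prop) zero_le_one]
  have key := disc_abstract (U := fun r θ => u (r • dirv θ)) (Ur := fun r θ => fderiv ℝ u (r • dirv θ) (dirv θ))
    (T := fun r θ => fderiv ℝ u (r • dirv θ) (perp (dirv θ))) (c := u 0)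
    (by simp only [Function.uncurry_def]; fun_prop) (by simp only [Function.uncurry_def]; fun_prop)
    (by simp only [Function.uncurry_def]; fun_prop)
    (fun r θ => by
      have h1 : HasDerivAt (fun r : ℝ => r • dirv θ) (dirv θ) r := by
        simpa using (hasDerivAt_id r).smul_const (dirv θ)
      exact (hud (r • dirv θ)).hasFDerivAt.comp_hasDerivAt r h1)
    (fun r θ => by
      have h1 : HasDerivAt (fun θ : ℝ => r • dirv θ) (r • perp (dirv θ)) θ := (hasDerivAt_dirv θ).const_smul r
      have h2 := (hud (r • dirv θ)).hasFDerivAt.comp_hasDerivAt θ h1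
      refine h2.congr_deriv (by simp))
    (fun r θ => by simp only [hdirper]) (fun θ => by simp) hu0
  refine key.trans ?_
  have k1 : Continuous fun r : ℝ => ∫ θ in (-π)..π, ((fderiv ℝ u (r • dirv θ) (dirv θ)) ^ 2 +
      (fderiv ℝ u (r • dirv θ) (perp (dirv θ))) ^ 2) :=
    cont_param (φ := fun r θ => (fderiv ℝ u (r • dirv θ) (dirv θ)) ^ 2 +
      (fderiv ℝ u (r • dirv θ) (perp (dirv θ))) ^ 2) (by simp only [Function.uncurry_def]; fun_prop) _ _
  have k2 : Continuous fun r : ℝ => ∫ θ in (-π)..π, ‖fderiv ℝ u (r • dirv θ)‖ ^ 2 :=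
    cont_param (φ := fun r θ => ‖fderiv ℝ u (r • dirv θ)‖ ^ 2) (by simp only [Function.uncurry_def]; fun_prop) _ _
  apply intervalIntegral.integral_mono_on zero_le_one
  · exact (continuous_id.mul k1).intervalIntegrable _ _
  · exact (continuous_id.mul k2).intervalIntegrable _ _
  intro r hr
  apply mul_le_mul_of_nonneg_left _ hr.1
  apply intervalIntegral.integral_mono_on (by linarith)
  · exact Continuous.intervalIntegrable (by fun_prop) _ _
  · exact Continuous.intervalIntegrable (by fun_prop) _ _
  intro θ _
  exact frame_le _ (norm_dirv θ)

theorem diagEC_subset :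
    diagEC ⊆ { p : ℝ × ℝ | π * dEig1 unitDisc ≤ p.1 ∧ π^4 / (4 * p.1) < p.2 ∧
      p.2 ≤ min (π * nEig1 unitDisc) (9 * π^2 * dEig1 unitDisc / p.1) } := by
  rintro p ⟨Ω, hne, ho, hb, hc, rfl⟩
  obtain ⟨hl, hlow⟩ := lower_hyp ho hb hc hne
  have hup := upper_hyp ho hb hc hne
  have hA : 0 < (volume Ω).toReal := vol_pos ho hb hne
  have hx : 0 < (volume Ω).toReal * dEig1 Ω := mul_pos hA hl
  refine ⟨faber_krahn ho hb hne, ?_, le_min ?_ ?_⟩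
  · simp only
    rw [div_lt_iff₀ (by positivity)]
    nlinarith
  · exact (weinberger_upper ho hb hne).trans (mul_le_mul_of_nonneg_left disc_lower pi_pos.le)
  · simp only
    rw [le_div_iff₀ hx]
    nlinarith
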